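/- arXiv:1806.03926 — 4 statements merged into one kernel-verified Lean document; each statement's English description precedes it below -/
import Mathlib

section
/- Let k > 0, let Z be a random variable whose distribution belongs to GGC(k), i.e. it is a generalized gamma convolution with left extremity a = 0 and total U-measure U((0,∞)) ≤ k, and let X be an independent positive random variable whose density is hyperbolically monotone of order k (HM_k). Then the distribution of the quotient Z/X is a generalized gamma convolution (GGC). -/
open MeasureTheory ProbabilityTheory Real

noncomputable section

/-- A probability measure on `[0,∞)` is a generalized gamma convolution (GGC) if its
Laplace transform has the Thorin form. -/
def IsGGC (μ : Measure ℝ) : Prop :=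
  IsProbabilityMeasure μ ∧ μ (Set.Iio 0) = 0 ∧
  ∃ (a : ℝ) (U : Measure ℝ),
    0 ≤ a ∧ U (Set.Iic 0) = 0 ∧
    (∀ r s : ℝ, 0 < r → U (Set.Icc r s) < ⊤) ∧
    (∫⁻ t in Set.Ioc (0:ℝ) 1, ENNReal.ofReal |Real.log t| ∂U) < ⊤ ∧
    (∫⁻ t in Set.Ici (1:ℝ), ENNReal.ofReal t⁻¹ ∂U) < ⊤ ∧
    ∀ s : ℝ, 0 ≤ s →
      (∫ x, Real.exp (-s * x) ∂μ) =
        Real.exp (-(a * s) + ∫ t in Set.Ioi (0:ℝ), Real.log (t / (t + s)) ∂U)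

/-- A probability density `f` on `(0,∞)` is hyperbolically monotone of order `k` (`HM_k`). -/
def IsHMDensity (k : ℝ) (f : ℝ → ℝ) : Prop :=
  (∀ x, 0 ≤ f x) ∧ (∫⁻ x in Set.Ioi (0:ℝ), ENNReal.ofReal (f x)) = 1 ∧
  ∀ u : ℝ, 0 < u → ∃ H : Measure ℝ,
    ∀ v : ℝ, 0 < v →
      ENNReal.ofReal (f (u * v) * f (u / v)) =
        ∫⁻ lam in Set.Ioi (v + v⁻¹), ENNReal.ofReal ((lam - (v + v⁻¹)) ^ (k - 1)) ∂H

/-- The random variable `X` has density `f` (with respect to Lebesgue measure) on `(0,∞)`. -/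
def HasDensityOn {Ω : Type*} [MeasurableSpace Ω] (P : Measure Ω) (X : Ω → ℝ)
    (f : ℝ → ℝ) : Prop :=
  Measure.map X P =
    (volume.restrict (Set.Ioi (0:ℝ))).withDensity (fun x => ENNReal.ofReal (f x))

/-- The `Gamma(k, r)` distribution, with density `r^k Γ(k)⁻¹ x^(k-1) e^(-r x)` on `(0,∞)`. -/
def gammaMeas (k r : ℝ) : Measure ℝ :=
  (volume.restrict (Set.Ioi (0:ℝ))).withDensity
    (fun x => ENNReal.ofReal (r ^ k / Real.Gamma k * x ^ (k - 1) * Real.exp (-(r * x))))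

/-- `g` is completely monotone on `(0,∞)`:  infinitely differentiable with
`(-1)^n g^(n)(T) ≥ 0` for all `T > 0` and `n ≥ 0`. -/
def CompletelyMonotoneOn (g : ℝ → ℝ) : Prop :=
  ContDiffOn ℝ (⊤ : ℕ∞) g (Set.Ioi 0) ∧
  ∀ (n : ℕ) (T : ℝ), 0 < T →
    0 ≤ (-1 : ℝ) ^ n * iteratedDerivWithin n g (Set.Ioi 0) T

end
noncomputable section

/-- `GGC(k)`: a GGC with left extremity `a = 0` and total `U`-measure at most `k`. -/
def IsGGCk (k : ℝ) (μ : Measure ℝ) : Prop :=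
  IsProbabilityMeasure μ ∧ μ (Set.Iio 0) = 0 ∧
  ∃ U : Measure ℝ,
    U (Set.Iic 0) = 0 ∧
    (∀ r s : ℝ, 0 < r → U (Set.Icc r s) < ⊤) ∧
    (∫⁻ t in Set.Ioc (0:ℝ) 1, ENNReal.ofReal |Real.log t| ∂U) < ⊤ ∧
    (∫⁻ t in Set.Ici (1:ℝ), ENNReal.ofReal t⁻¹ ∂U) < ⊤ ∧
    U (Set.Ioi 0) ≤ ENNReal.ofReal k ∧
    ∀ s : ℝ, 0 ≤ s →
      (∫ x, Real.exp (-s * x) ∂μ) =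
        Real.exp (∫ t in Set.Ioi (0:ℝ), Real.log (t / (t + s)) ∂U)

end

open scoped NNReal ENNReal

theorem differentiableOn_integral_of_locally_dominated {α : Type*} [MeasurableSpace α]
    {μ : Measure α} {f : ℂ → α → ℂ} {Ω : Set ℂ} (hΩ : IsOpen Ω)
    (hmeas : ∀ z ∈ Ω, AEStronglyMeasurable (f z) μ)
    (hd : ∀ᵐ a ∂μ, DifferentiableOn ℂ (fun z => f z a) Ω)
    {C : ℂ → ℝ} (hC : ContinuousOn C Ω) {g : α → ℝ} (hg : Integrable g μ)
    (hb : ∀ᵐ a ∂μ, ∀ z ∈ Ω, ‖f z a‖ ≤ C z * g a) :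
    DifferentiableOn ℂ (fun z => ∫ a, f z a ∂μ) Ω := by
  intro z₀ hz₀
  obtain ⟨ε, hε, hball⟩ := Metric.isOpen_iff.1 hΩ z₀ hz₀
  have hsub : Metric.closedBall z₀ (ε / 2) ⊆ Ω :=
    (Metric.closedBall_subset_ball (by linarith)).trans hball
  obtain ⟨M, hM⟩ := (isCompact_closedBall z₀ (ε / 2)).exists_bound_of_continuousOn (hC.mono hsub)
  have hball4 : Metric.ball z₀ (ε / 4) ⊆ Ω :=
    (Metric.ball_subset_ball (by linarith)).trans hball
  have hbd : ∀ᵐ a ∂μ, ∀ z ∈ Metric.closedBall z₀ (ε / 2), ‖f z a‖ ≤ M * |g a| := by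
    filter_upwards [hb] with a ha z hz
    calc ‖f z a‖ ≤ C z * g a := ha z (hsub hz)
      _ ≤ |C z * g a| := le_abs_self _
      _ = ‖C z‖ * |g a| := by rw [abs_mul, Real.norm_eq_abs]
      _ ≤ M * |g a| := by gcongr; exact hM z hz
  have hdiff : ∀ᵐ a ∂μ, ∀ z ∈ Metric.ball z₀ (ε / 4),
      HasDerivAt (fun z => f z a) (deriv (fun z => f z a) z) z := by
    filter_upwards [hd] with a ha z hz
    exact (ha.differentiableAt (hΩ.mem_nhds (hball4 hz))).hasDerivAt
  have key := hasDerivAt_integral_of_dominated_loc_of_deriv_le (μ := μ) (F := f)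
    (F' := fun z a => deriv (fun z => f z a) z) (bound := fun a => M * |g a| / (ε / 4))
    (Metric.ball_mem_nhds z₀ (by positivity : 0 < ε / 4)) ?_ ?_ ?_ ?_ ?_ hdiff
  · exact key.2.differentiableAt.differentiableWithinAt
  · filter_upwards [hΩ.mem_nhds hz₀] with z hz using hmeas z hz
  · refine Integrable.mono' (hg.abs.const_mul M) (hmeas z₀ hz₀) ?_
    filter_upwards [hbd] with a ha using ha z₀ (Metric.mem_closedBall_self (by positivity))
  · have htend : Filter.Tendsto (fun n : ℕ => ((ε / 4 * (1 / ((n : ℝ) + 2)) : ℝ) : ℂ)) Filter.atTop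
        (nhdsWithin 0 {0}ᶜ) := by
      refine tendsto_nhdsWithin_iff.2 ⟨?_, Filter.Eventually.of_forall fun n => ?_⟩
      · have h1 : Filter.Tendsto (fun n : ℕ => (ε / 4 * (1 / ((n : ℝ) + 2)) : ℝ)) Filter.atTop
            (nhds 0) := by
          have := (tendsto_const_nhds (x := ε / 4)).mul ((tendsto_one_div_add_atTop_nhds_zero_nat (𝕜 := ℝ)).comp
            (Filter.tendsto_add_atTop_nat 1))
          simp only [mul_zero] at this
          refine this.congr fun n => ?_
          simp only [Function.comp, Nat.cast_add, Nat.cast_one]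
          ring
        have := (Complex.continuous_ofReal.tendsto 0).comp h1
        simpa [Function.comp_def] using this
      · simp only [Set.mem_compl_iff, Set.mem_singleton_iff, Complex.ofReal_eq_zero]
        positivity
    refine aestronglyMeasurable_of_tendsto_ae Filter.atTop
      (f := fun (n : ℕ) a => ((ε / 4 * (1 / ((n : ℝ) + 2)) : ℝ) : ℂ)⁻¹ •
        (f (z₀ + ((ε / 4 * (1 / ((n : ℝ) + 2)) : ℝ) : ℂ)) a - f z₀ a)) (fun n => ?_) ?_
    · refine AEStronglyMeasurable.const_smul
        (f := fun a => f (z₀ + ((ε / 4 * (1 / ((n : ℝ) + 2)) : ℝ) : ℂ)) a - f z₀ a)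
        ((hmeas _ (hball4 ?_)).sub (hmeas z₀ hz₀))
        (((ε / 4 * (1 / ((n : ℝ) + 2)) : ℝ) : ℂ)⁻¹)
      rw [Metric.mem_ball, dist_eq_norm, add_sub_cancel_left, Complex.norm_real, Real.norm_eq_abs,
        abs_of_pos (by positivity)]
      have : (1 / ((n : ℝ) + 2)) < 1 := by
        rw [div_lt_one (by positivity)]; linarith [(Nat.cast_nonneg n : (0:ℝ) ≤ n)]
      nlinarith
    · filter_upwards [hdiff] with a ha
      exact (ha z₀ (Metric.mem_ball_self (by positivity))).tendsto_slope_zero.comp htend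
  · filter_upwards [hbd, hd] with a ha hda z hz
    have hsub2 : Metric.closedBall z (ε / 4) ⊆ Metric.closedBall z₀ (ε / 2) := by
      refine Metric.closedBall_subset_closedBall' ?_
      have := Metric.mem_ball.1 hz
      linarith
    refine Complex.norm_deriv_le_of_forall_mem_sphere_norm_le (by positivity) ?_ ?_
    · refine DifferentiableOn.diffContOnCl ?_
      rw [closure_ball _ (by positivity)]
      exact hda.mono (hsub2.trans hsub)
    · intro w hw
      exact ha w (hsub2 (Metric.sphere_subset_closedBall hw))
  · exact (hg.abs.const_mul M).div_const _

theorem typicallyReal_kernel_circle {z α : ℝ} (hz : |z| < 1) :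
    Complex.exp (α * Complex.I) / (Complex.exp (α * Complex.I) - z)
      - (1 - z * Complex.exp (α * Complex.I))⁻¹ =
    -2 * Complex.I * ((z * Real.sin α / (1 - 2 * z * Real.cos α + z ^ 2) : ℝ) : ℂ) := by
  have hz1 := abs_lt.1 hz
  have hcs := Real.sin_sq_add_cos_sq α
  have hD : 0 < 1 - 2 * z * Real.cos α + z ^ 2 := by
    have h1 : (z * Real.cos α) ≤ |z| := by
      calc z * Real.cos α ≤ |z * Real.cos α| := le_abs_self _
        _ = |z| * |Real.cos α| := abs_mul _ _
        _ ≤ |z| * 1 := by gcongr; exact Real.abs_cos_le_one α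
        _ = |z| := mul_one _
    have h2 : z ^ 2 = |z| ^ 2 := (sq_abs z).symm
    nlinarith [abs_nonneg z]
  have hDc : ((1 : ℂ) - 2 * z * Complex.cos α + z ^ 2) ≠ 0 := by
    have : ((1 - 2 * z * Real.cos α + z ^ 2 : ℝ) : ℂ) ≠ 0 := by exact_mod_cast hD.ne'
    simpa using this
  have hcsc : Complex.sin α ^ 2 + Complex.cos α ^ 2 = 1 := Complex.sin_sq_add_cos_sq _
  have hI := Complex.I_sq
  set c := Complex.cos α with hc
  set s := Complex.sin α with hs
  have he : Complex.exp (α * Complex.I) = c + s * Complex.I := Complex.exp_mul_I _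
  have h1 : (1 - z * (c + s * Complex.I)) * (1 - z * (c - s * Complex.I)) =
      1 - 2 * z * c + z ^ 2 := by
    linear_combination (z : ℂ) ^ 2 * hcsc - z ^ 2 * s ^ 2 * hI
  have h2 : (c + s * Complex.I - z) * (1 - z * (c + s * Complex.I)) =
      (c + s * Complex.I) * (1 - 2 * z * c + z ^ 2) := by
    linear_combination (z : ℂ) * hcsc - z * s ^ 2 * hI
  have hne1 : (1 - z * (c + s * Complex.I)) ≠ 0 := by
    intro h; rw [h, zero_mul] at h1; exact hDc h1.symm
  have hne3 : (1 - z * (c - s * Complex.I)) ≠ 0 := by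
    intro h; rw [h, mul_zero] at h1; exact hDc h1.symm
  have hene : c + s * Complex.I ≠ 0 := by rw [← he]; exact Complex.exp_ne_zero _
  have hne2 : (c + s * Complex.I - z) ≠ 0 := by
    intro h; rw [h, zero_mul] at h2; exact mul_ne_zero hene hDc h2.symm
  push_cast
  rw [he, ← hc, ← hs]
  have h3 : (1 - z * (c + s * Complex.I))⁻¹ = (1 - z * (c - s * Complex.I)) / (1 - 2 * z * c + z ^ 2) := by
    rw [← h1]
    exact (inv_eq_iff_eq_inv.2 (by
      rw [inv_div, mul_div_assoc, div_self hne3, mul_one]))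
  have h4 : (c + s * Complex.I) / (c + s * Complex.I - z) = (1 - z * (c + s * Complex.I)) / (1 - 2 * z * c + z ^ 2) := by
    rw [div_eq_div_iff hne2 hDc]
    linear_combination -h2
  rw [h3, h4]
  field_simp
  ring

theorem typicallyReal_circle_formula {g : ℂ → ℂ} (hg : DiffContOnCl ℂ g (Metric.ball 0 1))
    {z : ℝ} (hz : |z| < 1) :
    (g z).re - (g 0).re = ∫ α in Set.Ioc 0 (2 * π), z / (1 - 2 * z * Real.cos α + z ^ 2) *
      (π⁻¹ * ((g (Complex.exp (α * Complex.I))).im * Real.sin α)) := by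
  have hz1 := abs_lt.1 hz
  have hzb : (z : ℂ) ∈ Metric.ball (0 : ℂ) |1| := by simpa using hz
  have e1 := DiffContOnCl.circleAverage_smul_div (c := 0) (R := 1) (by simpa using hg) hzb
  have hne : ∀ w ∈ Metric.closedBall (0 : ℂ) 1, 1 - z * w ≠ 0 := by
    intro w hw h
    have h1 : (z : ℂ) * w = 1 := by linear_combination -h
    have h2 : ‖(z : ℂ) * w‖ < 1 := by
      rw [norm_mul, Complex.norm_real, Real.norm_eq_abs]
      have : ‖w‖ ≤ 1 := by simpa using hw
      calc |z| * ‖w‖ ≤ |z| * 1 := by gcongr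
        _ < 1 := by simpa using hz
    rw [h1] at h2; simp at h2
  have hcl : closure (Metric.ball (0 : ℂ) 1) = Metric.closedBall 0 1 := closure_ball _ one_ne_zero
  have hinv : DiffContOnCl ℂ (fun w : ℂ => (1 - z * w)⁻¹) (Metric.ball 0 1) := by
    refine DifferentiableOn.diffContOnCl ?_
    rw [hcl]
    intro w hw
    have h1 : DifferentiableAt ℂ (fun w : ℂ => 1 - z * w) w := by fun_prop
    exact (h1.inv (hne w hw)).differentiableWithinAt
  have e2 := DiffContOnCl.circleAverage (c := 0) (R := 1) (f := fun w => (1 - z * w)⁻¹ • g w)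
    (by simpa using hinv.smul hg)
  have hgc : ContinuousOn g (Metric.closedBall 0 1) := hcl ▸ hg.continuousOn
  have hcm : Continuous (circleMap 0 1) := continuous_circleMap 0 1
  have hcmem : ∀ α, circleMap 0 1 α ∈ Metric.closedBall (0 : ℂ) 1 := fun α =>
    Metric.sphere_subset_closedBall (circleMap_mem_sphere 0 zero_le_one α)
  have hgcm : Continuous fun α => g (circleMap 0 1 α) :=
    hgc.comp_continuous hcm hcmem
  have hne2 : ∀ α, circleMap 0 1 α - z ≠ 0 := by
    intro α h
    have h1 := circleMap_mem_sphere (0 : ℂ) zero_le_one α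
    rw [sub_eq_zero.1 h] at h1
    simp at h1
    linarith
  rw [Real.circleAverage_def] at e1 e2
  have hc1 : Continuous fun α => ((circleMap 0 1 α - 0) / (circleMap 0 1 α - z)) • g (circleMap 0 1 α) :=
    ((hcm.sub continuous_const).div (hcm.sub continuous_const) hne2).smul hgcm
  have hc2 : Continuous fun α => (1 - z * circleMap 0 1 α)⁻¹ • g (circleMap 0 1 α) :=
    ((continuous_const.sub (continuous_const.mul hcm)).inv₀ (fun α => hne _ (hcmem α))).smul hgcm
  have e3 := congrArg₂ (· - ·) e1 e2
  simp only [← smul_sub] at e3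
  rw [← intervalIntegral.integral_sub (hc1.intervalIntegrable _ _) (hc2.intervalIntegrable _ _)] at e3
  have e4 : ∀ α : ℝ, ((circleMap 0 1 α - 0) / (circleMap 0 1 α - z)) • g (circleMap 0 1 α)
      - (1 - z * circleMap 0 1 α)⁻¹ • g (circleMap 0 1 α) =
      (-2 * Complex.I * ((z * Real.sin α / (1 - 2 * z * Real.cos α + z ^ 2) : ℝ) : ℂ)) *
        g (Complex.exp (α * Complex.I)) := by
    intro α
    rw [← typicallyReal_kernel_circle hz]
    simp only [circleMap, smul_eq_mul, Complex.ofReal_one, one_mul, zero_add, sub_zero]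
    ring
  have h_int : IntervalIntegrable (fun α : ℝ =>
      (-2 * Complex.I * ((z * Real.sin α / (1 - 2 * z * Real.cos α + z ^ 2) : ℝ) : ℂ)) *
        g (Complex.exp (α * Complex.I))) volume 0 (2 * π) := by
    have := (hc1.sub hc2).intervalIntegrable (μ := volume) 0 (2 * π)
    exact this.congr (fun α _ => e4 α)
  simp only [e4] at e3
  have e5 := congrArg Complex.re e3
  simp only [mul_zero, sub_zero, inv_one, one_smul, Complex.sub_re] at e5
  rw [← e5, Complex.smul_re, ← Complex.reCLM_apply,
    ← ContinuousLinearMap.intervalIntegral_comp_comm _ h_int,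
    ← intervalIntegral.integral_smul, intervalIntegral.integral_of_le (by positivity)]
  refine integral_congr_ae (Filter.Eventually.of_forall fun α => ?_)
  simp only [Complex.reCLM_apply, smul_eq_mul, Complex.mul_re, Complex.mul_im, Complex.I_re, Complex.I_im, Complex.ofReal_re,
    Complex.ofReal_im, Complex.neg_re, Complex.neg_im, Complex.re_ofNat, Complex.im_ofNat]
  have := Real.pi_pos
  field_simp
  ring

theorem typicallyReal_kernel_pos {z x : ℝ} (hx : x ∈ Set.Icc (-1 : ℝ) 1) :
    (1 - |z|) ^ 2 ≤ 1 - 2 * z * x + z ^ 2 := by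
  have h1 : z * x ≤ |z| := by
    calc z * x ≤ |z * x| := le_abs_self _
      _ = |z| * |x| := abs_mul _ _
      _ ≤ |z| * 1 := by gcongr; exact abs_le.2 hx
      _ = |z| := mul_one _
  nlinarith [sq_abs z]

theorem exists_finiteMeasure_of_circle {g : ℂ → ℂ} (hg : DiffContOnCl ℂ g (Metric.ball 0 1))
    (hpos : ∀ z ∈ Metric.closedBall (0 : ℂ) 1, 0 ≤ (g z).im * z.im) :
    ∃ μ : FiniteMeasure ℝ, μ (Set.Icc (-1 : ℝ) 1)ᶜ = 0 ∧
      ∀ z : ℝ, |z| < 1 → (g z).re - (g 0).re = ∫ x, z / (1 - 2 * z * x + z ^ 2) ∂(μ : Measure ℝ) := by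
  have hgc : ContinuousOn g (Metric.closedBall 0 1) := by
    have hcl : closure (Metric.ball (0 : ℂ) 1) = Metric.closedBall 0 1 := closure_ball _ one_ne_zero
    exact hcl ▸ hg.continuousOn
  have hmem : ∀ α : ℝ, Complex.exp (α * Complex.I) ∈ Metric.closedBall (0 : ℂ) 1 := fun α => by
    simp [Complex.norm_exp_ofReal_mul_I]
  set d : ℝ → ℝ := fun α => π⁻¹ * ((g (Complex.exp (α * Complex.I))).im * Real.sin α) with hd
  have hdc : Continuous d := by
    have : Continuous fun α : ℝ => g (Complex.exp (α * Complex.I)) :=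
      hgc.comp_continuous (by fun_prop) hmem
    have h2 : Continuous fun α : ℝ => (g (Complex.exp (α * Complex.I))).im :=
      Complex.continuous_im.comp this
    fun_prop
  have hd0 : ∀ α, 0 ≤ d α := fun α => by
    have := hpos _ (hmem α)
    rw [Complex.exp_ofReal_mul_I_im] at this
    have := Real.pi_pos
    positivity
  set ν : Measure ℝ := (volume.restrict (Set.Ioc 0 (2 * π))).withDensity
    (fun α => ENNReal.ofReal (d α)) with hν
  have hdi : IntegrableOn d (Set.Ioc 0 (2 * π)) :=
    (hdc.integrableOn_Icc).mono_set Set.Ioc_subset_Icc_self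
  have hfin : IsFiniteMeasure ν := isFiniteMeasure_withDensity_ofReal hdi.2
  have hmap : IsFiniteMeasure (ν.map Real.cos) := inferInstance
  obtain ⟨m, hm⟩ : ∃ m : FiniteMeasure ℝ, (m : Measure ℝ) = ν.map Real.cos := ⟨⟨_, hmap⟩, rfl⟩
  refine ⟨m, ?_, fun z hz => ?_⟩
  · rw [FiniteMeasure.null_iff_toMeasure_null, hm, Measure.map_apply Real.measurable_cos measurableSet_Icc.compl]
    convert measure_empty (μ := ν)
    ext α
    simp [Real.neg_one_le_cos α, Real.cos_le_one α]
  · rw [hm, typicallyReal_circle_formula hg hz,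
      integral_map Real.measurable_cos.aemeasurable
        (by refine Measurable.aestronglyMeasurable ?_; fun_prop),
      hν, integral_withDensity_eq_integral_toReal_smul (by fun_prop) (by simp)]
    refine integral_congr_ae (Filter.Eventually.of_forall fun α => ?_)
    simp only [ENNReal.toReal_ofReal (hd0 α), smul_eq_mul]
    ring

theorem exists_finiteMeasure_of_typicallyReal {f : ℂ → ℂ}
    (hf : DifferentiableOn ℂ f (Metric.ball 0 1))
    (hpos : ∀ z ∈ Metric.ball (0 : ℂ) 1, 0 ≤ (f z).im * z.im) :
    ∃ μ : FiniteMeasure ℝ, μ (Set.Icc (-1 : ℝ) 1)ᶜ = 0 ∧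
      ∀ z : ℝ, |z| < 1 → (f z).re - (f 0).re = ∫ x, z / (1 - 2 * z * x + z ^ 2) ∂(μ : Measure ℝ) := by
  set r : ℕ → ℝ := fun n => 1 - 1 / ((n : ℝ) + 2) with hr
  have hr1 : ∀ n, r n < 1 := fun n => by
    simp only [hr]; linarith [one_div_pos.2 (by positivity : (0:ℝ) < (n : ℝ) + 2)]
  have hr0 : ∀ n, 0 < r n := fun n => by
    simp only [hr, sub_pos]
    rw [div_lt_one (by positivity)]
    linarith [(Nat.cast_nonneg n : (0:ℝ) ≤ n)]
  have hrt : Filter.Tendsto r Filter.atTop (nhds 1) := by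
    have := (tendsto_const_nhds (x := (1:ℝ))).sub
      ((tendsto_one_div_add_atTop_nhds_zero_nat (𝕜 := ℝ)).comp (Filter.tendsto_add_atTop_nat 1))
    rw [sub_zero] at this
    refine this.congr fun n => ?_
    simp only [hr, Function.comp, Nat.cast_add, Nat.cast_one]
    ring
  have hin : ∀ n, ∀ z ∈ Metric.closedBall (0 : ℂ) 1, (r n : ℂ) * z ∈ Metric.ball (0 : ℂ) 1 := by
    intro n z hz
    have : ‖z‖ ≤ 1 := by simpa using hz
    rw [mem_ball_zero_iff, norm_mul, Complex.norm_real, Real.norm_eq_abs, abs_of_pos (hr0 n)]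
    calc r n * ‖z‖ ≤ r n * 1 := by gcongr; exact (hr0 n).le
      _ < 1 := by linarith [hr1 n]
  have hex : ∀ n, ∃ μ : FiniteMeasure ℝ, μ (Set.Icc (-1 : ℝ) 1)ᶜ = 0 ∧
      ∀ z : ℝ, |z| < 1 → (f (r n * z)).re - (f 0).re =
        ∫ x, z / (1 - 2 * z * x + z ^ 2) ∂(μ : Measure ℝ) := by
    intro n
    have := exists_finiteMeasure_of_circle (g := fun z => f (r n * z)) ?_ ?_
    · simpa using this
    · refine DifferentiableOn.diffContOnCl ?_
      rw [closure_ball _ one_ne_zero]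
      exact hf.comp (by fun_prop) (hin n)
    · intro z hz
      have h0 := hpos _ (hin n z hz)
      simp only [Complex.mul_im, Complex.ofReal_re, Complex.ofReal_im, zero_mul, add_zero] at h0
      have : 0 ≤ r n * ((f (r n * z)).im * z.im) := by linarith
      exact nonneg_of_mul_nonneg_right this (hr0 n)
  choose μ hμ0 hμ using hex
  have hlim : ∀ z : ℝ, |z| < 1 →
      Filter.Tendsto (fun n => (f (r n * z)).re - (f 0).re) Filter.atTop
        (nhds ((f z).re - (f 0).re)) := by
    intro z hz
    have h1 : ContinuousAt f z := (hf.differentiableAt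
      (Metric.isOpen_ball.mem_nhds (by simpa using hz))).continuousAt
    have h2 : Filter.Tendsto (fun n => (r n : ℂ) * z) Filter.atTop (nhds (z : ℂ)) := by
      have := ((Complex.continuous_ofReal.tendsto 1).comp hrt).mul_const (z : ℂ)
      simpa [Function.comp_def] using this
    exact ((Complex.continuous_re.tendsto _).comp (h1.tendsto.comp h2)).sub_const _
  have hae : ∀ n, ∀ᵐ x ∂(μ n : Measure ℝ), x ∈ Set.Icc (-1 : ℝ) 1 := fun n => by
    rw [ae_iff]
    exact (FiniteMeasure.null_iff_toMeasure_null _ _).1 (hμ0 n)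
  set κ : ℝ → ℝ → ℝ := fun z x => z / (1 - 2 * z * (max (-1) (min x 1)) + z ^ 2) with hκ
  have hclip : ∀ x : ℝ, max (-1) (min x 1) ∈ Set.Icc (-1 : ℝ) 1 := fun x =>
    ⟨le_max_left _ _, max_le (by norm_num) (min_le_right _ _)⟩
  have hclipeq : ∀ z, ∀ x ∈ Set.Icc (-1 : ℝ) 1, κ z x = z / (1 - 2 * z * x + z ^ 2) := by
    intro z x hx
    simp only [hκ, min_eq_left hx.2, max_eq_right hx.1]
  have hden : ∀ z : ℝ, |z| < 1 → ∀ x : ℝ, (1 - |z|) ^ 2 ≤ 1 - 2 * z * (max (-1) (min x 1)) + z ^ 2 :=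
    fun z _ x => typicallyReal_kernel_pos (hclip x)
  have hpos2 : ∀ z : ℝ, |z| < 1 → 0 < (1 - |z|) ^ 2 := fun z hz => by
    have : 0 < 1 - |z| := by linarith
    positivity
  have hκc : ∀ z : ℝ, |z| < 1 → Continuous (κ z) := by
    intro z hz
    refine continuous_const.div (by fun_prop) fun x => ?_
    exact ((hpos2 z hz).trans_le (hden z hz x)).ne'
  have hκb : ∀ z : ℝ, |z| < 1 → ∀ x, ‖κ z x‖ ≤ ((1 - |z|) ^ 2)⁻¹ := by
    intro z hz x
    have h1 := hden z hz x
    have h2 := hpos2 z hz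
    simp only [hκ, norm_div, Real.norm_eq_abs]
    rw [abs_of_pos (h2.trans_le h1), ← one_div]
    exact div_le_div₀ zero_le_one hz.le h2 h1
  have h_int : ∀ z : ℝ, |z| < 1 → ∀ n, (f (r n * z)).re - (f 0).re = ∫ x, κ z x ∂(μ n : Measure ℝ) := by
    intro z hz n
    rw [hμ n z hz]
    refine integral_congr_ae ?_
    filter_upwards [hae n] with x hx using (hclipeq z x hx).symm
  have hh : |(1/2:ℝ)| < 1 := by rw [abs_of_pos] <;> norm_num
  obtain ⟨C, hC⟩ : ∃ C : ℝ≥0, ∀ n, (μ n).mass ≤ C := by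
    obtain ⟨M, hM⟩ := (hlim (1/2) hh).bddAbove_range
    refine ⟨Real.toNNReal (9 / 2 * M), fun n => ?_⟩
    have h1 : (f (r n * (1/2:ℝ))).re - (f 0).re ≤ M := hM ⟨n, rfl⟩
    rw [h_int _ hh n] at h1
    have h2 : ∫ x, (2 / 9 : ℝ) ∂(μ n : Measure ℝ) ≤ ∫ x, κ (1/2) x ∂(μ n : Measure ℝ) := by
      refine integral_mono (integrable_const _) ?_ fun x => ?_
      · exact Integrable.of_bound (hκc _ hh).aestronglyMeasurable _
          (Filter.Eventually.of_forall (hκb _ hh))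
      · have h3 := hden (1/2) hh x
        have h4 := hclip x
        have h5 := (hpos2 (1/2) hh).trans_le h3
        simp only [hκ]
        rw [le_div_iff₀ h5]
        linarith [h4.1]
    rw [integral_const, smul_eq_mul] at h2
    have h6 : ((μ n).mass : ℝ) ≤ 9 / 2 * M := by
      have : (μ n : Measure ℝ).real Set.univ = ((μ n).mass : ℝ) := rfl
      rw [this] at h2
      linarith
    exact (NNReal.le_toNNReal_of_coe_le h6)
  obtain ⟨m, hmem, hle⟩ := (isCompact_setOfPred_finiteMeasure_le_of_isCompact C
    (isCompact_Icc (a := (-1:ℝ)) (b := 1))).ultrafilter_le_nhds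
      ((Filter.hyperfilter ℕ).map μ) (by
        rw [Filter.le_principal_iff]
        exact Filter.mem_map.2 (Filter.Eventually.of_forall fun n => ⟨hC n, hμ0 n⟩))
  have hmt : Filter.Tendsto μ (Filter.hyperfilter ℕ : Filter ℕ) (nhds m) := hle
  refine ⟨m, hmem.2, fun z hz => ?_⟩
  have t1 := (FiniteMeasure.tendsto_iff_forall_integral_tendsto.1 hmt)
    (BoundedContinuousFunction.ofNormedAddCommGroup (κ z) (hκc z hz) _ (hκb z hz))
  have t2 := (hlim z hz).mono_left (Nat.hyperfilter_le_atTop)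
  simp only [BoundedContinuousFunction.coe_ofNormedAddCommGroup, ← h_int z hz] at t1
  rw [tendsto_nhds_unique t2 t1]
  refine integral_congr_ae ?_
  have : ∀ᵐ x ∂(m : Measure ℝ), x ∈ Set.Icc (-1 : ℝ) 1 := by
    rw [ae_iff]
    exact (FiniteMeasure.null_iff_toMeasure_null _ _).1 hmem.2
  filter_upwards [this] with x hx using hclipeq z x hx

theorem lintegral_inv_add_Ioc {s t : ℝ} (hs : 0 ≤ s) (ht : 0 < t) :
    ∫⁻ y in Set.Ioc 0 s, ENNReal.ofReal (1 / (y + t)) = ENNReal.ofReal (Real.log ((t + s) / t)) := by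
  have hder : ∀ y ∈ Set.uIcc 0 s, HasDerivAt (fun y => Real.log (y + t)) (1 / (y + t)) y := by
    intro y hy
    rw [Set.uIcc_of_le hs] at hy
    exact ((hasDerivAt_id y).add_const t).log (by simp; linarith [hy.1])
  have hc : ContinuousOn (fun y => 1 / (y + t)) (Set.uIcc 0 s) := by
    refine continuousOn_const.div (by fun_prop) fun y hy => ?_
    rw [Set.uIcc_of_le hs] at hy
    linarith [hy.1]
  have h := intervalIntegral.integral_eq_sub_of_hasDerivAt hder hc.intervalIntegrable
  rw [zero_add, ← Real.log_div (by positivity) (by positivity),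
    intervalIntegral.integral_of_le hs] at h
  rw [add_comm t s, ← h, ofReal_integral_eq_lintegral_ofReal]
  · exact hc.intervalIntegrable.1
  · refine (ae_restrict_iff' measurableSet_Ioc).2 (Filter.Eventually.of_forall fun y hy => ?_)
    have := hy.1
    simp only [Pi.zero_apply]
    positivity

theorem ofReal_eq_lintegral_log_of_hasDerivAt {L b : ℝ → ℝ} (hL0 : L 0 = 0)
    (hLc : ContinuousOn L (Set.Ici 0)) (hb0 : ∀ s, 0 < s → 0 ≤ b s)
    (hd : ∀ s, 0 < s → HasDerivAt L (b s / s) s) {c a : ℝ} (hc : 0 ≤ c) (ha : 0 ≤ a)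
    {U : Measure ℝ} [SFinite U] (hU : U (Set.Iic 0) = 0)
    (hb : ∀ s, 0 < s → ENNReal.ofReal (b s) =
      ENNReal.ofReal c + ENNReal.ofReal (a * s) + ∫⁻ t, ENNReal.ofReal (s / (s + t)) ∂U)
    {s : ℝ} (hs : 0 ≤ s) :
    ENNReal.ofReal (L s) = ENNReal.ofReal (a * s) +
      ∫⁻ t, ENNReal.ofReal (Real.log ((t + s) / t)) ∂U := by
  have hLI : ∀ s, 0 ≤ s → ENNReal.ofReal (L s) = ∫⁻ y in Set.Ioc 0 s, ENNReal.ofReal (b y / y) := by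
    intro s hs
    have hi : IntegrableOn (fun y => b y / y) (Set.Ioc 0 s) :=
      intervalIntegral.integrableOn_deriv_of_nonneg (hLc.mono fun y hy => hy.1)
        (fun y hy => hd y hy.1) fun y hy => div_nonneg (hb0 y hy.1) hy.1.le
    have h := intervalIntegral.integral_eq_sub_of_hasDerivAt_of_le hs (hLc.mono fun y hy => hy.1)
      (fun y hy => hd y hy.1) ((intervalIntegrable_iff_integrableOn_Ioc_of_le hs).2 hi)
    rw [hL0, sub_zero, intervalIntegral.integral_of_le hs] at h
    rw [← h, ofReal_integral_eq_lintegral_ofReal hi]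
    refine (ae_restrict_iff' measurableSet_Ioc).2 (Filter.Eventually.of_forall fun y hy => ?_)
    exact div_nonneg (hb0 y hy.1) hy.1.le
  have haeU : ∀ᵐ t ∂U, 0 < t := by
    rw [ae_iff]; simpa [Set.Iic, not_lt] using hU
  have key : ∀ s, 0 ≤ s → ENNReal.ofReal (L s) =
      (∫⁻ y in Set.Ioc 0 s, ENNReal.ofReal (c / y)) + ENNReal.ofReal (a * s) +
      ∫⁻ t, ENNReal.ofReal (Real.log ((t + s) / t)) ∂U := by
    intro s hs
    rw [hLI s hs]
    have e1 : ∀ y ∈ Set.Ioc 0 s, ENNReal.ofReal (b y / y) =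
        ENNReal.ofReal (c / y) + ENNReal.ofReal a + ∫⁻ t, ENNReal.ofReal (1 / (y + t)) ∂U := by
      intro y hy
      have hy0 := hy.1
      rw [ENNReal.ofReal_div_of_pos hy0, hb y hy0, ENNReal.div_eq_inv_mul, mul_add, mul_add,
        ← ENNReal.ofReal_inv_of_pos hy0, ← ENNReal.ofReal_mul (by positivity),
        ← ENNReal.ofReal_mul (by positivity), ← lintegral_const_mul _ (by fun_prop)]
      congr 1
      · congr 2 <;> field_simp
      · refine lintegral_congr_ae ?_
        filter_upwards [haeU] with t ht
        rw [← ENNReal.ofReal_mul (by positivity)]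
        congr 1
        field_simp
    rw [setLIntegral_congr_fun measurableSet_Ioc e1, lintegral_add_left (by fun_prop),
      lintegral_add_left (by fun_prop), lintegral_lintegral_swap (by fun_prop)]
    congr 1
    · congr 1
      rw [lintegral_const, Measure.restrict_apply MeasurableSet.univ, Set.univ_inter,
        Real.volume_Ioc, sub_zero, ← ENNReal.ofReal_mul ha]
    · refine lintegral_congr_ae ?_
      filter_upwards [haeU] with t ht using lintegral_inv_add_Ioc hs ht
  have hc0 : c = 0 := by
    by_contra hne
    have hcp : 0 < c := lt_of_le_of_ne hc (Ne.symm hne)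
    have h1 := key 1 zero_le_one
    have h2 : (∫⁻ y in Set.Ioc (0:ℝ) 1, ENNReal.ofReal (c / y)) < ⊤ := by
      refine lt_of_le_of_lt ?_ (ENNReal.ofReal_lt_top (r := L 1))
      rw [h1, add_assoc]
      exact le_self_add
    have h3 : IntegrableOn (fun y : ℝ => c / y) (Set.Ioc 0 1) := by
      refine ⟨by fun_prop, ?_⟩
      rw [hasFiniteIntegral_iff_ofReal]
      · exact h2
      · refine (ae_restrict_iff' measurableSet_Ioc).2 (Filter.Eventually.of_forall fun y hy => ?_)
        exact div_nonneg hc hy.1.le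
    have h4 : IntervalIntegrable (fun y : ℝ => y⁻¹) volume 0 1 := by
      rw [intervalIntegrable_iff_integrableOn_Ioc_of_le zero_le_one]
      refine (h3.const_mul c⁻¹).congr (Filter.Eventually.of_forall fun y => ?_)
      simp only
      field_simp
    rw [intervalIntegrable_inv_iff] at h4
    rcases h4 with h4 | h4
    · exact zero_ne_one h4
    · exact h4 (by simp)
  rw [key s hs, hc0]
  simp

theorem thorin_conditions_of_ofReal_eq {L : ℝ → ℝ} (hL : ∀ s, 0 ≤ s → 0 ≤ L s) {a : ℝ} (ha : 0 ≤ a)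
    {U : Measure ℝ} (hU : U (Set.Iic 0) = 0)
    (hLU : ∀ s, 0 ≤ s → ENNReal.ofReal (L s) = ENNReal.ofReal (a * s) +
      ∫⁻ t, ENNReal.ofReal (Real.log ((t + s) / t)) ∂U) :
    (∀ r s : ℝ, 0 < r → U (Set.Icc r s) < ⊤) ∧
    (∫⁻ t in Set.Ioc (0:ℝ) 1, ENNReal.ofReal |Real.log t| ∂U) < ⊤ ∧
    (∫⁻ t in Set.Ici (1:ℝ), ENNReal.ofReal t⁻¹ ∂U) < ⊤ ∧
    ∀ s : ℝ, 0 ≤ s → -L s = -(a * s) + ∫ t in Set.Ioi (0:ℝ), Real.log (t / (t + s)) ∂U := by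
  have hfin : ∀ s, 0 ≤ s → ∫⁻ t, ENNReal.ofReal (Real.log ((t + s) / t)) ∂U < ⊤ := by
    intro s hs
    refine lt_of_le_of_lt ?_ (ENNReal.ofReal_lt_top (r := L s))
    rw [hLU s hs]
    exact le_add_self
  have haeU : ∀ᵐ t ∂U, 0 < t := by
    rw [ae_iff]; simpa [Set.Iic, not_lt] using hU
  refine ⟨fun r s hr => ?_, ?_, ?_, fun s hs => ?_⟩
  · rcases lt_or_ge s r with h | h
    · simp [Set.Icc_eq_empty_of_lt h]
    have hs : 0 < s := hr.trans_le h
    have h1 := meas_ge_le_lintegral_div (μ := U)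
      (f := fun t => ENNReal.ofReal (Real.log ((t + 1) / t))) (by fun_prop)
      (ε := ENNReal.ofReal (Real.log ((s + 1) / s))) ?_ ENNReal.ofReal_ne_top
    · refine (measure_mono fun t ht => ?_).trans_lt (h1.trans_lt (ENNReal.div_lt_top (hfin 1 zero_le_one).ne ?_))
      · have ht0 : 0 < t := hr.trans_le ht.1
        refine ENNReal.ofReal_le_ofReal (Real.log_le_log (by positivity) ?_)
        rw [div_le_div_iff₀ hs ht0]
        nlinarith [ht.2]
      · simp only [ne_eq, ENNReal.ofReal_eq_zero, not_le]
        refine Real.log_pos ?_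
        rw [lt_div_iff₀ hs]; linarith
    · simp only [ne_eq, ENNReal.ofReal_eq_zero, not_le]
      refine Real.log_pos ?_
      rw [lt_div_iff₀ hs]; linarith
  · refine lt_of_le_of_lt ?_ (hfin 1 zero_le_one)
    refine (setLIntegral_mono' measurableSet_Ioc fun t ht => ?_).trans (setLIntegral_le_lintegral _ _)
    have ht0 := ht.1
    refine ENNReal.ofReal_le_ofReal ?_
    rw [abs_of_nonpos (Real.log_nonpos ht0.le ht.2), ← Real.log_inv]
    refine Real.log_le_log (by positivity) ?_
    rw [← one_div]
    gcongr
    linarith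
  · refine lt_of_le_of_lt ?_ (ENNReal.mul_lt_top (ENNReal.ofReal_lt_top (r := 2)) (hfin 1 zero_le_one))
    rw [← lintegral_const_mul _ (by fun_prop)]
    refine (setLIntegral_mono' measurableSet_Ici fun t ht => ?_).trans (setLIntegral_le_lintegral _ _)
    have ht1 : 1 ≤ t := ht
    have ht0 : 0 < t := by linarith
    rw [← ENNReal.ofReal_mul (by norm_num)]
    refine ENNReal.ofReal_le_ofReal ?_
    have h1 := Real.one_sub_inv_le_log_of_pos (x := (t + 1) / t) (by positivity)
    have h2 : t⁻¹ ≤ 2 * (1 - ((t + 1) / t)⁻¹) := by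
      rw [inv_div, one_sub_div (by positivity), ← one_div, mul_div_assoc', div_le_div_iff₀ ht0 (by positivity)]
      linarith
    linarith
  · have h1 : ∫ t, Real.log ((t + s) / t) ∂U = L s - a * s := by
      rw [integral_eq_lintegral_of_nonneg_ae]
      · have h2 := hLU s hs
        have h3 : (∫⁻ t, ENNReal.ofReal (Real.log ((t + s) / t)) ∂U) =
          ENNReal.ofReal (L s) - ENNReal.ofReal (a * s) := by
          rw [h2]
          exact (ENNReal.add_sub_cancel_left ENNReal.ofReal_ne_top).symm
        rw [h3, ← ENNReal.ofReal_sub _ (by positivity), ENNReal.toReal_ofReal]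
        have h4 : ENNReal.ofReal (a * s) ≤ ENNReal.ofReal (L s) := by rw [h2]; exact le_self_add
        linarith [(ENNReal.ofReal_le_ofReal_iff (hL s hs)).1 h4]
      · filter_upwards [haeU] with t ht
        refine Real.log_nonneg ?_
        rw [le_div_iff₀ ht]; linarith
      · refine Measurable.aestronglyMeasurable ?_
        fun_prop
    have h5 : U.restrict (Set.Ioi 0) = U := Measure.restrict_eq_self_of_ae_mem haeU
    rw [h5]
    have h6 : ∀ t, Real.log (t / (t + s)) = -Real.log ((t + s) / t) := fun t => by
      rw [← Real.log_inv, inv_div]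
    simp only [h6]
    rw [integral_neg, h1]
    ring

theorem thorin_kernel_add {s x : ℝ} (hD : (1 - x) * s + (1 + x) ≠ 0) (hx : 1 + x ≠ 0) :
    (s - 1) / (2 * ((1 - x) * s + (1 + x))) + 1 / (2 * (1 + x)) =
      s / (((1 - x) * s + (1 + x)) * (1 + x)) := by
  rw [div_add_div _ _ (by simpa using hD) (by simpa using hx), div_eq_div_iff
    (by simpa using ⟨hD, hx⟩) (by simpa using ⟨hD, hx⟩)]
  ring

/-- A nonnegative `b` whose increments `b s - b 1` are integrals of Möbius kernels over `[-1, 1]` has a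
Thorin-type representation. -/
theorem exists_thorin_of_kernel_rep {μ : Measure ℝ} [IsFiniteMeasure μ]
    (hμ : ∀ᵐ x ∂μ, x ∈ Set.Icc (-1 : ℝ) 1) {b : ℝ → ℝ} (hb0 : ∀ s, 0 < s → 0 ≤ b s)
    (hb : ∀ s, 0 < s → b s - b 1 =
      ∫ x, (s - 1) / (2 * ((1 - x) * s + (1 + x))) ∂μ) :
    ∃ (c a : ℝ) (U : Measure ℝ), SFinite U ∧ 0 ≤ c ∧ 0 ≤ a ∧ U (Set.Iic 0) = 0 ∧
      ∀ s, 0 < s → ENNReal.ofReal (b s) =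
        ENNReal.ofReal c + ENNReal.ofReal (a * s) + ∫⁻ t, ENNReal.ofReal (s / (s + t)) ∂U := by
  have hDpos : ∀ s : ℝ, 0 < s → ∀ x ∈ Set.Icc (-1 : ℝ) 1, min 1 s * 2 ≤ (1 - x) * s + (1 + x) := by
    intro s hs x hx
    have h1 := min_le_left 1 s
    have h2 := min_le_right 1 s
    nlinarith [hx.1, hx.2]
  have hmin : ∀ s : ℝ, 0 < s → 0 < min 1 s := fun s hs => lt_min one_pos hs
  have hK : ∀ s : ℝ, 0 < s → Integrable (fun x => (s - 1) / (2 * ((1 - x) * s + (1 + x)))) μ := by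
    intro s hs
    refine Integrable.of_bound (C := |s - 1| / (4 * min 1 s)) ?_ ?_
    · exact (by fun_prop : Measurable fun x : ℝ => (s - 1) / (2 * ((1 - x) * s + (1 + x)))).aestronglyMeasurable
    · filter_upwards [hμ] with x hx
      have h1 := hDpos s hs x hx
      have h2 := hmin s hs
      rw [norm_div, Real.norm_eq_abs, Real.norm_eq_abs, abs_of_pos (by linarith : 0 < 2 * ((1 - x) * s + (1 + x)))]
      exact div_le_div_of_nonneg_left (abs_nonneg _) (by positivity) (by linarith)
  -- Fatou bound as `s` tends to `0`
  have hfatou : ∫⁻ x, (ENNReal.ofReal (2 * (1 + x)))⁻¹ ∂μ ≤ ENNReal.ofReal (b 1) := by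
    set e : ℕ → ℝ := fun n => 1 / ((n : ℝ) + 2) with he
    have he0 : ∀ n, 0 < e n := fun n => by simp only [he]; positivity
    have he1 : ∀ n, e n < 1 := fun n => by
      simp only [he]; rw [div_lt_one (by positivity)]; linarith [(Nat.cast_nonneg n : (0:ℝ) ≤ n)]
    have het : Filter.Tendsto e Filter.atTop (nhds 0) := by
      refine ((tendsto_one_div_add_atTop_nhds_zero_nat (𝕜 := ℝ)).comp (Filter.tendsto_add_atTop_nat 1)).congr fun n => ?_
      simp only [he, Function.comp, Nat.cast_add, Nat.cast_one]
      ring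
    have h1 : ∀ᵐ x ∂μ, (ENNReal.ofReal (2 * (1 + x)))⁻¹ ≤ Filter.liminf (fun n =>
        ENNReal.ofReal (1 - e n) * (ENNReal.ofReal (2 * ((1 - x) * e n + (1 + x))))⁻¹) Filter.atTop := by
      filter_upwards [hμ] with x hx
      refine le_of_eq (Filter.Tendsto.liminf_eq ?_).symm
      have t1 : Filter.Tendsto (fun n => ENNReal.ofReal (1 - e n)) Filter.atTop (nhds (ENNReal.ofReal (1 - 0))) :=
        (ENNReal.continuous_ofReal.tendsto _).comp (het.const_sub 1)
      have t2 : Filter.Tendsto (fun n => (ENNReal.ofReal (2 * ((1 - x) * e n + (1 + x))))⁻¹) Filter.atTop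
          (nhds (ENNReal.ofReal (2 * ((1 - x) * 0 + (1 + x))))⁻¹) :=
        ((continuous_inv.comp ENNReal.continuous_ofReal).tendsto _).comp
          (((het.const_mul (1 - x)).add_const (1 + x)).const_mul 2)
      have t3 := ENNReal.Tendsto.mul t1 (Or.inl (by simp)) t2 (Or.inr (by simp))
      simpa using t3
    refine (lintegral_mono_ae h1).trans ((lintegral_liminf_le fun n => by fun_prop).trans ?_)
    refine Filter.liminf_le_of_frequently_le' (Filter.Frequently.of_forall fun n => ?_)
    have h2 := hb (e n) (he0 n)
    have h3 : ∫⁻ x, ENNReal.ofReal (1 - e n) * (ENNReal.ofReal (2 * ((1 - x) * e n + (1 + x))))⁻¹ ∂μ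
        = ENNReal.ofReal (b 1 - b (e n)) := by
      rw [← neg_sub (b (e n)), h2, ← integral_neg,
        ofReal_integral_eq_lintegral_ofReal (f := fun x => -((e n - 1) / (2 * ((1 - x) * e n + (1 + x)))))
          (hK _ (he0 n)).neg]
      · refine lintegral_congr_ae ?_
        filter_upwards [hμ] with x hx
        have h4 := hDpos _ (he0 n) x hx
        have h5 := hmin _ (he0 n)
        have h6 : 0 < 2 * ((1 - x) * e n + (1 + x)) := by linarith
        rw [← ENNReal.ofReal_inv_of_pos h6, ← ENNReal.ofReal_mul (by linarith [he1 n])]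
        congr 1
        rw [← neg_div, neg_sub, div_eq_mul_inv]
      · filter_upwards [hμ] with x hx
        have h4 := hDpos _ (he0 n) x hx
        have h5 := hmin _ (he0 n)
        have h6 : 0 < 2 * ((1 - x) * e n + (1 + x)) := by linarith
        simp only [Pi.zero_apply]
        rw [← neg_div, neg_sub]
        exact div_nonneg (by linarith [he1 n]) h6.le
    rw [h3]
    exact ENNReal.ofReal_le_ofReal (by linarith [hb0 _ (he0 n)])
  have hae : ∀ᵐ x ∂μ, x ∈ Set.Ioc (-1 : ℝ) 1 := by
    have h1 := ae_lt_top (by fun_prop) (hfatou.trans_lt ENNReal.ofReal_lt_top).ne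
    filter_upwards [h1, hμ] with x hx hx2
    refine ⟨lt_of_le_of_ne hx2.1 ?_, hx2.2⟩
    rintro rfl
    simp at hx
  have hI : Integrable (fun x => 1 / (2 * (1 + x))) μ := by
    refine ⟨(by fun_prop : Measurable fun x : ℝ => 1 / (2 * (1 + x))).aestronglyMeasurable, ?_⟩
    rw [hasFiniteIntegral_iff_ofReal]
    · refine lt_of_le_of_lt (le_of_eq (lintegral_congr_ae ?_)) (hfatou.trans_lt ENNReal.ofReal_lt_top)
      filter_upwards [hae] with x hx
      have : 0 < 2 * (1 + x) := by linarith [hx.1]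
      rw [← ENNReal.ofReal_inv_of_pos this, one_div]
    · filter_upwards [hae] with x hx
      have : 0 < 2 * (1 + x) := by linarith [hx.1]
      simp only [Pi.zero_apply]
      positivity
  have hc : 0 ≤ b 1 - ∫ x, 1 / (2 * (1 + x)) ∂μ := by
    rw [sub_nonneg, ← ENNReal.ofReal_le_ofReal_iff (hb0 1 one_pos), ofReal_integral_eq_lintegral_ofReal hI]
    · refine le_of_eq_of_le (lintegral_congr_ae ?_) hfatou
      filter_upwards [hae] with x hx
      have : 0 < 2 * (1 + x) := by linarith [hx.1]
      rw [← ENNReal.ofReal_inv_of_pos this, one_div]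
    · filter_upwards [hae] with x hx
      have : 0 < 2 * (1 + x) := by linarith [hx.1]
      simp only [Pi.zero_apply]
      positivity
  set τ : ℝ → ℝ := fun x => (1 + x) / (1 - x) with hτ
  have hτm : Measurable τ := by simp only [hτ]; fun_prop
  set ν : Measure ℝ := (μ.restrict (Set.Ioo (-1) 1)).withDensity (fun x => ENNReal.ofReal (1 / ((1 - x) * (1 + x)))) with hν
  refine ⟨b 1 - ∫ x, 1 / (2 * (1 + x)) ∂μ, μ.real {1} / 4, ν.map τ, inferInstance, hc, by positivity, ?_, ?_⟩
  · rw [Measure.map_apply hτm measurableSet_Iic, hν,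
      withDensity_apply _ (hτm measurableSet_Iic), Measure.restrict_restrict (hτm measurableSet_Iic)]
    have : τ ⁻¹' Set.Iic 0 ∩ Set.Ioo (-1) 1 = ∅ := by
      ext x
      simp only [Set.mem_inter_iff, Set.mem_preimage, Set.mem_Iic, Set.mem_Ioo, Set.mem_empty_iff_false,
        iff_false, not_and, hτ]
      intro h1 h2
      by_contra! h4
      have h3 : 0 < (1 + x) / (1 - x) := div_pos (by linarith) (by linarith)
      linarith
    rw [this]
    simp
  · intro s hs
    have hIs : Integrable (fun x => s / (((1 - x) * s + (1 + x)) * (1 + x))) μ := by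
      refine ((hK s hs).add hI).congr ?_
      filter_upwards [hae] with x hx
      have h4 := hDpos _ hs x ⟨hx.1.le, hx.2⟩
      have h5 := hmin _ hs
      have h6 : 0 < ((1 - x) * s + (1 + x)) := by linarith
      have h7 : 0 < 1 + x := by linarith [hx.1]
      exact thorin_kernel_add h6.ne' h7.ne'
    have e1 : b s = (b 1 - ∫ x, 1 / (2 * (1 + x)) ∂μ) + ∫ x, s / (((1 - x) * s + (1 + x)) * (1 + x)) ∂μ := by
      have : ∫ x, s / (((1 - x) * s + (1 + x)) * (1 + x)) ∂μ =
          ∫ x, ((s - 1) / (2 * ((1 - x) * s + (1 + x))) + 1 / (2 * (1 + x))) ∂μ := by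
        refine integral_congr_ae ?_
        filter_upwards [hae] with x hx
        have h4 := hDpos _ hs x ⟨hx.1.le, hx.2⟩
        have h5 := hmin _ hs
        have h6 : 0 < ((1 - x) * s + (1 + x)) := by linarith
        have h7 : 0 < 1 + x := by linarith [hx.1]
        exact (thorin_kernel_add h6.ne' h7.ne').symm
      rw [this, integral_add (hK s hs) hI, ← hb s hs]
      ring
    have hnn : ∀ᵐ x ∂μ, 0 ≤ s / (((1 - x) * s + (1 + x)) * (1 + x)) := by
      filter_upwards [hae] with x hx
      have h4 := hDpos _ hs x ⟨hx.1.le, hx.2⟩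
      have h5 := hmin _ hs
      have h6 : 0 < ((1 - x) * s + (1 + x)) := by linarith
      have h7 : 0 < 1 + x := by linarith [hx.1]
      positivity
    rw [e1, ENNReal.ofReal_add hc (integral_nonneg_of_ae hnn), ofReal_integral_eq_lintegral_ofReal hIs hnn, add_assoc]
    congr 1
    have hsplit : μ = μ.restrict {1} + μ.restrict (Set.Ioo (-1) 1) := by
      rw [← Measure.restrict_union (by simp) measurableSet_Ioo]
      refine (Measure.restrict_eq_self_of_ae_mem ?_).symm
      filter_upwards [hae] with x hx
      rcases hx.2.eq_or_lt with h | h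
      · exact Or.inl h
      · exact Or.inr ⟨hx.1, h⟩
    nth_rewrite 1 [hsplit]
    rw [lintegral_add_measure]
    congr 1
    · rw [lintegral_singleton]
      rw [← ENNReal.ofReal_toReal (measure_ne_top μ {1}), ← ENNReal.ofReal_mul (by positivity)]
      congr 1
      simp only [Measure.real]
      field_simp
      ring
    · rw [lintegral_map (by fun_prop) hτm, hν, lintegral_withDensity_eq_lintegral_mul _ (by fun_prop) (by fun_prop)]
      refine setLIntegral_congr_fun measurableSet_Ioo fun x hx => ?_
      simp only [Pi.mul_apply, hτ]
      have h1 : 0 < 1 - x := by linarith [hx.2]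
      have h2 : 0 < 1 + x := by linarith [hx.1]
      rw [← ENNReal.ofReal_mul (by positivity)]
      congr 1
      field_simp

theorem isGGC_of_strip {m : Measure ℝ} [IsProbabilityMeasure m] (hm : m (Set.Iio 0) = 0)
    {B : ℂ → ℂ} (hB : DifferentiableOn ℂ B {ζ | |ζ.im| < π})
    (hBpos : ∀ ζ : ℂ, |ζ.im| < π → 0 ≤ (B ζ).im * ζ.im)
    (hB0 : ∀ s : ℝ, 0 < s → 0 ≤ (B (Real.log s : ℝ)).re)
    {L : ℝ → ℝ} (hL0 : L 0 = 0) (hLc : ContinuousOn L (Set.Ici 0)) (hLnn : ∀ s, 0 ≤ s → 0 ≤ L s)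
    (hd : ∀ s, 0 < s → HasDerivAt L ((B (Real.log s : ℝ)).re / s) s)
    (hL : ∀ s, 0 ≤ s → ∫ x, Real.exp (-s * x) ∂m = Real.exp (-L s)) : IsGGC m := by
  have hre : ∀ z ∈ Metric.ball (0 : ℂ) 1, 0 < ((1 + z) / (1 - z)).re ∧
      ∃ c : ℝ, 0 < c ∧ ((1 + z) / (1 - z)).im = c * z.im := by
    intro z hz
    have hz1 : ‖z‖ < 1 := by simpa using hz
    have hne : 1 - z ≠ 0 := by
      intro h
      rw [← sub_eq_zero.1 h] at hz1
      simp at hz1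
    have hn : 0 < Complex.normSq (1 - z) := Complex.normSq_pos.2 hne
    have hsq : z.re ^ 2 + z.im ^ 2 < 1 := by
      have := Complex.sq_norm z
      rw [Complex.normSq_apply] at this
      nlinarith [norm_nonneg z]
    constructor
    · rw [Complex.div_re, ← add_div]
      refine div_pos ?_ hn
      simp
      nlinarith
    · refine ⟨2 / Complex.normSq (1 - z), by positivity, ?_⟩
      rw [Complex.div_im, ← sub_div, div_mul_eq_mul_div]
      congr 1
      simp
      ring
  set f : ℂ → ℂ := fun z => B (2 * Complex.log ((1 + z) / (1 - z))) with hf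
  have him : ∀ z ∈ Metric.ball (0 : ℂ) 1, (2 * Complex.log ((1 + z) / (1 - z))).im =
      2 * Complex.arg ((1 + z) / (1 - z)) := by
    intro z _
    simp [Complex.log_im]
  have hstrip : ∀ z ∈ Metric.ball (0 : ℂ) 1, 2 * Complex.log ((1 + z) / (1 - z)) ∈ {ζ : ℂ | |ζ.im| < π} := by
    intro z hz
    have h1 := Complex.abs_arg_lt_pi_div_two_iff.2 (Or.inl (hre z hz).1)
    rw [Set.mem_ofPred_eq, him z hz, abs_mul, abs_two]
    linarith
  have hfd : DifferentiableOn ℂ f (Metric.ball 0 1) := by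
    refine hB.comp ?_ hstrip
    intro z hz
    have hz1 : ‖z‖ < 1 := by simpa using hz
    have hne : 1 - z ≠ 0 := by
      intro h
      rw [← sub_eq_zero.1 h] at hz1
      simp at hz1
    refine DifferentiableAt.differentiableWithinAt ?_
    have h1 : DifferentiableAt ℂ (fun z : ℂ => (1 + z) / (1 - z)) z :=
      DifferentiableAt.div (by fun_prop) (by fun_prop) hne
    exact (h1.clog (Or.inl (hre z hz).1)).const_mul 2
  have hfpos : ∀ z ∈ Metric.ball (0 : ℂ) 1, 0 ≤ (f z).im * z.im := by
    intro z hz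
    have h1 := hBpos _ (hstrip z hz)
    rw [him z hz] at h1
    obtain ⟨hr, c, hc, hi⟩ := hre z hz
    simp only [hf]
    rcases lt_trichotomy z.im 0 with h | h | h
    · have h2 : Complex.arg ((1 + z) / (1 - z)) < 0 := Complex.arg_neg_iff.2 (by rw [hi]; nlinarith)
      exact mul_nonneg_of_nonpos_of_nonpos (by nlinarith) h.le
    · rw [h, mul_zero]
    · have h2 : 0 < Complex.arg ((1 + z) / (1 - z)) := by
        refine lt_of_le_of_ne (Complex.arg_nonneg_iff.2 (by rw [hi]; positivity)) (fun h3 => ?_)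
        have h4 := (Complex.arg_eq_zero_iff.1 h3.symm).2
        rw [hi] at h4
        have : 0 < c * z.im := by positivity
        linarith
      exact mul_nonneg (by nlinarith) h.le
  obtain ⟨μ, hμ0, hμ⟩ := exists_finiteMeasure_of_typicallyReal (f := f) hfd hfpos
  have hae : ∀ᵐ x ∂(μ : Measure ℝ), x ∈ Set.Icc (-1 : ℝ) 1 := by
    rw [ae_iff]
    exact (FiniteMeasure.null_iff_toMeasure_null _ _).1 hμ0
  have hf0 : f 0 = B (Real.log 1 : ℝ) := by simp [hf]
  obtain ⟨c, a, U, hU, hc, ha, hU0, hrep⟩ := exists_thorin_of_kernel_rep hae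
    (b := fun s => (B (Real.log s : ℝ)).re) hB0 (by
      intro s hs
      set q := √s with hq
      have hq0 : 0 < q := Real.sqrt_pos.2 hs
      have hqs : s = q ^ 2 := (Real.sq_sqrt hs.le).symm
      have hz : |(q - 1) / (q + 1)| < 1 := by
        rw [abs_div, abs_of_pos (by linarith : 0 < q + 1), div_lt_one (by linarith), abs_lt]
        constructor <;> linarith
      have h1 := hμ _ hz
      have h2 : f ((q - 1) / (q + 1) : ℝ) = B (Real.log s : ℝ) := by
        simp only [hf]
        congr 1
        have : (1 + (((q - 1) / (q + 1) : ℝ) : ℂ)) / (1 - (((q - 1) / (q + 1) : ℝ) : ℂ)) = (q : ℂ) := by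
          norm_cast
          field_simp
          ring
        rw [this, ← Complex.ofReal_log hq0.le, hqs, Real.log_pow]
        push_cast
        ring
      rw [h2, hf0] at h1
      rw [h1]
      refine integral_congr_ae ?_
      filter_upwards [hae] with x hx
      have h5 : 0 < (1 - x) * q ^ 2 + (1 + x) := by
        rcases hx.1.eq_or_lt with h | h
        · rw [← h]; positivity
        · have : 0 ≤ (1 - x) * q ^ 2 := mul_nonneg (by linarith [hx.2]) (sq_nonneg _)
          linarith
      rw [hqs]
      have h6 : 1 - 2 * ((q - 1) / (q + 1)) * x + ((q - 1) / (q + 1)) ^ 2 =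
        2 * ((1 - x) * q ^ 2 + (1 + x)) / (q + 1) ^ 2 := by
        field_simp
        ring
      rw [h6, div_div_eq_mul_div]
      congr 1
      field_simp
      ring)
  have hLU := fun (s : ℝ) (hs : 0 ≤ s) =>
    ofReal_eq_lintegral_log_of_hasDerivAt hL0 hLc hB0 hd hc ha hU0 hrep hs
  obtain ⟨g1, g2, g3, g4⟩ := thorin_conditions_of_ofReal_eq hLnn ha hU0 hLU
  exact ⟨inferInstance, hm, a, U, ha, hU0, g1, g2, g3, fun s hs => by rw [hL s hs, g4 s hs]⟩

theorem rpow_jacobian_identity {k d δ Y Λ W q : ℝ} (hδ : 0 < δ) (hY : 0 < Y)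
    (hΛ : 0 < Λ) (hW : 0 < W) (hq : 0 < q) (h1 : δ ^ 2 * Y / Λ = q / W) (h2 : d * q = δ * Y) :
    d * (δ ^ (2 * k - 1) * Λ ^ (-k) * Y ^ (k - 1)) = W ^ (-k) * q ^ (k - 1) := by
  have hd : d = δ * Y / q := by field_simp; linarith
  rw [Real.rpow_sub_one hδ.ne', Real.rpow_sub_one hY.ne', Real.rpow_sub_one hq.ne',
    Real.rpow_neg hΛ.le, Real.rpow_neg hW.le, Real.rpow_mul hδ.le, Real.rpow_two, hd]
  have h3 := congrArg (· ^ k) h1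
  rw [Real.div_rpow (by positivity) hΛ.le, Real.div_rpow hq.le hW.le,
    Real.mul_rpow (by positivity) hY.le] at h3

  calc δ * Y / q * ((δ ^ 2) ^ k / δ * (Λ ^ k)⁻¹ * (Y ^ k / Y))
      = ((δ ^ 2) ^ k * Y ^ k / Λ ^ k) / q := by field_simp
    _ = (q ^ k / W ^ k) / q := by rw [h3]
    _ = _ := by field_simp

theorem lintegral_cosh_kernel {A B a k η : ℝ} (hB : 0 ≤ B) (hA : 0 < A) (ha : 0 < a) :
    ∫⁻ t in Set.Ioo (-a) a, ENNReal.ofReal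
      ((A ^ 2 + B ^ 2 + A * B * (2 * Real.cosh (η - t))) ^ (-k) *
        (2 * Real.cosh a - 2 * Real.cosh t) ^ (k - 1)) =
    ∫⁻ y in Set.Ioo (0:ℝ) 1, ENNReal.ofReal ((2 * Real.sinh a) ^ (2 * k - 1) *
      (((A ^ 2 + B ^ 2) * Real.cosh a + (A ^ 2 - B ^ 2) * Real.sinh a * (2 * y - 1)) +
        A * B * (2 * Real.cosh η)) ^ (-k) * (y * (1 - y)) ^ (k - 1)) := by
  set α := Real.exp a with hα
  set v := Real.exp η with hv
  have hα0 : 0 < α := Real.exp_pos a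
  have hα1 : 1 < α := Real.one_lt_exp_iff.2 ha
  have hv0 : 0 < v := Real.exp_pos η
  have hδ : 0 < α - α⁻¹ := by linarith [inv_lt_one_of_one_lt₀ hα1]
  set Y : ℝ → ℝ := fun t => (Real.exp t - α⁻¹) * (B * α + A * v) / ((α - α⁻¹) * (B * Real.exp t + A * v)) with hY
  set Y' : ℝ → ℝ := fun t => Real.exp t * ((B * α + A * v) * (B * α⁻¹ + A * v)) / ((α - α⁻¹) * (B * Real.exp t + A * v) ^ 2) with hY'
  have hN : ∀ t, 0 < B * Real.exp t + A * v := fun t => by positivity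
  have hα2 : α ^ 2 - 1 ≠ 0 := by nlinarith
  have hE1 : 0 < B * α + A * v := by positivity
  have hE2 : 0 < B * α⁻¹ + A * v := by positivity
  have hder : ∀ t, HasDerivAt Y (Y' t) t := by
    intro t
    have e1 : HasDerivAt (fun t => (Real.exp t - α⁻¹) * (B * α + A * v)) (Real.exp t * (B * α + A * v)) t :=
      ((Real.hasDerivAt_exp t).sub_const _).mul_const _
    have e2 : HasDerivAt (fun t => (α - α⁻¹) * (B * Real.exp t + A * v)) ((α - α⁻¹) * (B * Real.exp t)) t :=
      ((((Real.hasDerivAt_exp t).const_mul B).add_const _).const_mul _)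
    have e3 := e1.div e2 (mul_pos hδ (hN t)).ne'
    refine e3.congr_deriv ?_
    have := (hN t).ne'
    have := hδ.ne'
    rw [div_eq_div_iff (by positivity) (by positivity)]
    ring
  have hY'pos : ∀ t, 0 < Y' t := fun t => by
    have := hN t
    simp only [hY']
    positivity
  have hmono : StrictMono Y := strictMono_of_hasDerivAt_pos hder hY'pos
  have hYc : Continuous Y := continuous_iff_continuousAt.2 fun t => (hder t).continuousAt
  have hYa : Y a = 1 := by
    simp only [hY, ← hα]
    exact div_self (by positivity)
  have hYma : Y (-a) = 0 := by
    simp only [hY, Real.exp_neg, ← hα]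
    simp
  have himg : Y '' Set.Ioo (-a) a = Set.Ioo 0 1 := by
    rw [← hYa, ← hYma]
    refine Set.Subset.antisymm ?_ (intermediate_value_Ioo (by linarith) hYc.continuousOn)
    rintro _ ⟨t, ht, rfl⟩
    exact ⟨hmono ht.1, hmono ht.2⟩
  rw [← himg, lintegral_image_eq_lintegral_abs_deriv_mul measurableSet_Ioo
    (fun t _ => (hder t).hasDerivWithinAt) hmono.injective.injOn]
  refine setLIntegral_congr_fun measurableSet_Ioo fun t ht => ?_
  rw [abs_of_pos (hY'pos t), ← ENNReal.ofReal_mul (hY'pos t).le]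
  congr 1
  have hp0 : 0 < Real.exp t := Real.exp_pos t
  have hp1 : Real.exp t < α := Real.exp_lt_exp.2 ht.2
  have hp2 : α⁻¹ < Real.exp t := by rw [hα, ← Real.exp_neg]; exact Real.exp_lt_exp.2 ht.1
  have hsinh : 2 * Real.sinh a = α - α⁻¹ := by rw [Real.sinh_eq, Real.exp_neg, hα]; ring
  have hcosha : Real.cosh a = (α + α⁻¹) / 2 := by rw [Real.cosh_eq, Real.exp_neg]
  have hcosht : Real.cosh t = (Real.exp t + (Real.exp t)⁻¹) / 2 := by rw [Real.cosh_eq, Real.exp_neg]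
  have hcoshη : Real.cosh η = (v + v⁻¹) / 2 := by rw [Real.cosh_eq, Real.exp_neg]
  have hcoshs : Real.cosh (η - t) = (v / Real.exp t + Real.exp t / v) / 2 := by
    rw [Real.cosh_eq, Real.exp_sub, neg_sub, Real.exp_sub]
  have hsinh' : Real.sinh a = (α - α⁻¹) / 2 := by linarith
  have hN' := hN t
  set p := Real.exp t with hp
  have hM : 0 < A * p + B * v := by positivity
  have h1Y : 1 - Y t = (α - p) * (B * α⁻¹ + A * v) / ((α - α⁻¹) * (B * p + A * v)) := by
    simp only [hY, ← hp]
    rw [one_sub_div (by positivity)]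
    ring
  have hYY : Y t * (1 - Y t) = ((p - α⁻¹) * (α - p)) * ((B * α + A * v) * (B * α⁻¹ + A * v)) /
      ((α - α⁻¹) ^ 2 * (B * p + A * v) ^ 2) := by
    rw [h1Y]
    simp only [hY, ← hp]
    rw [div_mul_div_comm]
    congr 1 <;> ring
  have hq : 2 * Real.cosh a - 2 * Real.cosh t = (p - α⁻¹) * (α - p) / p := by
    rw [hcosha, hcosht]
    have : α * α⁻¹ = 1 := mul_inv_cancel₀ hα0.ne'
    field_simp
    ring
  have hW : A ^ 2 + B ^ 2 + A * B * (2 * Real.cosh (η - t)) = (A * p + B * v) * (B * p + A * v) / (p * v) := by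
    rw [hcoshs]
    field_simp
    ring
  have hΛ : ((A ^ 2 + B ^ 2) * Real.cosh a + (A ^ 2 - B ^ 2) * Real.sinh a * (2 * Y t - 1)) +
        A * B * (2 * Real.cosh η) = ((B * α + A * v) * (B * α⁻¹ + A * v)) * (A * p + B * v) / (v * (B * p + A * v)) := by
    rw [hcosha, hsinh', hcoshη]
    have : (α - α⁻¹) * Y t = (p - α⁻¹) * (B * α + A * v) / (B * p + A * v) := by
      simp only [hY, ← hp]
      field_simp
    have e : ((A ^ 2 + B ^ 2) * ((α + α⁻¹) / 2) + (A ^ 2 - B ^ 2) * ((α - α⁻¹) / 2) * (2 * Y t - 1)) +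
        A * B * (2 * ((v + v⁻¹) / 2)) = ((A ^ 2 + B ^ 2) * ((α + α⁻¹) / 2) +
        (A ^ 2 - B ^ 2) * (((α - α⁻¹) * Y t) - (α - α⁻¹) / 2)) + A * B * (v + v⁻¹) := by ring
    rw [e, this]
    have hN2 := hN'.ne'
    field_simp
    ring
  have hp3 : 0 < (p - α⁻¹) * (α - p) := mul_pos (by linarith) (by linarith)
  rw [hsinh, hΛ, hYY, hq, hW]
  refine (rpow_jacobian_identity hδ (by positivity) (by positivity) (by positivity) (by positivity) ?_ ?_).symm
  · field_simp
  · simp only [hY', ← hp]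
    field_simp

theorem ofReal_rpow_mul_rpow_eq_lintegral_beta {α β C D : ℝ} (hα : 0 < α) (hβ : 0 < β) (hC : 0 < C) (hD : 0 < D) :
    ENNReal.ofReal (C ^ (-α) * D ^ (-β)) = ∫⁻ x in Set.Ioo (0:ℝ) 1,
      ENNReal.ofReal (1 / beta α β * x ^ (α - 1) * (1 - x) ^ (β - 1)) *
        ENNReal.ofReal ((x * C + (1 - x) * D) ^ (-(α + β))) := by
  have hS : ∀ x ∈ Set.Icc (0:ℝ) 1, 0 < x * C + (1 - x) * D := by
    intro x hx
    rcases hx.1.eq_or_lt with h | h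
    · rw [← h]; simpa
    · have : 0 ≤ (1 - x) * D := mul_nonneg (by linarith [hx.2]) hD.le
      nlinarith
  set Y : ℝ → ℝ := fun x => x * C / (x * C + (1 - x) * D) with hY
  set Y' : ℝ → ℝ := fun x => C * D / (x * C + (1 - x) * D) ^ 2 with hY'
  have hder : ∀ x ∈ Set.Icc (0:ℝ) 1, HasDerivAt Y (Y' x) x := by
    intro x hx
    have e1 : HasDerivAt (fun x => x * C) (1 * C) x := (hasDerivAt_id x).mul_const C
    have e2 : HasDerivAt (fun x => (1 - x) * D) ((-1) * D) x :=
      ((hasDerivAt_id x).const_sub 1).mul_const D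
    refine (e1.div (e1.add e2) (hS x hx).ne').congr_deriv ?_
    simp only [hY', Pi.add_apply]
    congr 1
    ring
  have hY'pos : ∀ x ∈ Set.Icc (0:ℝ) 1, 0 < Y' x := fun x hx => by
    have := hS x hx
    simp only [hY']
    positivity
  have hYc : ContinuousOn Y (Set.Icc 0 1) := fun x hx => (hder x hx).continuousAt.continuousWithinAt
  have hmono : StrictMonoOn Y (Set.Icc 0 1) := by
    refine strictMonoOn_of_deriv_pos (convex_Icc 0 1) hYc fun x hx => ?_
    rw [interior_Icc] at hx
    rw [(hder x (Set.Ioo_subset_Icc_self hx)).deriv]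
    exact hY'pos x (Set.Ioo_subset_Icc_self hx)
  have hY0 : Y 0 = 0 := by simp [hY]
  have hY1 : Y 1 = 1 := by simp [hY, hC.ne']
  have himg : Y '' Set.Ioo 0 1 = Set.Ioo 0 1 := by
    refine Set.Subset.antisymm ?_ ?_
    · rintro _ ⟨x, hx, rfl⟩
      have hx' := Set.Ioo_subset_Icc_self hx
      have h1 := hmono (by simp) hx' hx.1
      have h2 := hmono hx' (by simp) hx.2
      rw [hY0] at h1
      rw [hY1] at h2
      exact ⟨h1, h2⟩
    · have := intermediate_value_Ioo zero_le_one hYc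
      rwa [hY0, hY1] at this
  have h1 := (lintegral_betaPDF (α := α) (β := β)).symm.trans (lintegral_betaPDF_eq_one hα hβ)
  rw [← himg, lintegral_image_eq_lintegral_abs_deriv_mul measurableSet_Ioo
    (fun x hx => (hder x (Set.Ioo_subset_Icc_self hx)).hasDerivWithinAt)
    (hmono.injOn.mono Set.Ioo_subset_Icc_self)] at h1
  rw [← mul_one (ENNReal.ofReal _), ← h1, ← lintegral_const_mul' _ _ ENNReal.ofReal_ne_top]
  refine setLIntegral_congr_fun measurableSet_Ioo fun x hx => ?_
  have hx' := Set.Ioo_subset_Icc_self hx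
  have hb := beta_pos hα hβ
  have hx0 := hx.1
  have hx1 : 0 < 1 - x := by linarith [hx.2]
  have hSx := hS x hx'
  rw [abs_of_pos (hY'pos x hx'), ← ENNReal.ofReal_mul (hY'pos x hx').le,
    ← ENNReal.ofReal_mul (by positivity), ← ENNReal.ofReal_mul (by positivity)]
  congr 1
  have h1Y : 1 - Y x = (1 - x) * D / (x * C + (1 - x) * D) := by
    simp only [hY]
    rw [one_sub_div hSx.ne']
    congr 1
    ring
  rw [h1Y]
  simp only [hY, hY']
  rw [Real.rpow_sub_one (by positivity), Real.rpow_sub_one (by positivity), Real.rpow_sub_one hx0.ne',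
    Real.rpow_sub_one hx1.ne', Real.div_rpow (by positivity) hSx.le, Real.div_rpow (by positivity) hSx.le,
    Real.mul_rpow hx0.le hC.le, Real.mul_rpow hx1.le hD.le, Real.rpow_neg hC.le, Real.rpow_neg hD.le,
    Real.rpow_neg hSx.le, Real.rpow_add hSx]
  have := (Real.rpow_pos_of_pos hC α).ne'
  have := (Real.rpow_pos_of_pos hD β).ne'
  have := (Real.rpow_pos_of_pos hSx β).ne'
  have := (Real.rpow_pos_of_pos hSx α).ne'
  generalize x * C + (1 - x) * D = S at *
  field_simp

/-- `h` is a mixture of the functions `η ↦ (L + 2 R cosh η)^(-k)` over the cone `0 ≤ 2R ≤ L`. -/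
def IsCoshMixture (k : ℝ) (h : ℝ → ℝ≥0∞) : Prop :=
  ∃ ν : Measure (ℝ × ℝ), SFinite ν ∧ (∀ᵐ p ∂ν, 0 < p.1 ∧ 0 ≤ p.2 ∧ 2 * p.2 ≤ p.1) ∧
    ∀ η, h η = ∫⁻ p, ENNReal.ofReal ((p.1 + p.2 * (2 * Real.cosh η)) ^ (-k)) ∂ν

theorem IsCoshMixture.of_measure {T : Type*} [MeasurableSpace T] {k : ℝ} {h : ℝ → ℝ≥0∞} (ν : Measure T) [SFinite ν]
    {w : T → ℝ≥0∞} (hw : Measurable w) (hwt : ∀ p, w p ≠ ⊤)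
    {L R : T → ℝ} (hL : Measurable L) (hR : Measurable R)
    (hc : ∀ᵐ p ∂ν, 0 < L p ∧ 0 ≤ R p ∧ 2 * R p ≤ L p)
    (hh : ∀ η, h η = ∫⁻ p, w p * ENNReal.ofReal ((L p + R p * (2 * Real.cosh η)) ^ (-k)) ∂ν) :
    IsCoshMixture k h := by
  have hsf : SFinite (ν.withDensity w) := by
    have e : w = fun p => ((w p).toNNReal : ℝ≥0∞) := funext fun p => (ENNReal.coe_toNNReal (hwt p)).symm
    rw [e]
    infer_instance
  refine ⟨(ν.withDensity w).map (fun p => (L p, R p)), inferInstance, ?_, fun η => ?_⟩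
  · rw [ae_map_iff (hL.prodMk hR).aemeasurable]
    · exact (withDensity_absolutelyContinuous ν w).ae_le hc
    · refine (measurableSet_lt measurable_const measurable_fst).inter
        ((measurableSet_le measurable_const measurable_snd).inter
        (measurableSet_le (measurable_snd.const_mul 2) measurable_fst))
  · rw [lintegral_map (by fun_prop) (hL.prodMk hR), lintegral_withDensity_eq_lintegral_mul _ hw (by fun_prop), hh]
    rfl

theorem isCoshMixture_rpow {k L R : ℝ} (hL : 0 < L) (hR : 0 ≤ R) (hRL : 2 * R ≤ L) :
    IsCoshMixture k (fun η => ENNReal.ofReal ((L + R * (2 * Real.cosh η)) ^ (-k))) :=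
  IsCoshMixture.of_measure (T := Unit) (Measure.dirac ()) (w := fun _ => 1) (L := fun _ => L) (R := fun _ => R)
    measurable_const (by simp) measurable_const measurable_const
    (Filter.Eventually.of_forall fun _ => ⟨hL, hR, hRL⟩) (fun η => by simp)

theorem IsCoshMixture.mul_rpow {k β L R : ℝ} {h : ℝ → ℝ≥0∞} (hh : IsCoshMixture k h) (hk : 0 < k) (hβ : 0 ≤ β)
    (hL : 0 < L) (hR : 0 ≤ R) (hRL : 2 * R ≤ L) :
    IsCoshMixture (k + β) (fun η => h η * ENNReal.ofReal ((L + R * (2 * Real.cosh η)) ^ (-β))) := by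
  rcases hβ.eq_or_lt with rfl | hβ
  · simpa using hh
  obtain ⟨ν, hν, hc, hr⟩ := hh
  refine IsCoshMixture.of_measure (T := (ℝ × ℝ) × ℝ) (ν.prod (volume.restrict (Set.Ioo (0:ℝ) 1)))
    (w := fun q => ENNReal.ofReal (1 / beta k β * q.2 ^ (k - 1) * (1 - q.2) ^ (β - 1)))
    (L := fun q => q.2 * q.1.1 + (1 - q.2) * L) (R := fun q => q.2 * q.1.2 + (1 - q.2) * R)
    (by fun_prop) (by simp) (by fun_prop) (by fun_prop) ?_ fun η => ?_
  · have h1 : ∀ᵐ q ∂(ν.prod (volume.restrict (Set.Ioo (0:ℝ) 1))), 0 < q.1.1 ∧ 0 ≤ q.1.2 ∧ 2 * q.1.2 ≤ q.1.1 :=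
      Measure.quasiMeasurePreserving_fst.ae hc
    have h2 : ∀ᵐ q ∂(ν.prod (volume.restrict (Set.Ioo (0:ℝ) 1))), q.2 ∈ Set.Ioo (0:ℝ) 1 :=
      Measure.quasiMeasurePreserving_snd.ae (ae_restrict_mem measurableSet_Ioo)
    filter_upwards [h1, h2] with q hq1 hq2
    have h3 := hq2.1
    have h4 : 0 < 1 - q.2 := by linarith [hq2.2]
    obtain ⟨h5, h6, h7⟩ := hq1
    refine ⟨by positivity, by positivity, ?_⟩
    nlinarith
  · rw [lintegral_prod _ (by fun_prop), hr, ← lintegral_mul_const _ (by fun_prop)]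
    refine lintegral_congr_ae ?_
    filter_upwards [hc] with p hp
    obtain ⟨h5, h6, h7⟩ := hp
    have hch := Real.one_le_cosh η
    rw [← ENNReal.ofReal_mul (by positivity), ofReal_rpow_mul_rpow_eq_lintegral_beta hk hβ (by positivity) (by positivity)]
    refine setLIntegral_congr_fun measurableSet_Ioo fun x hx => ?_
    congr 3
    ring

theorem isCoshMixture_prod {ι : Type*} (S : Finset ι) {ε : ℝ} (hε : 0 < ε) {β L R : ι → ℝ}
    (hβ : ∀ i, 0 ≤ β i) (hL : ∀ i, 0 < L i) (hR : ∀ i, 0 ≤ R i) (hRL : ∀ i, 2 * R i ≤ L i) :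
    IsCoshMixture (ε + ∑ i ∈ S, β i)
      (fun η => ENNReal.ofReal (∏ i ∈ S, (L i + R i * (2 * Real.cosh η)) ^ (-β i))) := by
  classical
  induction S using Finset.induction_on with
  | empty => simpa using isCoshMixture_rpow (k := ε) one_pos le_rfl (by norm_num : 2 * (0:ℝ) ≤ 1)
  | insert i S hi ih =>
    rw [Finset.sum_insert hi, add_comm (β i), ← add_assoc]
    have h1 := ih.mul_rpow (add_pos_of_pos_of_nonneg hε (Finset.sum_nonneg fun i _ => hβ i)) (hβ i) (hL i) (hR i) (hRL i)
    convert h1 using 2 with η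
    rw [Finset.prod_insert hi, mul_comm, ENNReal.ofReal_mul]
    refine Finset.prod_nonneg fun j _ => Real.rpow_nonneg ?_ _
    have := hL j
    have := hR j
    have := Real.cosh_pos η
    positivity

theorem sFinite_restrict_of_lintegral_ne_top {α : Type*} [MeasurableSpace α] {H : Measure α} {s : Set α} {w : α → ℝ≥0∞}
    (hw : Measurable w) (hs : MeasurableSet s) (hpos : ∀ x ∈ s, w x ≠ 0) (hfin : ∀ x, w x ≠ ⊤)
    (h : ∫⁻ x in s, w x ∂H ≠ ⊤) : SFinite (H.restrict s) := by
  have hf : IsFiniteMeasure ((H.restrict s).withDensity w) := isFiniteMeasure_withDensity h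
  rw [← withDensity_inv_same (μ := H.restrict s) hw
    ((ae_restrict_iff' hs).2 (Filter.Eventually.of_forall hpos)) (Filter.Eventually.of_forall hfin)]
  set m := (H.restrict s).withDensity w
  infer_instance

theorem sub_sqrt_le_of_cone {l r w y : ℝ} (hl : 0 < l) (hr : 0 ≤ r) (hrl : 2 * r ≤ l) (hw : 2 < w)
    (hy : y ∈ Set.Ioo (0:ℝ) 1) :
    0 < l * (w / 2) + √(l + 2 * r) * √(l - 2 * r) * (√(w ^ 2 - 4) / 2) * (2 * y - 1) ∧
    2 * r ≤ l * (w / 2) + √(l + 2 * r) * √(l - 2 * r) * (√(w ^ 2 - 4) / 2) * (2 * y - 1) := by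
  rw [← Real.sqrt_mul (by linarith)]
  set D := √((l + 2 * r) * (l - 2 * r)) with hD
  set s := √(w ^ 2 - 4) with hs
  have hD2 : D ^ 2 = (l + 2 * r) * (l - 2 * r) := Real.sq_sqrt (mul_nonneg (by linarith) (by linarith))
  have hs2 : s ^ 2 = w ^ 2 - 4 := Real.sq_sqrt (by nlinarith)
  have hD0 : 0 ≤ D := Real.sqrt_nonneg _
  have hs0 : 0 ≤ s := Real.sqrt_nonneg _
  have hDs : 0 ≤ D * s := mul_nonneg hD0 hs0
  have hDl : D ≤ l := by nlinarith [sq_nonneg r]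
  have hsw : s < w := by nlinarith
  have h1 : l * w - D * s ≤ 2 * (l * (w / 2) + D * (s / 2) * (2 * y - 1)) := by
    have := mul_nonneg hDs hy.1.le
    nlinarith
  have h2 : D * s < l * w := by
    calc D * s ≤ l * s := by gcongr
      _ < l * w := by gcongr
  have h3 : 4 * r ≤ l * w - D * s := by
    have h4 : D * s ≤ l * w - 4 * r := by
      refine abs_le_of_sq_le_sq' ?_ (by nlinarith) |>.2
      rw [mul_pow, hD2, hs2]
      nlinarith [sq_nonneg (l - r * w)]
    linarith
  constructor <;> linarith

theorem IsCoshMixture.convolve {k : ℝ} {h₀ : ℝ → ℝ≥0∞} (hh : IsCoshMixture k h₀) {H : Measure ℝ}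
    (hH : ∫⁻ l in Set.Ioi (2:ℝ), ENNReal.ofReal ((l - 2) ^ (k - 1)) ∂H ≠ ⊤) :
    IsCoshMixture k (fun η => ∫⁻ t, h₀ (η - t) *
      ∫⁻ l in Set.Ioi (2 * Real.cosh t), ENNReal.ofReal ((l - 2 * Real.cosh t) ^ (k - 1)) ∂H) := by
  obtain ⟨ν, hν, hc, hr⟩ := hh
  have hsf : SFinite (H.restrict (Set.Ioi 2)) := by
    refine sFinite_restrict_of_lintegral_ne_top (by fun_prop) measurableSet_Ioi (fun x hx => ?_) (by simp) hH
    simp only [ne_eq, ENNReal.ofReal_eq_zero, not_le]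
    exact Real.rpow_pos_of_pos (sub_pos.2 hx) _
  set H₂ := H.restrict (Set.Ioi 2) with hH₂
  set g : ℝ → ℝ → ℝ≥0∞ := fun t l => Set.indicator {q : ℝ × ℝ | 2 * Real.cosh q.1 < q.2}
    (fun q => ENNReal.ofReal ((q.2 - 2 * Real.cosh q.1) ^ (k - 1))) (t, l) with hg
  have hgset : MeasurableSet {q : ℝ × ℝ | 2 * Real.cosh q.1 < q.2} :=
    measurableSet_lt (by fun_prop) measurable_snd
  have hgm : Measurable (fun q : ℝ × ℝ => g q.1 q.2) := by
    simp only [hg]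
    exact Measurable.indicator (by fun_prop) hgset
  have hin : ∀ t, ∫⁻ l in Set.Ioi (2 * Real.cosh t), ENNReal.ofReal ((l - 2 * Real.cosh t) ^ (k - 1)) ∂H
      = ∫⁻ l, g t l ∂H₂ := by
    intro t
    have h1 : (fun l => g t l) = Set.indicator (Set.Ioi (2 * Real.cosh t))
        (fun l => ENNReal.ofReal ((l - 2 * Real.cosh t) ^ (k - 1))) := by
      ext l
      simp [hg, Set.indicator]
    rw [h1, lintegral_indicator measurableSet_Ioi, hH₂, Measure.restrict_restrict measurableSet_Ioi]
    congr 2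
    ext l
    simp only [Set.mem_Ioi, Set.mem_inter_iff]
    have := Real.one_le_cosh t
    constructor
    · intro h
      exact ⟨h, by linarith⟩
    · exact fun h => h.1
  refine IsCoshMixture.of_measure (T := ((ℝ × ℝ) × ℝ) × ℝ) ((ν.prod H₂).prod (volume.restrict (Set.Ioo (0:ℝ) 1)))
    (w := fun q => ENNReal.ofReal ((√(q.1.2 ^ 2 - 4)) ^ (2 * k - 1) * (q.2 * (1 - q.2)) ^ (k - 1)))
    (L := fun q => q.1.1.1 * (q.1.2 / 2) +
      √(q.1.1.1 + 2 * q.1.1.2) * √(q.1.1.1 - 2 * q.1.1.2) * (√(q.1.2 ^ 2 - 4) / 2) * (2 * q.2 - 1))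
    (R := fun q => q.1.1.2)
    (by fun_prop) (by simp) (by fun_prop) (by fun_prop) ?_ fun η => ?_
  · have h1 : ∀ᵐ q ∂((ν.prod H₂).prod (volume.restrict (Set.Ioo (0:ℝ) 1))),
        0 < q.1.1.1 ∧ 0 ≤ q.1.1.2 ∧ 2 * q.1.1.2 ≤ q.1.1.1 :=
      Measure.quasiMeasurePreserving_fst.ae (Measure.quasiMeasurePreserving_fst.ae hc)
    have h2 : ∀ᵐ q ∂((ν.prod H₂).prod (volume.restrict (Set.Ioo (0:ℝ) 1))), q.2 ∈ Set.Ioo (0:ℝ) 1 :=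
      Measure.quasiMeasurePreserving_snd.ae (ae_restrict_mem measurableSet_Ioo)
    have h3 : ∀ᵐ q ∂((ν.prod H₂).prod (volume.restrict (Set.Ioo (0:ℝ) 1))), q.1.2 ∈ Set.Ioi (2:ℝ) :=
      Measure.quasiMeasurePreserving_fst.ae (Measure.quasiMeasurePreserving_snd.ae (ae_restrict_mem measurableSet_Ioi))
    filter_upwards [h1, h2, h3] with q hq1 hq2 hq3
    obtain ⟨h5, h6, h7⟩ := hq1
    have hl : 2 < q.1.2 := hq3
    have key := sub_sqrt_le_of_cone h5 h6 h7 hl hq2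
    exact ⟨key.1, h6, key.2⟩
  · have e1 : ∀ t, h₀ (η - t) * ∫⁻ l in Set.Ioi (2 * Real.cosh t), ENNReal.ofReal ((l - 2 * Real.cosh t) ^ (k - 1)) ∂H
        = ∫⁻ q : (ℝ × ℝ) × ℝ, ENNReal.ofReal ((q.1.1 + q.1.2 * (2 * Real.cosh (η - t))) ^ (-k)) * g t q.2 ∂(ν.prod H₂) := by
      intro t
      rw [hr, hin, ← lintegral_prod_mul (by fun_prop) (by fun_prop)]
    simp only [e1]
    rw [lintegral_lintegral_swap (by fun_prop)]
    symm
    rw [lintegral_prod _ (by fun_prop)]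
    symm
    have h1 : ∀ᵐ q ∂(ν.prod H₂), 0 < q.1.1 ∧ 0 ≤ q.1.2 ∧ 2 * q.1.2 ≤ q.1.1 :=
      Measure.quasiMeasurePreserving_fst.ae hc
    have h3 : ∀ᵐ q ∂(ν.prod H₂), q.2 ∈ Set.Ioi (2:ℝ) :=
      Measure.quasiMeasurePreserving_snd.ae (ae_restrict_mem measurableSet_Ioi)
    refine lintegral_congr_ae ?_
    filter_upwards [h1, h3] with q hq1 hq3
    obtain ⟨h5, h6, h7⟩ := hq1
    have hl : 2 < q.2 := hq3
    have hq4 : 0 < q.2 ^ 2 - 4 := by nlinarith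
    set a := Real.arsinh (√(q.2 ^ 2 - 4) / 2) with ha
    have ha0 : 0 < a := Real.arsinh_pos_iff.2 (by have := Real.sqrt_pos.2 hq4; positivity)
    have hsinh : Real.sinh a = √(q.2 ^ 2 - 4) / 2 := Real.sinh_arsinh _
    have hcosh : Real.cosh a = q.2 / 2 := by
      have h8 := Real.cosh_sq a
      rw [hsinh, div_pow, Real.sq_sqrt hq4.le] at h8
      have h9 : Real.cosh a ^ 2 = (q.2 / 2) ^ 2 := by rw [h8]; ring
      exact (pow_left_inj₀ (Real.cosh_pos a).le (by linarith) two_ne_zero).1 h9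
    set A := (√(q.1.1 + 2 * q.1.2) + √(q.1.1 - 2 * q.1.2)) / 2 with hA
    set B := (√(q.1.1 + 2 * q.1.2) - √(q.1.1 - 2 * q.1.2)) / 2 with hB
    have hs1 := Real.sq_sqrt (by linarith : 0 ≤ q.1.1 + 2 * q.1.2)
    have hs2 := Real.sq_sqrt (by linarith : 0 ≤ q.1.1 - 2 * q.1.2)
    have hAB : A * B = q.1.2 := by simp only [hA, hB]; linarith
    have hAB2 : A ^ 2 + B ^ 2 = q.1.1 := by simp only [hA, hB]; linarith
    have hAB3 : A ^ 2 - B ^ 2 = √(q.1.1 + 2 * q.1.2) * √(q.1.1 - 2 * q.1.2) := by simp only [hA, hB]; ring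
    have hA0 : 0 < A := by
      have := Real.sqrt_pos.2 (by linarith : 0 < q.1.1 + 2 * q.1.2)
      positivity
    have hB0 : 0 ≤ B := by
      have := Real.sqrt_le_sqrt (by linarith : q.1.1 - 2 * q.1.2 ≤ q.1.1 + 2 * q.1.2)
      simp only [hB]; linarith
    have key := lintegral_cosh_kernel (k := k) (η := η) hB0 hA0 ha0
    have hset : ∀ t, t ∈ Set.Ioo (-a) a ↔ 2 * Real.cosh t < q.2 := by
      intro t
      have h8 : Real.cosh t < Real.cosh a ↔ |t| < |a| := Real.cosh_lt_cosh
      rw [abs_of_pos ha0, hcosh] at h8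
      rw [Set.mem_Ioo, ← abs_lt, ← h8]
      constructor <;> intro h <;> linarith
    have e2 : (fun t => ENNReal.ofReal ((q.1.1 + q.1.2 * (2 * Real.cosh (η - t))) ^ (-k)) * g t q.2) =
      Set.indicator (Set.Ioo (-a) a) (fun t => ENNReal.ofReal
        ((A ^ 2 + B ^ 2 + A * B * (2 * Real.cosh (η - t))) ^ (-k) *
        (2 * Real.cosh a - 2 * Real.cosh t) ^ (k - 1))) := by
      ext t
      rw [hAB, hAB2, hcosh]
      by_cases ht : t ∈ Set.Ioo (-a) a
      · have ht2 := (hset t).1 ht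
        rw [Set.indicator_of_mem ht]
        have : g t q.2 = ENNReal.ofReal ((q.2 - 2 * Real.cosh t) ^ (k - 1)) := by
          simp only [hg]
          rw [Set.indicator_of_mem (by simpa using ht2)]
        have hch := Real.cosh_pos (η - t)
        rw [this, ← ENNReal.ofReal_mul (by positivity)]
        congr 3
        ring
      · have ht2 := (hset t).not.1 ht
        rw [Set.indicator_of_notMem ht]
        have : g t q.2 = 0 := by
          simp only [hg]
          rw [Set.indicator_of_notMem (by simpa using ht2)]
        rw [this, mul_zero]
    rw [e2, lintegral_indicator measurableSet_Ioo, key]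
    refine setLIntegral_congr_fun measurableSet_Ioo fun y hy => ?_
    have hy1 : 0 < 1 - y := by linarith [hy.2]
    have hy0 := hy.1
    rw [hAB, hAB2, hAB3, hcosh, hsinh, ← ENNReal.ofReal_mul (by positivity)]
    congr 1
    have : 2 * (√(q.2 ^ 2 - 4) / 2) = √(q.2 ^ 2 - 4) := by ring
    rw [this]
    ring

theorem isOpen_strip : IsOpen {ζ : ℂ | |ζ.im| < π} :=
  isOpen_lt (by fun_prop) continuous_const

theorem convex_strip : Convex ℝ {ζ : ℂ | |ζ.im| < π} := by
  have : {ζ : ℂ | |ζ.im| < π} = Complex.imLm ⁻¹' Set.Ioo (-π) π := by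
    ext ζ; simp [abs_lt]
  rw [this]
  exact (convex_Ioo _ _).linear_preimage _

theorem eqOn_strip_of_eqOn_real {J G : ℂ → ℂ} (hJ : DifferentiableOn ℂ J {ζ | |ζ.im| < π})
    (hG : DifferentiableOn ℂ G {ζ | |ζ.im| < π}) (h : ∀ η : ℝ, J η = G η) :
    Set.EqOn J G {ζ | |ζ.im| < π} := by
  refine (hJ.analyticOnNhd isOpen_strip).eqOn_of_preconnected_of_frequently_eq
    (hG.analyticOnNhd isOpen_strip) convex_strip.isPreconnected
    (z₀ := 0) (by simp [Real.pi_pos]) ?_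
  have h1 : Filter.Tendsto (fun η : ℝ => (η : ℂ)) (nhdsWithin 0 {0}ᶜ) (nhdsWithin 0 {0}ᶜ) := by
    refine tendsto_nhdsWithin_of_tendsto_nhds_of_eventually_within _ ?_ ?_
    · exact (Complex.continuous_ofReal.tendsto' 0 0 (by simp)).mono_left nhdsWithin_le_nhds
    · filter_upwards [self_mem_nhdsWithin] with η hη
      simpa using hη
  exact h1.frequently (Filter.Frequently.of_forall h)

theorem cos_half_pos_of_abs_lt_pi {θ : ℝ} (h : |θ| < π) : 0 < Real.cos (θ / 2) := by
  rw [abs_lt] at h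
  exact Real.cos_pos_of_mem_Ioo ⟨by linarith, by linarith⟩

theorem cosh_re_im (ζ : ℂ) : (Complex.cosh ζ).re = Real.cosh ζ.re * Real.cos ζ.im ∧
    (Complex.cosh ζ).im = Real.sinh ζ.re * Real.sin ζ.im := by
  have : Complex.cosh ζ = Complex.cosh ((ζ.re : ℂ) + ζ.im * Complex.I) := by rw [Complex.re_add_im]
  rw [this, Complex.cosh_add, Complex.cosh_mul_I, Complex.sinh_mul_I]
  simp [← Complex.ofReal_cosh, ← Complex.ofReal_sinh, ← Complex.ofReal_cos, ← Complex.ofReal_sin]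

theorem cosh_kernel_mem_slitPlane {L R : ℝ} (hL : 0 < L) (hR : 0 ≤ R) (hRL : 2 * R ≤ L) {ζ : ℂ}
    (hζ : |ζ.im| < π) : (L : ℂ) + R * (2 * Complex.cosh ζ) ∈ Complex.slitPlane := by
  obtain ⟨h1, h2⟩ := cosh_re_im ζ
  have hre : ((L : ℂ) + R * (2 * Complex.cosh ζ)).re = L + R * (2 * (Real.cosh ζ.re * Real.cos ζ.im)) := by
    simp [h1]
  have him : ((L : ℂ) + R * (2 * Complex.cosh ζ)).im = R * (2 * (Real.sinh ζ.re * Real.sin ζ.im)) := by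
    simp [h2]
  rw [Complex.mem_slitPlane_iff, hre, him]
  by_contra! h
  obtain ⟨h3, h4⟩ := h
  rcases hR.eq_or_lt with hR0 | hR0
  · rw [← hR0] at h3; linarith
  have h5 : Real.sinh ζ.re = 0 ∨ Real.sin ζ.im = 0 := by
    simpa [hR0.ne'] using h4
  have hcos : -1 < Real.cos ζ.im := by
    have := cos_half_pos_of_abs_lt_pi hζ
    have h6 : Real.cos ζ.im = 2 * Real.cos (ζ.im / 2) ^ 2 - 1 := by rw [← Real.cos_two_mul]; ring_nf
    rw [h6]; nlinarith
  rcases h5 with h5 | h5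
  · rw [Real.sinh_eq_zero] at h5
    rw [h5, Real.cosh_zero] at h3
    nlinarith
  · have h6 : ζ.im = 0 := (Real.sin_eq_zero_iff_of_lt_of_lt (abs_lt.1 hζ).1 (abs_lt.1 hζ).2).1 h5
    rw [h6, Real.cos_zero] at h3
    have := Real.cosh_pos ζ.re
    nlinarith [mul_pos hR0 this]

theorem le_norm_cosh_kernel {L R : ℝ} (hL : 0 < L) (hR : 0 ≤ R) (hRL : 2 * R ≤ L) (ζ : ℂ) :
    Real.cos (ζ.im / 2) ^ 2 * (L + R * 2) ≤ ‖(L : ℂ) + R * (2 * Complex.cosh ζ)‖ := by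
  obtain ⟨h1, h2⟩ := cosh_re_im ζ
  have hc : Real.cos (ζ.im / 2) ^ 2 = (1 + Real.cos ζ.im) / 2 := by
    have h6 : Real.cos ζ.im = 2 * Real.cos (ζ.im / 2) ^ 2 - 1 := by rw [← Real.cos_two_mul]; ring_nf
    rw [h6]; ring
  have hre : ((L : ℂ) + R * (2 * Complex.cosh ζ)).re = L + R * (2 * (Real.cosh ζ.re * Real.cos ζ.im)) := by
    simp [h1]
  have him : ((L : ℂ) + R * (2 * Complex.cosh ζ)).im = R * (2 * (Real.sinh ζ.re * Real.sin ζ.im)) := by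
    simp [h2]
  refine le_of_sq_le_sq ?_ (norm_nonneg _)
  rw [Complex.sq_norm, Complex.normSq_apply, hre, him, hc]
  have hsh := Real.cosh_sq ζ.re
  have hsc := Real.sin_sq_add_cos_sq ζ.im
  have hc1 := Real.neg_one_le_cos ζ.im
  have hc2 := Real.cos_le_one ζ.im
  have hch := Real.one_le_cosh ζ.re
  set ch := Real.cosh ζ.re
  set sh := Real.sinh ζ.re
  set κ := Real.cos ζ.im
  set σ := Real.sin ζ.im
  have e : (L + R * (2 * (ch * κ))) * (L + R * (2 * (ch * κ))) + R * (2 * (sh * σ)) * (R * (2 * (sh * σ)))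
      = L ^ 2 + 2 * L * (2 * R * ch) * κ + (2 * R * ch) ^ 2 - (2 * R) ^ 2 * (1 - κ ^ 2) := by
    have e1 : sh ^ 2 = ch ^ 2 - 1 := by linarith
    have e2 : σ ^ 2 = 1 - κ ^ 2 := by linarith
    calc _ = (L + R * (2 * (ch * κ))) ^ 2 + 4 * R ^ 2 * sh ^ 2 * σ ^ 2 := by ring
      _ = _ := by rw [e1, e2]; ring
  rw [e]
  set p := 2 * R with hp
  set q := p * ch with hq
  have hp0 : 0 ≤ p := by positivity
  have hpq : p ≤ q := by simpa [hq] using mul_le_mul_of_nonneg_left hch hp0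
  have hk : 0 ≤ 1 - κ ^ 2 := by nlinarith
  have hp2 : p ^ 2 ≤ L ^ 2 := by gcongr
  have hpq2 : p ^ 2 ≤ q ^ 2 := by gcongr
  have a1 : (q + L * κ) ^ 2 ≤ L ^ 2 + 2 * L * q * κ + q ^ 2 - p ^ 2 * (1 - κ ^ 2) := by nlinarith
  have a2 : (L + q * κ) ^ 2 ≤ L ^ 2 + 2 * L * q * κ + q ^ 2 - p ^ 2 * (1 - κ ^ 2) := by nlinarith
  have a3 : ((1 + κ) / 2 * (L + q)) ^ 2 ≤ L ^ 2 + 2 * L * q * κ + q ^ 2 - p ^ 2 * (1 - κ ^ 2) := by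
    nlinarith [sq_nonneg ((q + L * κ) - (L + q * κ))]
  refine le_trans ?_ a3
  have : 0 ≤ (1 + κ) / 2 := by linarith
  have : 0 ≤ L + R * 2 := by positivity
  gcongr
  linarith

theorem IsCoshMixture.re_mono {k : ℝ} {h : ℝ → ℝ≥0∞} (hk : 0 < k) (hh : IsCoshMixture k h)
    (h0 : h 0 ≠ ⊤) {J : ℂ → ℂ} (hJ : DifferentiableOn ℂ J {ζ | |ζ.im| < π})
    (hJh : ∀ η : ℝ, J η = ((h η).toReal : ℂ)) {θ₁ θ₂ : ℝ} (h₁ : |θ₁| < π) (h₂ : |θ₂| < π)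
    (hc : Real.cos θ₂ ≤ Real.cos θ₁) :
    (J (θ₁ * Complex.I)).re ≤ (J (θ₂ * Complex.I)).re := by
  obtain ⟨ν, hν, hcone, hrep⟩ := hh
  set κ : ℂ → ℝ × ℝ → ℂ := fun ζ p => ((p.1 : ℂ) + p.2 * (2 * Complex.cosh ζ)) ^ (-(k : ℂ)) with hκ
  have hint0 : Integrable (fun p : ℝ × ℝ => (p.1 + p.2 * 2) ^ (-k)) ν := by
    have h1 : ∫⁻ p, ENNReal.ofReal ((p.1 + p.2 * 2) ^ (-k)) ∂ν ≠ ⊤ := by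
      have := hrep 0
      simp only [Real.cosh_zero, mul_one] at this
      rwa [← this]
    refine (lintegral_ofReal_ne_top_iff_integrable (Measurable.aestronglyMeasurable (by fun_prop)) ?_).1 h1
    filter_upwards [hcone] with p hp
    have := hp.1
    have := hp.2.1
    positivity
  have hmeas : ∀ ζ ∈ {ζ : ℂ | |ζ.im| < π}, AEStronglyMeasurable (κ ζ) ν := fun ζ _ => by
    refine Measurable.aestronglyMeasurable ?_
    simp only [hκ]
    fun_prop
  have hbd : ∀ᵐ p ∂ν, ∀ ζ ∈ {ζ : ℂ | |ζ.im| < π},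
      ‖κ ζ p‖ ≤ (Real.cos (ζ.im / 2) ^ 2) ^ (-k) * (p.1 + p.2 * 2) ^ (-k) := by
    filter_upwards [hcone] with p hp ζ hζ
    have hcp := cos_half_pos_of_abs_lt_pi hζ
    have := hp.1
    have := hp.2.1
    rw [← Real.mul_rpow (by positivity) (by positivity)]
    have e1 : ‖κ ζ p‖ = ‖(p.1 : ℂ) + p.2 * (2 * Complex.cosh ζ)‖ ^ (-k) := by
      simp only [hκ]
      rw [← Complex.ofReal_neg, Complex.norm_cpow_real]
    rw [e1]
    exact Real.rpow_le_rpow_of_nonpos (by positivity) (le_norm_cosh_kernel hp.1 hp.2.1 hp.2.2 ζ) (by linarith)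
  have hG : DifferentiableOn ℂ (fun ζ => ∫ p, κ ζ p ∂ν) {ζ | |ζ.im| < π} := by
    refine differentiableOn_integral_of_locally_dominated isOpen_strip hmeas ?_
      (C := fun ζ => (Real.cos (ζ.im / 2) ^ 2) ^ (-k)) ?_ hint0 hbd
    · filter_upwards [hcone] with p hp
      simp only [hκ]
      refine DifferentiableOn.cpow_const (by fun_prop) fun ζ hζ => ?_
      exact cosh_kernel_mem_slitPlane hp.1 hp.2.1 hp.2.2 hζ
    · refine ContinuousOn.rpow_const (by fun_prop) fun ζ hζ => Or.inl ?_
      exact (pow_pos (cos_half_pos_of_abs_lt_pi hζ) 2).ne'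
  have hreal : ∀ c : ℝ, -1 ≤ c → ∀ᵐ p ∂ν, ((p.1 : ℂ) + p.2 * (2 * (c : ℂ))) ^ (-(k : ℂ)) =
      ((p.1 + p.2 * (2 * c)) ^ (-k) : ℝ) := by
    intro c hc
    filter_upwards [hcone] with p hp
    have : 0 ≤ p.1 + p.2 * (2 * c) := by nlinarith [hp.1, hp.2.1, hp.2.2]
    rw [Complex.ofReal_cpow this]
    push_cast
    rfl
  have hEq := eqOn_strip_of_eqOn_real hJ hG fun η => by
    rw [hJh, hrep]
    have h1 := hreal (Real.cosh η) (by linarith [Real.one_le_cosh η])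
    have h2 : ∫ p, κ η p ∂ν = ∫ p, (((p.1 + p.2 * (2 * Real.cosh η)) ^ (-k) : ℝ) : ℂ) ∂ν := by
      refine integral_congr_ae ?_
      filter_upwards [h1] with p hp
      rw [← hp]
      simp [hκ]
    simp only [h2]
    rw [integral_complex_ofReal, integral_eq_lintegral_of_nonneg_ae _ (Measurable.aestronglyMeasurable (by fun_prop))]
    filter_upwards [hcone] with p hp
    have := hp.1
    have := hp.2.1
    have := Real.cosh_pos η
    simp only [Pi.zero_apply]
    positivity
  have hval : ∀ θ : ℝ, |θ| < π → Integrable (fun p : ℝ × ℝ => (p.1 + p.2 * (2 * Real.cos θ)) ^ (-k)) ν ∧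
      (J (θ * Complex.I)).re = ∫ p, (p.1 + p.2 * (2 * Real.cos θ)) ^ (-k) ∂ν := by
    intro θ hθ
    have hmem : (θ * Complex.I) ∈ {ζ : ℂ | |ζ.im| < π} := by simpa using hθ
    have h1 := hreal (Real.cos θ) (Real.neg_one_le_cos θ)
    have h3 : κ (θ * Complex.I) =ᵐ[ν] fun p => (((p.1 + p.2 * (2 * Real.cos θ)) ^ (-k) : ℝ) : ℂ) := by
      filter_upwards [h1] with p hp
      rw [← hp]
      simp [hκ, Complex.cosh_mul_I]
    have h4 : Integrable (κ (θ * Complex.I)) ν := by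
      refine Integrable.mono' (hint0.const_mul ((Real.cos ((θ * Complex.I : ℂ).im / 2) ^ 2) ^ (-k))) (hmeas _ hmem) ?_
      filter_upwards [hbd] with p hp
      exact hp _ hmem
    have h5 := (h4.congr h3).re
    refine ⟨by simpa using h5, ?_⟩
    rw [hEq hmem]
    simp only
    rw [integral_congr_ae h3, integral_complex_ofReal, Complex.ofReal_re]
  rw [(hval θ₁ h₁).2, (hval θ₂ h₂).2]
  refine integral_mono_ae (hval θ₁ h₁).1 (hval θ₂ h₂).1 ?_
  have hc2 : -1 < Real.cos θ₂ := by
    have := cos_half_pos_of_abs_lt_pi h₂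
    have h6 : Real.cos θ₂ = 2 * Real.cos (θ₂ / 2) ^ 2 - 1 := by rw [← Real.cos_two_mul]; ring_nf
    rw [h6]; nlinarith
  filter_upwards [hcone] with p hp
  obtain ⟨h5, h6, h7⟩ := hp
  refine Real.rpow_le_rpow_of_nonpos ?_ (by gcongr) (by linarith)
  rcases h6.eq_or_lt with h8 | h8
  · rw [← h8]; linarith
  · nlinarith

/-- Analytic kernels on the strip `|Im ζ| < π` whose symmetrized products are mixtures of
powers of `L + 2 R cosh`. -/
def IsCoshKernel (k : ℝ) (K : ℂ → ℂ) : Prop :=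
  DifferentiableOn ℂ K {ζ | |ζ.im| < π} ∧
  (∀ ζ : ℂ, |ζ.im| < π → ‖K ζ‖ ≤ Real.cos (ζ.im / 2) ^ (-k)) ∧
  (∀ ζ : ℂ, |ζ.im| < π → K (starRingEnd ℂ ζ) = starRingEnd ℂ (K ζ)) ∧
  ∀ a : ℝ, ∃ r : ℝ → ℝ, (∀ u, 0 ≤ r u) ∧ IsCoshMixture k (fun u => ENNReal.ofReal (r u)) ∧
    ∀ u : ℝ, K (a + u) * K (a - u) = r u

theorem one_add_mul_exp_mem_slitPlane {c : ℝ} (hc : 0 ≤ c) {ζ : ℂ} (hζ : |ζ.im| < π) :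
    1 + (c : ℂ) * Complex.exp ζ ∈ Complex.slitPlane := by
  have hre : (1 + (c : ℂ) * Complex.exp ζ).re = 1 + c * (Real.exp ζ.re * Real.cos ζ.im) := by
    simp [Complex.exp_re]
  have him : (1 + (c : ℂ) * Complex.exp ζ).im = c * (Real.exp ζ.re * Real.sin ζ.im) := by
    simp [Complex.exp_im]
  rw [Complex.mem_slitPlane_iff, hre, him]
  by_contra! h
  obtain ⟨h1, h2⟩ := h
  rcases hc.eq_or_lt with h0 | h0
  · rw [← h0] at h1; linarith
  have h3 : Real.sin ζ.im = 0 := by simpa [h0.ne', Real.exp_ne_zero] using h2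
  rw [(Real.sin_eq_zero_iff_of_lt_of_lt (abs_lt.1 hζ).1 (abs_lt.1 hζ).2).1 h3, Real.cos_zero] at h1
  have := Real.exp_pos ζ.re
  nlinarith [mul_pos h0 this]

theorem le_norm_one_add_mul_exp (c : ℝ) {ζ : ℂ} (hζ : |ζ.im| < π) :
    Real.cos (ζ.im / 2) * (1 + c * Real.exp ζ.re) ≤ ‖1 + (c : ℂ) * Complex.exp ζ‖ := by
  have hre : (1 + (c : ℂ) * Complex.exp ζ).re = 1 + c * (Real.exp ζ.re * Real.cos ζ.im) := by
    simp [Complex.exp_re]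
  have him : (1 + (c : ℂ) * Complex.exp ζ).im = c * (Real.exp ζ.re * Real.sin ζ.im) := by
    simp [Complex.exp_im]
  have hcp := cos_half_pos_of_abs_lt_pi hζ
  have hcs : Real.cos (ζ.im / 2) ^ 2 = (1 + Real.cos ζ.im) / 2 := by
    have h6 : Real.cos ζ.im = 2 * Real.cos (ζ.im / 2) ^ 2 - 1 := by rw [← Real.cos_two_mul]; ring_nf
    rw [h6]; ring
  refine le_of_sq_le_sq ?_ (norm_nonneg _)
  rw [Complex.sq_norm, Complex.normSq_apply, hre, him, mul_pow, hcs]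
  have hsc := Real.sin_sq_add_cos_sq ζ.im
  have hc2 := Real.cos_le_one ζ.im
  set ρ := c * Real.exp ζ.re with hρ
  have e : (1 + c * (Real.exp ζ.re * Real.cos ζ.im)) * (1 + c * (Real.exp ζ.re * Real.cos ζ.im)) +
      c * (Real.exp ζ.re * Real.sin ζ.im) * (c * (Real.exp ζ.re * Real.sin ζ.im)) =
      1 + 2 * ρ * Real.cos ζ.im + ρ ^ 2 * (Real.sin ζ.im ^ 2 + Real.cos ζ.im ^ 2) := by
    rw [hρ]; ring
  rw [e, hsc]
  nlinarith [mul_nonneg (sub_nonneg.2 hc2) (sq_nonneg (1 - ρ))]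

theorem isCoshKernel_prod {ι : Type*} (S : Finset ι) {k : ℝ} {c β : ι → ℝ} (hc : ∀ i, 0 ≤ c i)
    (hβ : ∀ i, 0 ≤ β i) (hk : ∑ i ∈ S, β i < k) :
    IsCoshKernel k (fun ζ => ∏ i ∈ S, (1 + (c i : ℂ) * Complex.exp ζ) ^ (-(β i : ℂ))) := by
  refine ⟨?_, fun ζ hζ => ?_, fun ζ hζ => ?_, fun a => ?_⟩
  · refine DifferentiableOn.fun_finsetProd fun i _ => ?_
    exact DifferentiableOn.cpow_const (by fun_prop) fun ζ hζ =>
      one_add_mul_exp_mem_slitPlane (hc i) hζ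
  · have hcp := cos_half_pos_of_abs_lt_pi hζ
    rw [norm_prod]
    calc ∏ i ∈ S, ‖(1 + (c i : ℂ) * Complex.exp ζ) ^ (-(β i : ℂ))‖
        ≤ ∏ i ∈ S, Real.cos (ζ.im / 2) ^ (-β i) := by
          refine Finset.prod_le_prod (fun _ _ => norm_nonneg _) fun i _ => ?_
          rw [← Complex.ofReal_neg, Complex.norm_cpow_real]
          refine Real.rpow_le_rpow_of_nonpos hcp ?_ (by linarith [hβ i])
          refine le_trans ?_ (le_norm_one_add_mul_exp (c i) hζ)
          have := mul_nonneg (hc i) (Real.exp_pos ζ.re).le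
          nlinarith
      _ = Real.cos (ζ.im / 2) ^ (∑ i ∈ S, -β i) := (Real.rpow_sum_of_pos hcp _ _).symm
      _ ≤ Real.cos (ζ.im / 2) ^ (-k) :=
          Real.rpow_le_rpow_of_exponent_ge hcp (Real.cos_le_one _)
            (by rw [Finset.sum_neg_distrib]; linarith)
  · rw [map_prod]
    refine Finset.prod_congr rfl fun i _ => ?_
    have h1 := one_add_mul_exp_mem_slitPlane (hc i) hζ
    have h2 := Complex.cpow_conj (1 + (c i : ℂ) * Complex.exp ζ) (-(β i : ℂ))
      (Complex.mem_slitPlane_iff_arg.1 h1).1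
    simp only [map_neg, Complex.conj_ofReal, map_add, map_one, map_mul, ← Complex.exp_conj] at h2
    rw [h2, Complex.conj_conj]
  · refine ⟨fun u => ∏ i ∈ S, (1 + (c i * Real.exp a) ^ 2 + c i * Real.exp a * (2 * Real.cosh u)) ^ (-β i),
      fun u => ?_, ?_, fun u => ?_⟩
    · refine Finset.prod_nonneg fun i _ => Real.rpow_nonneg ?_ _
      have := hc i
      have := Real.cosh_pos u
      positivity
    · have := isCoshMixture_prod S (sub_pos.2 hk) hβ (L := fun i => 1 + (c i * Real.exp a) ^ 2)
        (R := fun i => c i * Real.exp a) (fun i => by positivity)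
        (fun i => mul_nonneg (hc i) (Real.exp_pos a).le)
        (fun i => by nlinarith [sq_nonneg (1 - c i * Real.exp a)])
      simpa using this
    · simp only
      rw [← Finset.prod_mul_distrib]
      push_cast
      refine Finset.prod_congr rfl fun i _ => ?_
      have p1 : 0 ≤ 1 + c i * Real.exp (a + u) := by have := hc i; positivity
      have p2 : 0 ≤ 1 + c i * Real.exp (a - u) := by have := hc i; positivity
      have e1 : 1 + (c i : ℂ) * Complex.exp (a + u) = ((1 + c i * Real.exp (a + u) : ℝ) : ℂ) := by
        push_cast; rfl
      have e2 : 1 + (c i : ℂ) * Complex.exp (a - u) = ((1 + c i * Real.exp (a - u) : ℝ) : ℂ) := by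
        push_cast; rfl
      rw [e1, e2, ← Complex.mul_cpow_ofReal_nonneg p1 p2, ← Complex.ofReal_mul]
      have e3 : (1 + c i * Real.exp (a + u)) * (1 + c i * Real.exp (a - u)) =
          1 + (c i * Real.exp a) ^ 2 + c i * Real.exp a * (2 * Real.cosh u) := by
        rw [Real.cosh_eq, Real.exp_add, sub_eq_add_neg, Real.exp_add, Real.exp_neg]
        have := (Real.exp_pos u).ne'
        field_simp
        ring
      rw [e3]
      have p3 := e3 ▸ mul_nonneg p1 p2
      rw [Complex.ofReal_cpow p3]
      push_cast
      rfl

theorem IsCoshKernel.continuous_comp {k : ℝ} {K : ℂ → ℂ} (hK : IsCoshKernel k K) {T : Type*} [TopologicalSpace T]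
    {γ : T → ℂ} (hγ : Continuous γ) (hs : ∀ t, |(γ t).im| < π) : Continuous (fun t => K (γ t)) :=
  hK.1.continuousOn.comp_continuous hγ hs

theorem IsCoshKernel.norm_mul_le {k : ℝ} {K : ℂ → ℂ} (hK : IsCoshKernel k K) {z w : ℂ} {θ : ℝ}
    (hθ : |θ| < π) (hz : |z.im| = |θ|) (hw : |w.im| = |θ|) :
    ‖K z * K w‖ ≤ Real.cos (θ / 2) ^ (-k) * Real.cos (θ / 2) ^ (-k) := by
  have h : ∀ z : ℂ, |z.im| = |θ| → ‖K z‖ ≤ Real.cos (θ / 2) ^ (-k) := by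
    intro z hz
    refine (hK.2.1 z (hz ▸ hθ)).trans_eq ?_
    rw [← Real.cos_abs (z.im / 2), ← Real.cos_abs (θ / 2), abs_div, abs_div, hz]
  rw [norm_mul]
  exact mul_le_mul (h z hz) (h w hw) (norm_nonneg _)
    (Real.rpow_nonneg (cos_half_pos_of_abs_lt_pi hθ).le _)

theorem IsCoshKernel.re_integral_mono {k : ℝ} (hk : 0 < k) {K : ℂ → ℂ} (hK : IsCoshKernel k K) (a : ℝ)
    {w : ℝ → ℝ} (hw0 : ∀ t, 0 ≤ w t) (hw : Integrable w) {H : Measure ℝ}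
    (hH : ∫⁻ l in Set.Ioi (2:ℝ), ENNReal.ofReal ((l - 2) ^ (k - 1)) ∂H ≠ ⊤)
    (hwH : ∀ᵐ t, ENNReal.ofReal (w t) =
      ∫⁻ l in Set.Ioi (2 * Real.cosh t), ENNReal.ofReal ((l - 2 * Real.cosh t) ^ (k - 1)) ∂H)
    {θ₁ θ₂ : ℝ} (h₁ : |θ₁| < π) (h₂ : |θ₂| < π) (hc : Real.cos θ₂ ≤ Real.cos θ₁) :
    (∫ t : ℝ, K (a + (θ₁ * Complex.I - t)) * K (a - (θ₁ * Complex.I - t)) * (w t : ℂ)).re ≤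
      (∫ t : ℝ, K (a + (θ₂ * Complex.I - t)) * K (a - (θ₂ * Complex.I - t)) * (w t : ℂ)).re := by
  obtain ⟨r, hr0, hrm, hr⟩ := hK.2.2.2 a
  have hcont : ∀ ζ : ℂ, |ζ.im| < π → Continuous fun t : ℝ => K (a + (ζ - t)) * K (a - (ζ - t)) := by
    intro ζ hζ
    exact (hK.continuous_comp (by fun_prop) (by simpa using hζ)).mul
      (hK.continuous_comp (by fun_prop) (by simpa using hζ))
  have hrc : Continuous r := by
    have h1 : Continuous fun u : ℝ => (K (a + u) * K (a - u)).re :=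
      Complex.continuous_re.comp ((hK.continuous_comp (by fun_prop) (by simp [Real.pi_pos])).mul
        (hK.continuous_comp (by fun_prop) (by simp [Real.pi_pos])))
    simpa only [hr, Complex.ofReal_re] using h1
  have hwm : AEStronglyMeasurable (fun t => (w t : ℂ)) := Complex.continuous_ofReal.comp_aestronglyMeasurable hw.1
  have hmeas : ∀ ζ ∈ {ζ : ℂ | |ζ.im| < π}, AEStronglyMeasurable
      (fun t : ℝ => K (a + (ζ - t)) * K (a - (ζ - t)) * (w t : ℂ)) := fun ζ hζ =>
    (hcont ζ hζ).aestronglyMeasurable.mul hwm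
  have hbd : ∀ t : ℝ, ∀ ζ ∈ {ζ : ℂ | |ζ.im| < π}, ‖K (a + (ζ - t)) * K (a - (ζ - t)) * (w t : ℂ)‖ ≤
      Real.cos (ζ.im / 2) ^ (-k) * Real.cos (ζ.im / 2) ^ (-k) * w t := by
    intro t ζ hζ
    rw [norm_mul, Complex.norm_real, Real.norm_of_nonneg (hw0 t)]
    exact mul_le_mul_of_nonneg_right (hK.norm_mul_le hζ (by simp) (by simp)) (hw0 t)
  have hJ : DifferentiableOn ℂ (fun ζ : ℂ => ∫ t : ℝ, K (a + (ζ - t)) * K (a - (ζ - t)) * (w t : ℂ))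
      {ζ | |ζ.im| < π} := by
    refine differentiableOn_integral_of_locally_dominated isOpen_strip hmeas
      (Filter.Eventually.of_forall fun t => ?_)
      (C := fun ζ => Real.cos (ζ.im / 2) ^ (-k) * Real.cos (ζ.im / 2) ^ (-k)) ?_ hw
      (Filter.Eventually.of_forall hbd)
    · refine DifferentiableOn.mul_const (DifferentiableOn.mul ?_ ?_) _
      · exact hK.1.comp (by fun_prop) fun ζ hζ => by simpa using hζ
      · exact hK.1.comp (by fun_prop) fun ζ hζ => by simpa using hζ
    · have h1 : ContinuousOn (fun ζ : ℂ => Real.cos (ζ.im / 2) ^ (-k)) {ζ | |ζ.im| < π} :=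
        ContinuousOn.rpow_const (by fun_prop) fun ζ hζ => Or.inl (cos_half_pos_of_abs_lt_pi hζ).ne'
      exact h1.mul h1
  have hconv := hrm.convolve hH
  set h : ℝ → ℝ≥0∞ := fun η => ∫⁻ t, ENNReal.ofReal (r (η - t)) *
      ∫⁻ l in Set.Ioi (2 * Real.cosh t), ENNReal.ofReal ((l - 2 * Real.cosh t) ^ (k - 1)) ∂H with hh
  have hval : ∀ η : ℝ, Integrable (fun t => r (η - t) * w t) ∧
      h η = ENNReal.ofReal (∫ t, r (η - t) * w t) := by
    intro η
    have hi : Integrable (fun t => r (η - t) * w t) := by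
      refine Integrable.mono' (hw.const_mul (Real.cos (0 / 2) ^ (-k) * Real.cos (0 / 2) ^ (-k)))
        ((by fun_prop : Continuous fun t => r (η - t)).aestronglyMeasurable.mul hw.1)
        (Filter.Eventually.of_forall fun t => ?_)
      rw [norm_mul, Real.norm_of_nonneg (hw0 t)]
      refine mul_le_mul_of_nonneg_right ?_ (hw0 t)
      rw [← Complex.norm_real, ← hr]
      exact hK.norm_mul_le (by simp [Real.pi_pos]) (by simp) (by simp)
    refine ⟨hi, ?_⟩
    rw [ofReal_integral_eq_lintegral_ofReal hi
      (Filter.Eventually.of_forall fun t => mul_nonneg (hr0 _) (hw0 t))]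
    refine lintegral_congr_ae ?_
    filter_upwards [hwH] with t ht
    rw [← ht, ENNReal.ofReal_mul (hr0 _)]
  refine hconv.re_mono hk ?_ hJ (fun η => ?_) h₁ h₂ hc
  · rw [(hval 0).2]; exact ENNReal.ofReal_ne_top
  · rw [(hval η).2, ENNReal.toReal_ofReal (integral_nonneg fun t => mul_nonneg (hr0 _) (hw0 t)),
      ← integral_complex_ofReal]
    refine integral_congr_ae (Filter.Eventually.of_forall fun t => ?_)
    simp only
    rw [← Complex.ofReal_sub, hr, Complex.ofReal_mul]

/-- The values of a probability density `g` on the line along centred pairs `c / 2 ± t` are, for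
almost every `c`, of the form required by hyperbolic monotonicity of order `k`. -/
def IsLogHM (k : ℝ) (g : ℝ → ℝ) : Prop :=
  ∀ᵐ c : ℝ, ∃ H : Measure ℝ, ∫⁻ l in Set.Ioi (2:ℝ), ENNReal.ofReal ((l - 2) ^ (k - 1)) ∂H ≠ ⊤ ∧
    ∀ᵐ t, ENNReal.ofReal (g (c / 2 + t) * g (c / 2 - t)) =
      ∫⁻ l in Set.Ioi (2 * Real.cosh t), ENNReal.ofReal ((l - 2 * Real.cosh t) ^ (k - 1)) ∂H

theorem IsCoshKernel.norm_integral_mono {k : ℝ} (hk : 0 < k) {K : ℂ → ℂ} (hK : IsCoshKernel k K)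
    {g : ℝ → ℝ} (hg0 : ∀ y, 0 ≤ g y) (hg : Integrable g) (hgH : IsLogHM k g) (x : ℝ)
    {θ₁ θ₂ : ℝ} (h₁ : |θ₁| < π) (h₂ : |θ₂| < π) (hc : Real.cos θ₂ ≤ Real.cos θ₁) :
    ‖∫ y : ℝ, K (x + θ₁ * Complex.I - y) * (g y : ℂ)‖ ≤ ‖∫ y : ℝ, K (x + θ₂ * Complex.I - y) * (g y : ℂ)‖ := by
  set G : ℝ → ℝ → ℂ := fun θ y => K (x + θ * Complex.I - y) * (g y : ℂ) with hG
  have hGi : ∀ θ : ℝ, |θ| < π → Integrable (G θ) := by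
    intro θ hθ
    refine hg.ofReal.bdd_mul (c := Real.cos (θ / 2) ^ (-k)) ?_ (Filter.Eventually.of_forall fun y => ?_)
    · exact (hK.continuous_comp (by fun_prop) (by simpa using hθ)).aestronglyMeasurable
    · simpa using hK.2.1 (x + θ * Complex.I - y) (by simpa using hθ)
  have hshear := measurePreserving_prod_sub_swap (volume : Measure ℝ) (volume : Measure ℝ)
  have hgprod : ∀ᵐ c : ℝ, Integrable (fun t => g (c / 2 + t) * g (c / 2 - t)) := by
    have h1 : Integrable (fun z : ℝ × ℝ => g z.1 * g z.2) (volume.prod volume) := hg.mul_prod hg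
    have h2 := (hshear.integrable_comp_of_integrable h1).prod_right_ae
    filter_upwards [h2] with c hc
    have h3 := hc.comp_add_left (c / 2)
    refine h3.congr (Filter.Eventually.of_forall fun t => ?_)
    simp only [Function.comp]
    congr 2
    ring
  have hsq : ∀ θ : ℝ, |θ| < π →
      Integrable (fun c : ℝ => (∫ t : ℝ, K ((x - c / 2 : ℝ) + (θ * Complex.I - t)) *
        K ((x - c / 2 : ℝ) - (θ * Complex.I - t)) * ((g (c / 2 + t) * g (c / 2 - t) : ℝ) : ℂ)).re) ∧
      ‖∫ y, G θ y‖ ^ 2 = ∫ c : ℝ, (∫ t : ℝ, K ((x - c / 2 : ℝ) + (θ * Complex.I - t)) *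
        K ((x - c / 2 : ℝ) - (θ * Complex.I - t)) * ((g (c / 2 + t) * g (c / 2 - t) : ℝ) : ℂ)).re := by
    intro θ hθ
    have hneg : |-θ| < π := by simpa using hθ
    have h1 : Integrable (fun z : ℝ × ℝ => G θ z.1 * G (-θ) z.2) (volume.prod volume) :=
      (hGi θ hθ).mul_prod (hGi _ hneg)
    have h2 := hshear.integrable_comp_of_integrable h1
    have h3 : ∀ c : ℝ, ∫ y, G θ y * G (-θ) (c - y) =
        ∫ t : ℝ, K ((x - c / 2 : ℝ) + (θ * Complex.I - t)) *
        K ((x - c / 2 : ℝ) - (θ * Complex.I - t)) * ((g (c / 2 + t) * g (c / 2 - t) : ℝ) : ℂ) := by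
      intro c
      rw [← integral_add_left_eq_self _ (c / 2)]
      refine integral_congr_ae (Filter.Eventually.of_forall fun t => ?_)
      simp only [hG]
      have e1 : c - (c / 2 + t) = c / 2 - t := by ring
      rw [e1]
      push_cast
      have e2 : (x : ℂ) + θ * Complex.I - (c / 2 + t) = x - c / 2 + (θ * Complex.I - t) := by ring
      have e3 : (x : ℂ) + -θ * Complex.I - (c / 2 - t) = x - c / 2 - (θ * Complex.I - t) := by ring
      rw [e2, e3]
      ring
    have h4 : Integrable (fun c : ℝ => ∫ y, G θ y * G (-θ) (c - y)) := h2.integral_prod_left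
    have h5 : ((‖∫ y, G θ y‖ ^ 2 : ℝ) : ℂ) = ∫ c : ℝ, ∫ y, G θ y * G (-θ) (c - y) := by
      have e1 : ∫ y, G (-θ) y = starRingEnd ℂ (∫ y, G θ y) := by
        rw [← integral_conj]
        refine integral_congr_ae (Filter.Eventually.of_forall fun y => ?_)
        simp only [hG, map_mul, Complex.conj_ofReal]
        rw [← hK.2.2.1 _ (by simpa using hθ)]
        congr 2
        simp [sub_eq_add_neg]
      rw [Complex.ofReal_pow, ← Complex.mul_conj', ← e1, ← integral_prod_mul]
      refine Eq.trans ?_ (integral_prod _ h2)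
      have e2 := integral_map hshear.measurable.aemeasurable
        (f := fun z : ℝ × ℝ => G θ z.1 * G (-θ) z.2) (by rw [hshear.map_eq]; exact h1.1)
      rw [hshear.map_eq] at e2
      exact e2
    simp only [← h3]
    refine ⟨h4.re, ?_⟩
    have := congrArg Complex.re h5
    rw [Complex.ofReal_re] at this
    rw [this]
    exact (integral_re h4).symm
  refine le_of_sq_le_sq ?_ (norm_nonneg _)
  rw [(hsq θ₁ h₁).2, (hsq θ₂ h₂).2]
  refine integral_mono_ae (hsq θ₁ h₁).1 (hsq θ₂ h₂).1 ?_
  filter_upwards [hgprod, hgH] with c hci ⟨H, hH, hHc⟩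
  exact hK.re_integral_mono hk (x - c / 2) (fun t => mul_nonneg (hg0 _) (hg0 _)) hci hH hHc h₁ h₂ hc

theorem norm_log_one_add_mul_exp_le {c : ℝ} (hc : 0 ≤ c) {ζ : ℂ} (hζ : |ζ.im| < π) :
    ‖Complex.log (1 + (c : ℂ) * Complex.exp ζ)‖ ≤
      Real.log (1 + c) + (|ζ.re| + |Real.log (Real.cos (ζ.im / 2))| + π) := by
  have hcp := cos_half_pos_of_abs_lt_pi hζ
  have hlow := le_norm_one_add_mul_exp c hζ
  have hex := Real.exp_pos ζ.re
  have hcx := mul_nonneg hc hex.le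
  have h1 : Real.log (Real.cos (ζ.im / 2)) ≤ Real.log ‖1 + (c : ℂ) * Complex.exp ζ‖ :=
    Real.log_le_log hcp (by nlinarith)
  have h2 : Real.log ‖1 + (c : ℂ) * Complex.exp ζ‖ ≤ Real.log (1 + c) + |ζ.re| := by
    rw [← Real.log_exp |ζ.re|, ← Real.log_mul (by positivity) (Real.exp_pos _).ne']
    refine Real.log_le_log (by nlinarith) ?_
    calc ‖1 + (c : ℂ) * Complex.exp ζ‖ ≤ ‖(1 : ℂ)‖ + ‖(c : ℂ) * Complex.exp ζ‖ := norm_add_le _ _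
      _ = 1 + c * Real.exp ζ.re := by
        rw [norm_mul, Complex.norm_exp, Complex.norm_real, Real.norm_of_nonneg hc, norm_one]
      _ ≤ (1 + c) * Real.exp |ζ.re| := by
        have h3 : 1 ≤ Real.exp |ζ.re| := Real.one_le_exp (abs_nonneg _)
        have h4 : Real.exp ζ.re ≤ Real.exp |ζ.re| := Real.exp_le_exp.2 (le_abs_self _)
        nlinarith [mul_le_mul_of_nonneg_left h4 hc]
  have h3 : |Complex.arg (1 + (c : ℂ) * Complex.exp ζ)| ≤ π := Complex.abs_arg_le_pi _
  have h4 := Complex.norm_le_abs_re_add_abs_im (Complex.log (1 + (c : ℂ) * Complex.exp ζ))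
  rw [Complex.log_re, Complex.log_im] at h4
  have h5 : 0 ≤ Real.log (1 + c) := Real.log_nonneg (by linarith)
  have h6 : |Real.log ‖1 + (c : ℂ) * Complex.exp ζ‖| ≤
      Real.log (1 + c) + (|ζ.re| + |Real.log (Real.cos (ζ.im / 2))|) := by
    have := neg_abs_le (Real.log (Real.cos (ζ.im / 2)))
    have := abs_nonneg (Real.log (Real.cos (ζ.im / 2)))
    have := abs_nonneg ζ.re
    rw [abs_le]
    constructor <;> linarith
  linarith

/-- The Laplace transform at `exp ζ` of the generalized gamma convolution with Thorin measure `μ`. -/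
noncomputable def thorinKernel (μ : Measure ℝ) (ζ : ℂ) : ℂ :=
  Complex.exp (-∫ t, Complex.log (1 + ((t⁻¹ : ℝ) : ℂ) * Complex.exp ζ) ∂μ)

theorem differentiableOn_thorinKernel {μ : Measure ℝ} [IsFiniteMeasure μ] (hμ : ∀ᵐ t ∂μ, 0 < t)
    (hμi : Integrable (fun t => Real.log (1 + t⁻¹)) μ) :
    DifferentiableOn ℂ (thorinKernel μ) {ζ | |ζ.im| < π} := by
  refine DifferentiableOn.cexp (DifferentiableOn.neg ?_)
  refine differentiableOn_integral_of_locally_dominated isOpen_strip (fun ζ _ => ?_) ?_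
    (C := fun ζ => 1 + (|ζ.re| + |Real.log (Real.cos (ζ.im / 2))| + π)) ?_
    (hμi.add (integrable_const 1)) ?_
  · exact (Measurable.aestronglyMeasurable (by fun_prop))
  · filter_upwards [hμ] with t ht
    exact DifferentiableOn.clog (by fun_prop) fun ζ hζ =>
      one_add_mul_exp_mem_slitPlane (inv_nonneg.2 ht.le) hζ
  · have h1 : ContinuousOn (fun ζ : ℂ => Real.log (Real.cos (ζ.im / 2))) {ζ | |ζ.im| < π} :=
      ContinuousOn.log (by fun_prop) fun ζ hζ => (cos_half_pos_of_abs_lt_pi hζ).ne'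
    fun_prop
  · filter_upwards [hμ] with t ht ζ hζ
    refine (norm_log_one_add_mul_exp_le (inv_nonneg.2 ht.le) hζ).trans ?_
    have h5 : 0 ≤ Real.log (1 + t⁻¹) := Real.log_nonneg (by have := inv_pos.2 ht; linarith)
    have h6 : 0 ≤ |ζ.re| + |Real.log (Real.cos (ζ.im / 2))| + π := by positivity
    simp only [Pi.add_apply]
    nlinarith [mul_nonneg h6 h5]

theorem sum_measureReal_preimage_range {α β : Type*} [MeasurableSpace α] (f : SimpleFunc α β)
    (μ : Measure α) [IsFiniteMeasure μ] : ∑ y ∈ f.range, μ.real (f ⁻¹' {y}) = μ.real Set.univ := by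
  simp only [Measure.real]
  rw [← ENNReal.toReal_sum (fun _ _ => measure_ne_top _ _), f.sum_range_measure_preimage_singleton]

theorem isCoshKernel_simpleFunc {k : ℝ} {μ : Measure ℝ} [IsFiniteMeasure μ]
    (σ : SimpleFunc ℝ ℝ) {r : ℝ} (hr : 0 ≤ r) (hrk : r * μ.real Set.univ < k) :
    ∃ K, IsCoshKernel k K ∧ ∀ ζ : ℂ, |ζ.im| < π →
      K ζ = Complex.exp (-(r * ∫ t, Complex.log (1 + ((|σ t| : ℝ) : ℂ) * Complex.exp ζ) ∂μ)) := by
  refine ⟨_, isCoshKernel_prod σ.range (c := fun i => |i|) (β := fun i => r * μ.real (σ ⁻¹' {i}))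
    (fun i => abs_nonneg i) (fun i => by positivity) ?_, fun ζ hζ => ?_⟩
  · rwa [← Finset.mul_sum, sum_measureReal_preimage_range]
  · have h1 := σ.map_integral (μ := μ) (fun i => Complex.log (1 + ((|i| : ℝ) : ℂ) * Complex.exp ζ))
      σ.integrable_of_isFiniteMeasure (by simp)
    rw [SimpleFunc.integral_eq_integral _ (SimpleFunc.integrable_of_isFiniteMeasure _)] at h1
    simp only [SimpleFunc.map_apply] at h1
    rw [h1, Finset.mul_sum, ← Finset.sum_neg_distrib, Complex.exp_sum]
    refine Finset.prod_congr rfl fun i _ => ?_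
    rw [Complex.cpow_def_of_ne_zero
      (Complex.slitPlane_ne_zero (one_add_mul_exp_mem_slitPlane (abs_nonneg i) hζ))]
    congr 1
    rw [Complex.real_smul]
    push_cast
    ring

theorem exists_tendsto_thorinKernel {k : ℝ} (hk : 0 < k) {μ : Measure ℝ} [IsFiniteMeasure μ]
    (hμk : μ.real Set.univ ≤ k) (hμ : ∀ᵐ t ∂μ, 0 < t)
    (hμi : Integrable (fun t => Real.log (1 + t⁻¹)) μ) :
    ∃ K : ℕ → ℂ → ℂ, (∀ n, IsCoshKernel k (K n)) ∧ ∀ ζ : ℂ, |ζ.im| < π →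
      Filter.Tendsto (fun n => K n ζ) Filter.atTop (nhds (thorinKernel μ ζ)) := by
  set σ : ℕ → SimpleFunc ℝ ℝ := SimpleFunc.approxOn (fun t : ℝ => t⁻¹) measurable_inv Set.univ 0
    (Set.mem_univ _) with hσ
  set r : ℕ → ℝ := fun n => 1 - 1 / ((n : ℝ) + 1) with hr
  have hr0 : ∀ n, 0 ≤ r n := fun n => by
    simp only [hr]
    rw [sub_nonneg, div_le_one (by positivity)]
    have := Nat.cast_nonneg (α := ℝ) n
    linarith
  have hr1 : ∀ n, r n < 1 := fun n => by
    simp only [hr]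
    have : (0:ℝ) < 1 / ((n : ℝ) + 1) := by positivity
    linarith
  have hrk : ∀ n, r n * μ.real Set.univ < k := fun n => by
    calc r n * μ.real Set.univ ≤ r n * k := by gcongr; exact hr0 n
      _ < k := by nlinarith [hr1 n]
  choose K hK hKv using fun n => isCoshKernel_simpleFunc (σ n) (hr0 n) (hrk n)
  refine ⟨K, hK, fun ζ hζ => ?_⟩
  have hlim : Filter.Tendsto (fun n => ∫ t, Complex.log (1 + ((|σ n t| : ℝ) : ℂ) * Complex.exp ζ) ∂μ)
      Filter.atTop (nhds (∫ t, Complex.log (1 + ((t⁻¹ : ℝ) : ℂ) * Complex.exp ζ) ∂μ)) := by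
    refine tendsto_integral_of_dominated_convergence
      (fun t => Real.log (1 + t⁻¹) + (Real.log 2 + (|ζ.re| + |Real.log (Real.cos (ζ.im / 2))| + π)))
      (fun n => Measurable.aestronglyMeasurable ?_) (hμi.add (integrable_const _)) (fun n => ?_) ?_
    · have := (σ n).measurable
      fun_prop
    · filter_upwards [hμ] with t ht
      refine (norm_log_one_add_mul_exp_le (abs_nonneg _) hζ).trans ?_
      have h1 : |σ n t| ≤ t⁻¹ + t⁻¹ := by
        have := SimpleFunc.norm_approxOn_zero_le (measurable_inv (G := ℝ)) (Set.mem_univ (0:ℝ)) t n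
        rwa [Real.norm_eq_abs, Real.norm_of_nonneg (inv_nonneg.2 ht.le)] at this
      have ht' := inv_pos.2 ht
      have h2 : Real.log (1 + |σ n t|) ≤ Real.log (1 + t⁻¹) + Real.log 2 := by
        rw [← Real.log_mul (by positivity) (by norm_num)]
        exact Real.log_le_log (by positivity) (by linarith)
      linarith
    · filter_upwards [hμ] with t ht
      have h1 : Filter.Tendsto (fun n => σ n t) Filter.atTop (nhds t⁻¹) :=
        SimpleFunc.tendsto_approxOn measurable_inv (Set.mem_univ _) (by simp)
      have h2 : Filter.Tendsto (fun n => |σ n t|) Filter.atTop (nhds t⁻¹) := by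
        have := h1.abs
        rwa [abs_of_pos (inv_pos.2 ht)] at this
      have h3 : ContinuousAt (fun c : ℝ => Complex.log (1 + (c : ℂ) * Complex.exp ζ)) t⁻¹ :=
        ContinuousAt.clog (by fun_prop) (one_add_mul_exp_mem_slitPlane (inv_nonneg.2 ht.le) hζ)
      exact h3.tendsto.comp h2
  have hr2 : Filter.Tendsto (fun n => (r n : ℂ)) Filter.atTop (nhds 1) := by
    have h1 : Filter.Tendsto r Filter.atTop (nhds (1 - 0)) :=
      tendsto_const_nhds.sub tendsto_one_div_add_atTop_nhds_zero_nat
    have h2 := (Complex.continuous_ofReal.tendsto _).comp h1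
    simpa [Function.comp_def] using h2
  have h4 := (Complex.continuous_exp.tendsto _).comp (hr2.mul hlim).neg
  rw [one_mul] at h4
  refine h4.congr fun n => ?_
  rw [hKv n ζ hζ]
  rfl

theorem norm_thorinKernel_le {k : ℝ} (hk : 0 < k) {μ : Measure ℝ} [IsFiniteMeasure μ]
    (hμk : μ.real Set.univ ≤ k) (hμ : ∀ᵐ t ∂μ, 0 < t)
    (hμi : Integrable (fun t => Real.log (1 + t⁻¹)) μ) {ζ : ℂ} (hζ : |ζ.im| < π) :
    ‖thorinKernel μ ζ‖ ≤ Real.cos (ζ.im / 2) ^ (-k) := by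
  obtain ⟨K, hK, hKl⟩ := exists_tendsto_thorinKernel hk hμk hμ hμi
  exact le_of_tendsto (hKl ζ hζ).norm (Filter.Eventually.of_forall fun n => (hK n).2.1 ζ hζ)

theorem norm_integral_thorinKernel_mono {k : ℝ} (hk : 0 < k) {μ : Measure ℝ} [IsFiniteMeasure μ]
    (hμk : μ.real Set.univ ≤ k) (hμ : ∀ᵐ t ∂μ, 0 < t)
    (hμi : Integrable (fun t => Real.log (1 + t⁻¹)) μ)
    {g : ℝ → ℝ} (hg0 : ∀ y, 0 ≤ g y) (hg : Integrable g) (hgH : IsLogHM k g) (x : ℝ)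
    {θ₁ θ₂ : ℝ} (h₁ : |θ₁| < π) (h₂ : |θ₂| < π) (hc : Real.cos θ₂ ≤ Real.cos θ₁) :
    ‖∫ y : ℝ, thorinKernel μ (x + θ₁ * Complex.I - y) * (g y : ℂ)‖ ≤
      ‖∫ y : ℝ, thorinKernel μ (x + θ₂ * Complex.I - y) * (g y : ℂ)‖ := by
  obtain ⟨K, hK, hKl⟩ := exists_tendsto_thorinKernel hk hμk hμ hμi
  have hlim : ∀ θ : ℝ, |θ| < π → Filter.Tendsto
      (fun n => ‖∫ y : ℝ, K n (x + θ * Complex.I - y) * (g y : ℂ)‖) Filter.atTop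
      (nhds ‖∫ y : ℝ, thorinKernel μ (x + θ * Complex.I - y) * (g y : ℂ)‖) := by
    intro θ hθ
    have hs : ∀ y : ℝ, |(x + θ * Complex.I - y : ℂ).im| < π := fun y => by simpa using hθ
    refine Filter.Tendsto.norm ?_
    refine tendsto_integral_of_dominated_convergence (fun y => Real.cos (θ / 2) ^ (-k) * g y)
      (fun n => ?_) (hg.const_mul _) (fun n => Filter.Eventually.of_forall fun y => ?_)
      (Filter.Eventually.of_forall fun y => (hKl _ (hs y)).mul_const _)
    · exact ((hK n).continuous_comp (by fun_prop) hs).aestronglyMeasurable.mul hg.ofReal.1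
    · rw [norm_mul, Complex.norm_real, Real.norm_of_nonneg (hg0 y)]
      refine mul_le_mul_of_nonneg_right ?_ (hg0 y)
      simpa using (hK n).2.1 _ (hs y)
  exact le_of_tendsto_of_tendsto (hlim θ₁ h₁) (hlim θ₂ h₂)
    (Filter.Eventually.of_forall fun n => (hK n).norm_integral_mono hk hg0 hg hgH x h₁ h₂ hc)

theorem im_neg_deriv_div_mul_nonneg {Φ : ℂ → ℂ} (hΦ : DifferentiableOn ℂ Φ {ζ | |ζ.im| < π})
    (hmono : ∀ x θ₁ θ₂ : ℝ, |θ₁| < π → |θ₂| < π → Real.cos θ₂ ≤ Real.cos θ₁ →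
      ‖Φ (x + θ₁ * Complex.I)‖ ≤ ‖Φ (x + θ₂ * Complex.I)‖)
    {ζ : ℂ} (hζ : |ζ.im| < π) (h0 : Φ ζ ≠ 0) : 0 ≤ (-deriv Φ ζ / Φ ζ).im * ζ.im := by
  obtain ⟨x, θ⟩ := ζ
  simp only at hζ ⊢
  have hζe : (⟨x, θ⟩ : ℂ) = x + θ * Complex.I := Complex.mk_eq_add_mul_I x θ
  rw [hζe] at h0 ⊢
  set N : ℝ → ℝ := fun τ => ‖Φ (x + τ * Complex.I)‖ ^ 2 with hN
  have hder : HasDerivAt N (2 * ((-deriv Φ (x + θ * Complex.I) / Φ (x + θ * Complex.I)).im *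
      ‖Φ (x + θ * Complex.I)‖ ^ 2)) θ := by
    have h1 : HasDerivAt Φ (deriv Φ (x + θ * Complex.I)) (x + θ * Complex.I) :=
      (hΦ.differentiableAt (isOpen_strip.mem_nhds (by simpa using hζ))).hasDerivAt
    have h2 : HasDerivAt (fun τ : ℝ => (x : ℂ) + τ * Complex.I) Complex.I θ := by
      simpa using ((Complex.ofRealCLM.hasDerivAt (x := θ)).mul_const Complex.I).const_add (x : ℂ)
    have h3 := (h1.comp θ h2).norm_sq
    refine h3.congr_deriv ?_
    rw [Complex.inner, ← Complex.normSq_eq_norm_sq]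
    simp only [Function.comp]
    set w := Φ (x + θ * Complex.I)
    set w' := deriv Φ (x + θ * Complex.I)
    have hq : w' = -(-w' / w * w) := by
      rw [div_mul_cancel₀ _ h0, neg_neg]
    set q := -w' / w
    rw [hq]
    simp [Complex.normSq_apply]
    ring
  have hpos : 0 < ‖Φ (x + θ * Complex.I)‖ ^ 2 := by positivity
  obtain ⟨hl, hr⟩ := abs_lt.1 hζ
  rcases lt_trichotomy θ 0 with hθ | hθ | hθ
  · have hanti : AntitoneOn N (Set.Ioo (-π) 0) := by
      intro a ha b hb hab
      have := hmono x b a (abs_lt.2 ⟨hb.1, hb.2.trans Real.pi_pos⟩) (abs_lt.2 ⟨ha.1, ha.2.trans Real.pi_pos⟩)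
        (by
          rw [← Real.cos_neg a, ← Real.cos_neg b]
          exact Real.cos_le_cos_of_nonneg_of_le_pi (by linarith [hb.2]) (by linarith [ha.1]) (by linarith))
      simp only [hN]
      gcongr
    have h1 := hanti.derivWithin_nonpos (x := θ)
    rw [derivWithin_of_isOpen isOpen_Ioo ⟨hl, hθ⟩, hder.deriv] at h1
    have h2 : (-deriv Φ (x + θ * Complex.I) / Φ (x + θ * Complex.I)).im ≤ 0 := by
      by_contra! h; nlinarith [mul_pos h hpos]
    exact mul_nonneg_of_nonpos_of_nonpos h2 hθ.le
  · simp [hθ]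
  · have hmn : MonotoneOn N (Set.Ioo 0 π) := by
      intro a ha b hb hab
      have := hmono x a b (abs_lt.2 ⟨by linarith [ha.1, Real.pi_pos], ha.2⟩)
        (abs_lt.2 ⟨by linarith [hb.1, Real.pi_pos], hb.2⟩)
        (Real.cos_le_cos_of_nonneg_of_le_pi ha.1.le hb.2.le hab)
      simp only [hN]
      gcongr
    have h1 := hmn.derivWithin_nonneg (x := θ)
    rw [derivWithin_of_isOpen isOpen_Ioo ⟨hθ, hr⟩, hder.deriv] at h1
    have h2 : 0 ≤ (-deriv Φ (x + θ * Complex.I) / Φ (x + θ * Complex.I)).im := by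
      by_contra! h; nlinarith [mul_pos (neg_pos.2 h) hpos]
    exact mul_nonneg h2 hθ.le

theorem ae_nonneg_of_measure_Iio {m : Measure ℝ} (hm : m (Set.Iio 0) = 0) : ∀ᵐ x ∂m, 0 ≤ x := by
  rw [ae_iff]
  convert hm using 2
  ext x
  simp

theorem isGGC_of_norm_mono {m : Measure ℝ} [IsProbabilityMeasure m] (hm : m (Set.Iio 0) = 0)
    {Φ : ℂ → ℂ} (hΦ : DifferentiableOn ℂ Φ {ζ | |ζ.im| < π})
    (hmono : ∀ x θ₁ θ₂ : ℝ, |θ₁| < π → |θ₂| < π → Real.cos θ₂ ≤ Real.cos θ₁ →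
      ‖Φ (x + θ₁ * Complex.I)‖ ≤ ‖Φ (x + θ₂ * Complex.I)‖)
    (hL : ∀ s : ℝ, 0 < s → Φ (Real.log s : ℝ) = ((∫ x, Real.exp (-s * x) ∂m : ℝ) : ℂ)) : IsGGC m := by
  have hae := ae_nonneg_of_measure_Iio hm
  set φ : ℝ → ℝ := fun s => ∫ x, Real.exp (-s * x) ∂m with hφ
  have hbd : ∀ s ∈ Set.Ici (0:ℝ), ∀ᵐ x ∂m, ‖Real.exp (-s * x)‖ ≤ 1 := by
    intro s hs
    filter_upwards [hae] with x hx
    rw [Real.norm_of_nonneg (Real.exp_pos _).le, Real.exp_le_one_iff]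
    have : 0 ≤ s * x := mul_nonneg hs hx
    linarith
  have h_int : ∀ s, 0 ≤ s → Integrable (fun x => Real.exp (-s * x)) m := fun s hs =>
    Integrable.mono' (integrable_const 1) (by fun_prop) (hbd s hs)
  have hφpos : ∀ s, 0 ≤ s → 0 < φ s := fun s hs => integral_exp_pos (h_int s hs)
  have hφ0 : φ 0 = 1 := by simp [hφ]
  have hφc : ContinuousOn φ (Set.Ici 0) :=
    continuousOn_of_dominated (fun s _ => by fun_prop) hbd (integrable_const 1)
      (Filter.Eventually.of_forall fun x => by fun_prop)
  have hφanti : AntitoneOn φ (Set.Ici 0) := by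
    intro s hs t ht hst
    refine integral_mono_ae (h_int t ht) (h_int s hs) ?_
    filter_upwards [hae] with x hx
    exact Real.exp_le_exp.2 (by nlinarith)
  have hΦ0 : ∀ ζ : ℂ, |ζ.im| < π → Φ ζ ≠ 0 := by
    intro ζ hζ h
    have h1 := hmono ζ.re 0 ζ.im (by simp [Real.pi_pos]) hζ (by simp [Real.cos_le_one])
    rw [Complex.re_add_im, h] at h1
    have h2 := hL (Real.exp ζ.re) (Real.exp_pos _)
    rw [Real.log_exp] at h2
    have h3 := hφpos (Real.exp ζ.re) (Real.exp_pos _).le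
    simp only [Complex.ofReal_zero, zero_mul, add_zero, norm_zero, norm_le_zero_iff] at h1
    rw [h1] at h2
    exact h3.ne (by exact_mod_cast h2)
  have hmem : ∀ s : ℝ, (Real.log s : ℂ) ∈ {ζ : ℂ | |ζ.im| < π} := fun s => by simp [Real.pi_pos]
  have hφd : ∀ s, 0 < s → HasDerivAt φ ((deriv Φ (Real.log s : ℝ)).re / s) s := by
    intro s hs
    have h1 : HasDerivAt Φ (deriv Φ (Real.log s : ℝ)) (Real.log s : ℝ) :=
      (hΦ.differentiableAt (isOpen_strip.mem_nhds (hmem s))).hasDerivAt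
    have h2 := h1.real_of_complex.comp s (Real.hasDerivAt_log hs.ne')
    refine (h2.congr_of_eventuallyEq ?_).congr_deriv (by rw [div_eq_mul_inv])
    filter_upwards [Ioi_mem_nhds hs] with t ht
    simp only [Function.comp]
    rw [hL t ht, Complex.ofReal_re]
  have hBre : ∀ s, 0 < s → (-deriv Φ (Real.log s : ℝ) / Φ (Real.log s : ℝ)).re =
      -(deriv Φ (Real.log s : ℝ)).re / φ s := by
    intro s hs
    rw [hL s hs, Complex.div_ofReal_re, Complex.neg_re]
  refine isGGC_of_strip hm (B := fun ζ => -deriv Φ ζ / Φ ζ) (L := fun s => -Real.log (φ s))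
    ((hΦ.deriv isOpen_strip).neg.div hΦ hΦ0)
    (fun ζ hζ => im_neg_deriv_div_mul_nonneg hΦ hmono hζ (hΦ0 ζ hζ)) ?_ (by simp [hφ0])
    (hφc.log fun s hs => (hφpos s hs).ne').neg (fun s hs => ?_) (fun s hs => ?_) (fun s hs => ?_)
  · intro s hs
    rw [hBre s hs]
    refine div_nonneg ?_ (hφpos s hs.le).le
    have h1 := (hφanti.mono Set.Ioi_subset_Ici_self).derivWithin_nonpos (x := s)
    rw [derivWithin_of_isOpen isOpen_Ioi hs, (hφd s hs).deriv] at h1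
    by_contra! h
    have := div_pos (by linarith : 0 < (deriv Φ (Real.log s : ℝ)).re) hs
    linarith
  · have h1 := hφanti (Set.mem_Ici.2 le_rfl) hs hs
    rw [hφ0] at h1
    have := Real.log_nonpos (hφpos s hs).le h1
    linarith
  · refine ((hφd s hs).log (hφpos s hs.le).ne').neg.congr_deriv ?_
    rw [hBre s hs]
    have := (hφpos s hs.le).ne'
    field_simp
  · rw [neg_neg, Real.exp_log (hφpos s hs)]

theorem isGGC_of_thorinKernel {k : ℝ} (hk : 0 < k) {μ : Measure ℝ} [IsFiniteMeasure μ]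
    (hμk : μ.real Set.univ ≤ k) (hμ : ∀ᵐ t ∂μ, 0 < t)
    (hμi : Integrable (fun t => Real.log (1 + t⁻¹)) μ)
    {g : ℝ → ℝ} (hg0 : ∀ y, 0 ≤ g y) (hg : Integrable g) (hgH : IsLogHM k g)
    {m : Measure ℝ} [IsProbabilityMeasure m] (hm : m (Set.Iio 0) = 0)
    (hL : ∀ s : ℝ, 0 < s → ∫ y : ℝ, thorinKernel μ (((Real.log s : ℝ) : ℂ) - y) * (g y : ℂ) =
      ((∫ x, Real.exp (-s * x) ∂m : ℝ) : ℂ)) : IsGGC m := by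
  have hdiff := differentiableOn_thorinKernel hμ hμi
  refine isGGC_of_norm_mono hm (Φ := fun ζ => ∫ y : ℝ, thorinKernel μ (ζ - y) * (g y : ℂ)) ?_
    (fun x θ₁ θ₂ h₁ h₂ hc => norm_integral_thorinKernel_mono hk hμk hμ hμi hg0 hg hgH x h₁ h₂ hc) hL
  have hsub : ∀ (y : ℝ) (ζ : ℂ), |ζ.im| < π → |(ζ - y).im| < π := fun y ζ hζ => by simpa using hζ
  refine differentiableOn_integral_of_locally_dominated isOpen_strip (fun ζ hζ => ?_)
    (Filter.Eventually.of_forall fun y => ?_) (C := fun ζ => Real.cos (ζ.im / 2) ^ (-k)) ?_ hg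
    (Filter.Eventually.of_forall fun y ζ hζ => ?_)
  · refine Continuous.aestronglyMeasurable ?_ |>.mul hg.ofReal.1
    exact hdiff.continuousOn.comp_continuous (by fun_prop) fun y => hsub y ζ hζ
  · exact (hdiff.comp (by fun_prop) fun ζ hζ => hsub y ζ hζ).mul_const _
  · exact ContinuousOn.rpow_const (by fun_prop) fun ζ hζ =>
      Or.inl (cos_half_pos_of_abs_lt_pi hζ).ne'
  · rw [norm_mul, Complex.norm_real, Real.norm_of_nonneg (hg0 y)]
    refine mul_le_mul_of_nonneg_right ?_ (hg0 y)
    simpa using norm_thorinKernel_le hk hμk hμ hμi (hsub y ζ hζ)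

theorem ae_comp_sub_left {p : ℝ → Prop} (h : ∀ᵐ x, p x) (c : ℝ) : ∀ᵐ x, p (c - x) :=
  (Measure.measurePreserving_sub_left volume c).quasiMeasurePreserving.ae h

theorem ae_ae_of_forall_ae_sub {Q : ℝ × ℝ → Prop} (hQ : MeasurableSet {p | Q p})
    (h : ∀ c : ℝ, ∀ᵐ x : ℝ, Q (x, c - x)) : ∀ᵐ x : ℝ, ∀ᵐ y : ℝ, Q (x, y) := by
  have hshear := measurePreserving_prod_sub_swap (volume : Measure ℝ) (volume : Measure ℝ)
  have h1 : ∀ᵐ z : ℝ × ℝ ∂(volume.prod volume), Q (z.2, z.1 - z.2) := by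
    have hQ' : MeasurableSet {z : ℝ × ℝ | Q (z.2, z.1 - z.2)} := hshear.measurable hQ
    exact (Measure.ae_prod_iff_ae_ae hQ').2 (Filter.Eventually.of_forall h)
  have h2 : ∀ᵐ z : ℝ × ℝ ∂(volume.prod volume), Q z := by
    rw [← hshear.map_eq, ae_map_iff hshear.measurable.aemeasurable hQ]
    exact h1
  exact Measure.ae_ae_of_ae_prod h2

theorem exists_measurable_mul_reflection {F : ℝ → ℝ≥0∞} (hF : ∀ x, F x ≠ ⊤)
    (hm : ∀ c, Measurable fun x => F x * F (c - x)) (hpos : ∫⁻ x, F x ≠ 0) :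
    ∃ g : ℝ → ℝ≥0∞, Measurable g ∧ g ≤ F ∧ volume.withDensity F = volume.withDensity g ∧
      ∃ κ : ℝ≥0∞, κ ≠ ⊤ ∧ ∀ c, ∀ᵐ x, g x * g (c - x) = κ * (F x * F (c - x)) := by
  obtain ⟨g, hg, hgF, hgi⟩ := exists_measurable_le_forall_setLIntegral_eq volume F
  obtain ⟨g', hg', hgF', hgi'⟩ := exists_measurable_le_forall_setLIntegral_eq volume (fun x => (F x)⁻¹)
  have hmax : ∀ {f e m : ℝ → ℝ≥0∞}, Measurable e → Measurable m →
      (∀ s, ∫⁻ a in s, f a = ∫⁻ a in s, e a) → (∀ x, m x ≤ f x) → ∀ᵐ x, m x ≤ e x := by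
    intro f e m he hm hi hle
    refine ae_le_of_forall_setLIntegral_le_of_sigmaFinite hm fun s _ _ => ?_
    rw [← hi s]
    exact lintegral_mono hle
  have hP : ∀ c, ∀ᵐ x, F x ≠ 0 → F (c - x) ≠ 0 →
      g x = F x * F (c - x) * g' (c - x) ∧ g (c - x) = F x * F (c - x) * g' x := by
    intro c
    have h1 : ∀ᵐ x, F x * F (c - x) * g' (c - x) ≤ g x := by
      refine hmax hg ((hm c).mul (hg'.comp (measurable_const.sub measurable_id))) hgi fun x => ?_
      calc F x * F (c - x) * g' (c - x) ≤ F x * F (c - x) * (F (c - x))⁻¹ := by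
            gcongr; exact hgF' _
        _ = F x * (F (c - x) * (F (c - x))⁻¹) := mul_assoc _ _ _
        _ ≤ F x * 1 := by gcongr; exact ENNReal.mul_inv_le_one _
        _ = F x := mul_one _
    have h2 : ∀ᵐ x, g (c - x) * (F x * F (c - x))⁻¹ ≤ g' x := by
      refine hmax hg' ((hg.comp (measurable_const.sub measurable_id)).mul (hm c).inv) hgi' fun x => ?_
      rcases eq_or_ne (F x) 0 with h0 | h0
      · simp [h0]
      rcases eq_or_ne (F (c - x)) 0 with h3 | h3
      · have : g (c - x) = 0 := le_antisymm (h3 ▸ hgF (c - x)) bot_le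
        simp [this]
      calc g (c - x) * (F x * F (c - x))⁻¹ ≤ F (c - x) * (F x * F (c - x))⁻¹ := by
            gcongr; exact hgF _
        _ = F (c - x) * (F (c - x))⁻¹ * (F x)⁻¹ := by
            rw [ENNReal.mul_inv (Or.inl h0) (Or.inl (hF x))]; ring
        _ = (F x)⁻¹ := by rw [ENNReal.mul_inv_cancel h3 (hF _), one_mul]
    filter_upwards [h1, h2, ae_comp_sub_left h1 c, ae_comp_sub_left h2 c] with x a1 a2 a3 a4 n1 n2
    simp only [sub_sub_cancel, mul_comm (F (c - x)) (F x)] at a3 a4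
    have hh0 : F x * F (c - x) ≠ 0 := mul_ne_zero n1 n2
    have hh1 : F x * F (c - x) ≠ ⊤ := ENNReal.mul_ne_top (hF _) (hF _)
    rw [← div_eq_mul_inv, ENNReal.div_le_iff hh0 hh1, mul_comm] at a2 a4
    exact ⟨le_antisymm a4 a1, le_antisymm a2 a3⟩
  have hne : ∀ x, g x ≠ 0 → F x ≠ 0 := fun x hx h => hx (le_antisymm (h ▸ hgF x) bot_le)
  have hG : ∃ᵐ x, g x ≠ 0 := by
    have h1 : ∫⁻ x, g x ≠ 0 := by
      have := hgi Set.univ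
      simp only [Measure.restrict_univ] at this
      rwa [← this]
    intro h2
    refine h1 ((lintegral_eq_zero_iff hg).2 ?_)
    filter_upwards [h2] with x hx
    simpa using hx
  have hQ := ae_ae_of_forall_ae_sub
    (Q := fun p => g p.1 ≠ 0 → g p.2 ≠ 0 → g' p.1 ≠ 0 ∧ g p.1 * g' p.1 = g p.2 * g' p.2) (by
      have e1 : Measurable fun p : ℝ × ℝ => g p.1 := by fun_prop
      have e2 : Measurable fun p : ℝ × ℝ => g p.2 := by fun_prop
      have e3 : Measurable fun p : ℝ × ℝ => g' p.1 := by fun_prop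
      have e4 : Measurable fun p : ℝ × ℝ => g' p.2 := by fun_prop
      exact ((e1 (measurableSet_singleton 0)).compl).imp (((e2 (measurableSet_singleton 0)).compl).imp
        (((e3 (measurableSet_singleton 0)).compl).inter
          (measurableSet_eq_fun (e1.mul e3) (e2.mul e4))))) (fun c => by
      filter_upwards [hP c] with x hx h1 h2
      obtain ⟨h3, h4⟩ := hx (hne _ h1) (hne _ h2)
      refine ⟨fun h => h2 (by rw [h4, h, mul_zero]), ?_⟩
      calc g x * g' x = F x * F (c - x) * g' (c - x) * g' x := by rw [← h3]
        _ = F x * F (c - x) * g' x * g' (c - x) := by ring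
        _ = g (c - x) * g' (c - x) := by rw [← h4])
  obtain ⟨x₀, hx₀, hκ⟩ := (hG.and_eventually hQ).exists
  simp only at hκ
  have hx₀' : g' x₀ ≠ 0 := by
    obtain ⟨y, hy, hy2⟩ := (hG.and_eventually hκ).exists
    exact (hy2 hx₀ hy).1
  set κ := g x₀ * g' x₀ with hκdef
  have hκ0 : κ ≠ 0 := mul_ne_zero hx₀ hx₀'
  have hκtop : κ ≠ ⊤ := ENNReal.mul_ne_top (ne_top_of_le_ne_top (hF _) (hgF _))
    (ne_top_of_le_ne_top (ENNReal.inv_ne_top.2 (hne _ hx₀)) (hgF' _))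
  have hκ' : ∀ᵐ y, g y ≠ 0 → g y * g' y = κ := by
    filter_upwards [hκ] with y hy h
    exact (hy hx₀ h).2.symm
  set D : Set ℝ := {x | F x ≠ 0 ∧ g x = 0} with hD
  have hDc : ∀ c, volume (toMeasurable volume D ∩ {x | g (c - x) ≠ 0}) = 0 := by
    intro c
    have hmc : MeasurableSet {x | g (c - x) ≠ 0} :=
      ((hg.comp (measurable_const.sub measurable_id)) (measurableSet_singleton 0)).compl
    rw [Measure.measure_toMeasurable_inter_of_sFinite hmc]
    have h1 : ∀ᵐ x, ¬ (x ∈ D ∩ {x | g (c - x) ≠ 0}) := by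
      filter_upwards [hP c, ae_comp_sub_left hκ' c] with x hx hx2 ⟨⟨h3, h4⟩, h5⟩
      obtain ⟨h6, h7⟩ := hx h3 (hne _ h5)
      rw [h4] at h6
      have h8 : g' (c - x) = 0 :=
        (mul_eq_zero.1 h6.symm).resolve_left (mul_ne_zero h3 (hne _ h5))
      exact hκ0 (by rw [← hx2 h5, h8, mul_zero])
    exact measure_eq_zero_iff_ae_notMem.2 h1
  have hDm := measurableSet_toMeasurable volume D
  have hR := ae_ae_of_forall_ae_sub (Q := fun p => g p.1 ≠ 0 → p.2 ∉ toMeasurable volume D) (by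
      have e1 : Measurable fun p : ℝ × ℝ => g p.1 := by fun_prop
      exact ((e1 (measurableSet_singleton 0)).compl).imp (measurable_snd hDm.compl)) (fun c => by
      have h1 : ∀ᵐ x, ¬ (x ∈ toMeasurable volume D ∩ {x | g (c - x) ≠ 0}) :=
        measure_eq_zero_iff_ae_notMem.1 (hDc c)
      filter_upwards [ae_comp_sub_left h1 c] with x hx h2 h3
      exact hx ⟨h3, by simpa using h2⟩)
  have hD0 : ∀ᵐ x, F x ≠ 0 → g x ≠ 0 := by
    obtain ⟨y, hy, hy2⟩ := (hG.and_eventually hR).exists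
    filter_upwards [hy2] with x hx h1 h2
    exact hx hy (subset_toMeasurable _ _ ⟨h1, h2⟩)
  refine ⟨g, hg, hgF, ?_, κ, hκtop, fun c => ?_⟩
  · refine Measure.ext fun s hs => ?_
    rw [withDensity_apply _ hs, withDensity_apply _ hs, hgi]
  · filter_upwards [hP c, hκ', hD0, ae_comp_sub_left hD0 c] with x h1 h2 h3 h4
    rcases eq_or_ne (F x) 0 with h5 | h5
    · have : g x = 0 := le_antisymm (h5 ▸ hgF x) bot_le
      simp [this, h5]
    rcases eq_or_ne (F (c - x)) 0 with h6 | h6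
    · have : g (c - x) = 0 := le_antisymm (h6 ▸ hgF (c - x)) bot_le
      simp [this, h6]
    obtain ⟨h7, h8⟩ := h1 h5 h6
    rw [← h2 (h3 h5)]
    calc g x * g (c - x) = g x * (F x * F (c - x) * g' x) := by rw [← h8]
      _ = g x * g' x * (F x * F (c - x)) := by ring

theorem measurable_lintegral_cosh {k : ℝ} {H : Measure ℝ}
    (hH : ∫⁻ l in Set.Ioi (2:ℝ), ENNReal.ofReal ((l - 2) ^ (k - 1)) ∂H ≠ ⊤) :
    Measurable fun t : ℝ => ∫⁻ l in Set.Ioi (2 * Real.cosh t),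
      ENNReal.ofReal ((l - 2 * Real.cosh t) ^ (k - 1)) ∂H := by
  have hsf : SFinite (H.restrict (Set.Ioi 2)) := by
    refine sFinite_restrict_of_lintegral_ne_top (by fun_prop) measurableSet_Ioi (fun x hx => ?_) (by simp) hH
    simp only [ne_eq, ENNReal.ofReal_eq_zero, not_le]
    exact Real.rpow_pos_of_pos (sub_pos.2 hx) _
  have hgset : MeasurableSet {q : ℝ × ℝ | 2 * Real.cosh q.1 < q.2} :=
    measurableSet_lt (by fun_prop) measurable_snd
  have hgm : Measurable (Set.indicator {q : ℝ × ℝ | 2 * Real.cosh q.1 < q.2}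
      (fun q => ENNReal.ofReal ((q.2 - 2 * Real.cosh q.1) ^ (k - 1)))) :=
    Measurable.indicator (by fun_prop) hgset
  convert hgm.lintegral_prod_right' (ν := H.restrict (Set.Ioi 2)) using 2 with t
  have h1 : (fun l => Set.indicator {q : ℝ × ℝ | 2 * Real.cosh q.1 < q.2}
      (fun q => ENNReal.ofReal ((q.2 - 2 * Real.cosh q.1) ^ (k - 1))) (t, l)) =
      Set.indicator (Set.Ioi (2 * Real.cosh t))
        (fun l => ENNReal.ofReal ((l - 2 * Real.cosh t) ^ (k - 1))) := by
    ext l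
    simp [Set.indicator]
  rw [h1, lintegral_indicator measurableSet_Ioi, Measure.restrict_restrict measurableSet_Ioi]
  congr 2
  ext l
  simp only [Set.mem_Ioi, Set.mem_inter_iff]
  have := Real.one_le_cosh t
  exact ⟨fun h => ⟨h, by linarith⟩, fun h => h.1⟩

theorem map_log_withDensity {F : ℝ → ℝ≥0∞} :
    ((volume.restrict (Set.Ioi (0:ℝ))).withDensity F).map Real.log =
      volume.withDensity fun y => ENNReal.ofReal (Real.exp y) * F (Real.exp y) := by
  refine Measure.ext fun s hs => ?_
  rw [Measure.map_apply Real.measurable_log hs, withDensity_apply _ (Real.measurable_log hs),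
    withDensity_apply _ hs, Measure.restrict_restrict (Real.measurable_log hs)]
  have h1 : Real.log ⁻¹' s ∩ Set.Ioi 0 = Real.exp '' s := by
    ext x
    constructor
    · rintro ⟨h2, h3⟩
      exact ⟨Real.log x, h2, Real.exp_log h3⟩
    · rintro ⟨y, hy, rfl⟩
      exact ⟨by simpa using hy, Real.exp_pos y⟩
  rw [h1, lintegral_image_eq_lintegral_abs_deriv_mul hs
    (fun x _ => (Real.hasDerivAt_exp x).hasDerivWithinAt) Real.exp_injective.injOn]
  simp [abs_of_pos (Real.exp_pos _)]

theorem IsHMDensity.exists_isLogHM {k : ℝ} {f : ℝ → ℝ} (hf : IsHMDensity k f) :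
    ∃ g : ℝ → ℝ, Measurable g ∧ (∀ y, 0 ≤ g y) ∧ Integrable g ∧ IsLogHM k g ∧
      ((volume.restrict (Set.Ioi (0:ℝ))).withDensity fun x => ENNReal.ofReal (f x)).map Real.log =
        volume.withDensity fun y => ENNReal.ofReal (g y) := by
  obtain ⟨hf0, hf1, hH⟩ := hf
  rw [map_log_withDensity]
  set F : ℝ → ℝ≥0∞ := fun y => ENNReal.ofReal (Real.exp y) * ENNReal.ofReal (f (Real.exp y)) with hF
  have hFtop : ∀ y, F y ≠ ⊤ := fun y => ENNReal.mul_ne_top ENNReal.ofReal_ne_top ENNReal.ofReal_ne_top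
  have hFint : ∫⁻ y, F y = 1 := by
    have h1 := congrArg (fun m : Measure ℝ => m Set.univ)
      (map_log_withDensity (F := fun x => ENNReal.ofReal (f x)))
    simp only [Measure.map_apply Real.measurable_log MeasurableSet.univ, Set.preimage_univ,
      withDensity_apply _ MeasurableSet.univ, Measure.restrict_univ, hf1] at h1
    exact h1.symm
  have hkey : ∀ c : ℝ, ∃ H : Measure ℝ,
      ∫⁻ l in Set.Ioi (2:ℝ), ENNReal.ofReal ((l - 2) ^ (k - 1)) ∂H ≠ ⊤ ∧
      ∀ t, F (c / 2 + t) * F (c / 2 - t) = ∫⁻ l in Set.Ioi (2 * Real.cosh t),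
        ENNReal.ofReal ((l - 2 * Real.cosh t) ^ (k - 1)) ∂H := by
    intro c
    obtain ⟨H, hH⟩ := hH (Real.exp (c / 2)) (Real.exp_pos _)
    have h1 : ∀ t, F (c / 2 + t) * F (c / 2 - t) = ∫⁻ l in Set.Ioi (2 * Real.cosh t),
        ENNReal.ofReal ((l - 2 * Real.cosh t) ^ (k - 1)) ∂(ENNReal.ofReal (Real.exp c) • H) := by
      intro t
      have h2 := hH (Real.exp t) (Real.exp_pos t)
      have h3 : Real.exp t + (Real.exp t)⁻¹ = 2 * Real.cosh t := by
        rw [Real.cosh_eq, Real.exp_neg]; ring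
      rw [h3, ← Real.exp_add, ← Real.exp_sub] at h2
      rw [Measure.restrict_smul, lintegral_smul_measure, ← h2, ENNReal.ofReal_mul (hf0 _), smul_eq_mul]
      have h4 : ENNReal.ofReal (Real.exp c) =
          ENNReal.ofReal (Real.exp (c / 2 + t)) * ENNReal.ofReal (Real.exp (c / 2 - t)) := by
        rw [← ENNReal.ofReal_mul (Real.exp_pos _).le, ← Real.exp_add]
        congr 2
        ring
      rw [h4]
      simp only [hF]
      ring
    refine ⟨_, ?_, h1⟩
    have h2 := h1 0
    simp only [Real.cosh_zero, mul_one] at h2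
    rw [← h2]
    exact ENNReal.mul_ne_top (hFtop _) (hFtop _)
  obtain ⟨g, hg, hgF, hFg, κ, hκ, hgκ⟩ := exists_measurable_mul_reflection hFtop (fun c => by
    obtain ⟨H, h1, h2⟩ := hkey c
    have h3 := (measurable_lintegral_cosh h1).comp (measurable_id.sub_const (c / 2))
    convert h3 using 1
    ext x
    simp only [Function.comp, id, ← h2]
    congr 2 <;> ring) (by rw [hFint]; exact one_ne_zero)
  have hgtop : ∀ y, g y ≠ ⊤ := fun y => ne_top_of_le_ne_top (hFtop y) (hgF y)
  refine ⟨fun y => (g y).toReal, hg.ennreal_toReal, fun y => ENNReal.toReal_nonneg, ?_, ?_, ?_⟩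
  · refine integrable_toReal_of_lintegral_ne_top hg.aemeasurable ?_
    refine ne_top_of_le_ne_top ENNReal.one_ne_top ?_
    rw [← hFint]
    exact lintegral_mono hgF
  · refine Filter.Eventually.of_forall fun c => ?_
    obtain ⟨H, h1, h2⟩ := hkey c
    refine ⟨κ • H, ?_, ?_⟩
    · rw [Measure.restrict_smul, lintegral_smul_measure]
      exact ENNReal.mul_ne_top hκ h1
    · filter_upwards [(measurePreserving_add_left volume (c / 2)).quasiMeasurePreserving.ae (hgκ c)] with t ht
      rw [Measure.restrict_smul, lintegral_smul_measure, ← h2, smul_eq_mul,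
        ENNReal.ofReal_mul ENNReal.toReal_nonneg, ENNReal.ofReal_toReal (hgtop _),
        ENNReal.ofReal_toReal (hgtop _)]
      have h5 : c - (c / 2 + t) = c / 2 - t := by ring
      rwa [h5] at ht
  · rw [hFg]
    simp [ENNReal.ofReal_toReal (hgtop _)]

theorem thorinKernel_ofReal {μ : Measure ℝ} (hμ : ∀ᵐ t ∂μ, 0 < t) (x : ℝ) :
    thorinKernel μ (x : ℂ) = ((Real.exp (∫ t, Real.log (t / (t + Real.exp x)) ∂μ) : ℝ) : ℂ) := by
  rw [thorinKernel, Complex.ofReal_exp, ← integral_neg, ← integral_complex_ofReal]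
  congr 1
  refine integral_congr_ae ?_
  filter_upwards [hμ] with t ht
  have he := Real.exp_pos x
  have h1 : 1 + ((t⁻¹ : ℝ) : ℂ) * Complex.exp (x : ℂ) = ((1 + t⁻¹ * Real.exp x : ℝ) : ℂ) := by
    push_cast; rfl
  rw [h1, ← Complex.ofReal_log (by positivity), ← Complex.ofReal_neg, ← Real.log_inv]
  congr 2
  field_simp

theorem integrable_log_one_add_inv {U : Measure ℝ} [IsFiniteMeasure (U.restrict (Set.Ioi 0))]
    (hU : (∫⁻ t in Set.Ioc (0:ℝ) 1, ENNReal.ofReal |Real.log t| ∂U) < ⊤) :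
    IntegrableOn (fun t => Real.log (1 + t⁻¹)) (Set.Ioi 0) U := by
  have hfin : ∀ s ⊆ Set.Ioi (0:ℝ), U s ≠ ⊤ := fun s hs => by
    have := measure_ne_top (U.restrict (Set.Ioi 0)) Set.univ
    rw [Measure.restrict_apply_univ] at this
    exact ne_top_of_le_ne_top this (measure_mono hs)
  rw [← Set.Ioc_union_Ioi_eq_Ioi (zero_le_one' ℝ)]
  refine IntegrableOn.union ?_ ?_
  · have h1 : IntegrableOn (fun t => Real.log 2 + |Real.log t|) (Set.Ioc 0 1) U := by
      refine Integrable.add ((integrableOn_const_iff).2 (Or.inr (hfin _ Set.Ioc_subset_Ioi_self).lt_top)) ?_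
      refine ⟨(by fun_prop : Measurable fun t : ℝ => |Real.log t|).aestronglyMeasurable, ?_⟩
      rw [hasFiniteIntegral_iff_norm]
      simpa using hU
    refine Integrable.mono' h1 (by fun_prop : Measurable fun t : ℝ => Real.log (1 + t⁻¹)).aestronglyMeasurable ?_
    filter_upwards [ae_restrict_mem measurableSet_Ioc] with t ht
    have ht0 : 0 < t := ht.1
    have h2 : 1 + t⁻¹ ≤ 2 * t⁻¹ := by
      have := (one_le_inv₀ ht0).2 ht.2
      linarith
    have h3 : 0 < t⁻¹ := inv_pos.2 ht0
    rw [Real.norm_of_nonneg (Real.log_nonneg (by linarith))]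
    calc Real.log (1 + t⁻¹) ≤ Real.log (2 * t⁻¹) := Real.log_le_log (by linarith) h2
      _ = Real.log 2 + -Real.log t := by rw [Real.log_mul two_ne_zero h3.ne', Real.log_inv]
      _ ≤ Real.log 2 + |Real.log t| := by gcongr; exact neg_le_abs _
  · refine Integrable.mono' (g := fun _ => Real.log 2) ((integrableOn_const_iff).2
      (Or.inr (hfin _ (Set.Ioi_subset_Ioi zero_le_one)).lt_top))
      (by fun_prop : Measurable fun t : ℝ => Real.log (1 + t⁻¹)).aestronglyMeasurable ?_
    filter_upwards [ae_restrict_mem measurableSet_Ioi] with t ht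
    have ht1 : 1 < t := ht
    have h3 : 0 < t⁻¹ := inv_pos.2 (by linarith)
    have h4 : t⁻¹ ≤ 1 := inv_le_one_of_one_le₀ ht1.le
    rw [Real.norm_of_nonneg (Real.log_nonneg (by linarith))]
    exact Real.log_le_log (by linarith) (by linarith)

theorem integral_exp_div_eq {Ω : Type*} [MeasurableSpace Ω] {P : Measure Ω} [IsProbabilityMeasure P]
    {Z X : Ω → ℝ} (hZ : Measurable Z) (hX : Measurable X) (hZ0 : ∀ᵐ z ∂P.map Z, 0 ≤ z)
    (hXpos : ∀ᵐ ω ∂P, 0 < X ω) (hindep : IndepFun Z X P) {g : ℝ → ℝ} (hg : Measurable g)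
    (hg0 : ∀ y, 0 ≤ g y)
    (hgX : P.map (fun ω => Real.log (X ω)) = volume.withDensity fun y => ENNReal.ofReal (g y))
    {s : ℝ} (hs : 0 ≤ s) :
    ∫ x, Real.exp (-s * x) ∂(P.map fun ω => Z ω / X ω) =
      ∫ y, (∫ z, Real.exp (-(s * Real.exp (-y)) * z) ∂P.map Z) * g y := by
  set Y : Ω → ℝ := fun ω => Real.log (X ω) with hYdef
  have hY : Measurable Y := Real.measurable_log.comp hX
  have hprod := (indepFun_iff_map_prod_eq_prod_map_map hZ.aemeasurable hY.aemeasurable).1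
    (hindep.comp measurable_id Real.measurable_log)
  have : IsProbabilityMeasure (P.map Z) := Measure.isProbabilityMeasure_map hZ.aemeasurable
  have : IsProbabilityMeasure (P.map Y) := Measure.isProbabilityMeasure_map hY.aemeasurable
  have hm : Measurable fun q : ℝ × ℝ => Real.exp (-(s * Real.exp (-q.2)) * q.1) := by fun_prop
  have hq : Measurable fun ω => Z ω / X ω := hZ.div hX
  rw [integral_map hq.aemeasurable (by fun_prop)]
  calc ∫ ω, Real.exp (-s * (Z ω / X ω)) ∂P
      = ∫ ω, Real.exp (-(s * Real.exp (-Y ω)) * Z ω) ∂P := by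
        refine integral_congr_ae ?_
        filter_upwards [hXpos] with ω hω
        simp only [hYdef]
        rw [Real.exp_neg, Real.exp_log hω]
        congr 1
        ring
    _ = ∫ q, Real.exp (-(s * Real.exp (-q.2)) * q.1) ∂(P.map Z).prod (P.map Y) := by
        rw [← hprod, integral_map (hZ.prodMk hY).aemeasurable hm.aestronglyMeasurable]
    _ = ∫ y, ∫ z, Real.exp (-(s * Real.exp (-y)) * z) ∂P.map Z ∂P.map Y := by
        refine integral_prod_symm _ (Integrable.of_bound hm.aestronglyMeasurable 1 ?_)
        filter_upwards [Measure.quasiMeasurePreserving_fst.ae hZ0] with q hq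
        rw [Real.norm_of_nonneg (Real.exp_pos _).le]
        refine Real.exp_le_one_iff.2 ?_
        have := Real.exp_pos (-q.2)
        have : 0 ≤ s * Real.exp (-q.2) * q.1 := by positivity
        linarith
    _ = ∫ y, (∫ z, Real.exp (-(s * Real.exp (-y)) * z) ∂P.map Z) * g y := by
        rw [hgX, integral_withDensity_eq_integral_toReal_smul (by fun_prop) (by simp)]
        refine integral_congr_ae (Filter.Eventually.of_forall fun y => ?_)
        simp [ENNReal.toReal_ofReal (hg0 y), mul_comm]

theorem GGCk_div_HM_is_GGC
    {Ω : Type*} [MeasurableSpace Ω] (P : Measure Ω) [IsProbabilityMeasure P]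
    (k : ℝ) (hk : 0 < k)
    (Z X : Ω → ℝ) (hZ : Measurable Z) (hX : Measurable X)
    (hZd : IsGGCk k (Measure.map Z P))
    (f : ℝ → ℝ) (hf : IsHMDensity k f) (hXd : HasDensityOn P X f)
    (hXpos : ∀ᵐ ω ∂P, 0 < X ω)
    (hindep : IndepFun Z X P) :
    IsGGC (Measure.map (fun ω => Z ω / X ω) P) := by
  obtain ⟨g, hg, hg0, hgi, hgH, hgX⟩ := hf.exists_isLogHM
  rw [← (hXd : P.map X = _), Measure.map_map Real.measurable_log hX] at hgX
  obtain ⟨-, hZ0, U, -, -, hU1, -, hUk, hUL⟩ := hZd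
  have hZ0' := ae_nonneg_of_measure_Iio hZ0
  have hUfin : IsFiniteMeasure (U.restrict (Set.Ioi 0)) :=
    isFiniteMeasure_restrict.2 (ne_top_of_le_ne_top ENNReal.ofReal_ne_top hUk)
  have hpos : ∀ᵐ t ∂U.restrict (Set.Ioi 0), 0 < t := ae_restrict_mem measurableSet_Ioi
  have hq : Measurable fun ω => Z ω / X ω := hZ.div hX
  have := Measure.isProbabilityMeasure_map (μ := P) hq.aemeasurable
  refine isGGC_of_thorinKernel hk (μ := U.restrict (Set.Ioi 0)) ?_ hpos
    (integrable_log_one_add_inv hU1) hg0 hgi hgH ?_ fun s hs => ?_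
  · rw [measureReal_def, Measure.restrict_apply_univ]
    exact ENNReal.toReal_le_of_le_ofReal hk.le hUk
  · rw [Measure.map_apply hq measurableSet_Iio, measure_eq_zero_iff_ae_notMem]
    filter_upwards [ae_of_ae_map hZ.aemeasurable hZ0', hXpos] with ω h1 h2
    simpa using div_nonneg h1 h2.le
  · rw [integral_exp_div_eq hZ hX hZ0' hXpos hindep hg hg0 hgX hs.le, ← integral_complex_ofReal]
    refine integral_congr_ae (Filter.Eventually.of_forall fun y => ?_)
    have h1 : 0 < s * Real.exp (-y) := mul_pos hs (Real.exp_pos _)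
    simp only [← Complex.ofReal_sub]
    rw [thorinKernel_ofReal hpos, hUL _ h1.le, sub_eq_add_neg, Real.exp_add, Real.exp_log hs]
    simp
end

section
/- Let a > 1 and b > 1, and set A = ab + 1/(ab) and B = a/b + b/a. Then A > B, and the function g(T) = (a − a^{-1})^{-1} · log((T + A)/(T + B)) is completely monotone on (0,∞). -/
open MeasureTheory Real

theorem hasDerivAt_log_div_add {A B T : ℝ} (hA : 0 < T + A) (hB : 0 < T + B) :
    HasDerivAt (fun T => Real.log ((T + A) / (T + B))) ((T + A)⁻¹ - (T + B)⁻¹) T := by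
  have h := (((hasDerivAt_id T).add_const A).div ((hasDerivAt_id T).add_const B) hB.ne').log
    (div_pos hA hB).ne'
  refine h.congr_deriv ?_
  simp only [id, Pi.div_apply]
  field_simp

theorem hasDerivAt_inv_pow_add {A T : ℝ} (hA : 0 < T + A) (n : ℕ) :
    HasDerivAt (fun T => ((T + A) ^ (n + 1))⁻¹) (-(n + 1) * ((T + A) ^ (n + 2))⁻¹) T := by
  have h := (((hasDerivAt_id T).add_const A).pow (n + 1)).inv (pow_pos hA (n + 1)).ne'
  refine h.congr_deriv ?_
  simp only [id, Pi.pow_apply]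
  push_cast
  field_simp
  ring

theorem iteratedDerivWithin_succ_const_mul_log_div_add (c : ℝ) {A B : ℝ} (hA : 0 < A) (hB : 0 < B)
    (n : ℕ) {T : ℝ} (hT : 0 < T) :
    iteratedDerivWithin (n + 1) (fun T => c * Real.log ((T + A) / (T + B))) (Set.Ioi 0) T =
      (-1) ^ n * n.factorial * c * (((T + A) ^ (n + 1))⁻¹ - ((T + B) ^ (n + 1))⁻¹) := by
  induction n generalizing T with
  | zero =>
    rw [zero_add, iteratedDerivWithin_one,
      ((hasDerivAt_log_div_add (by positivity) (by positivity)).const_mul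
        c).hasDerivWithinAt.derivWithin (uniqueDiffOn_Ioi 0 T hT)]
    simp
  | succ n ih =>
    rw [iteratedDerivWithin_succ,
      derivWithin_congr (fun x (hx : x ∈ Set.Ioi (0 : ℝ)) => ih hx) (ih hT),
      (((hasDerivAt_inv_pow_add (by positivity) n).fun_sub
        (hasDerivAt_inv_pow_add (by positivity) n)).const_mul
        _).hasDerivWithinAt.derivWithin (uniqueDiffOn_Ioi 0 T hT), Nat.factorial_succ]
    push_cast
    ring

/-- `c * log ((T + A) / (T + B))` is completely monotone when `0 ≤ c` and `0 < B ≤ A`. -/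
theorem completelyMonotoneOn_const_mul_log_div_add {c A B : ℝ} (hc : 0 ≤ c) (hB : 0 < B)
    (hBA : B ≤ A) :
    CompletelyMonotoneOn (fun T => c * Real.log ((T + A) / (T + B))) := by
  have hA : 0 < A := hB.trans_le hBA
  refine ⟨?_, fun n T hT => ?_⟩
  · have hne : ∀ {C : ℝ}, 0 < C → ∀ T ∈ Set.Ioi (0 : ℝ), T + C ≠ 0 :=
      fun hC T hT => (add_pos hT hC).ne'
    exact contDiffOn_const.mul (((contDiffOn_id.add contDiffOn_const).div
      (contDiffOn_id.add contDiffOn_const) (hne hB)).log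
      fun T hT => div_ne_zero (hne hA T hT) (hne hB T hT))
  · cases n with
    | zero =>
      have hlog : 0 ≤ Real.log ((T + A) / (T + B)) :=
        Real.log_nonneg ((one_le_div (by positivity)).2 (by linarith))
      simpa using mul_nonneg hc hlog
    | succ n =>
      rw [iteratedDerivWithin_succ_const_mul_log_div_add c hA hB n hT]
      have hle : ((T + A) ^ (n + 1))⁻¹ ≤ ((T + B) ^ (n + 1))⁻¹ := by gcongr
      have hsq : (-1 : ℝ) ^ n * (-1) ^ n = 1 := by rw [← mul_pow]; simp
      calc (0 : ℝ) ≤ n.factorial * c * (((T + B) ^ (n + 1))⁻¹ - ((T + A) ^ (n + 1))⁻¹) :=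
            mul_nonneg (by positivity) (sub_nonneg.2 hle)
        _ = ((-1) ^ n * (-1) ^ n) *
            (n.factorial * c * (((T + B) ^ (n + 1))⁻¹ - ((T + A) ^ (n + 1))⁻¹)) := by
          rw [hsq, one_mul]
        _ = _ := by ring

theorem J_one_CM (a b : ℝ) (ha : 1 < a) (hb : 1 < b)
    (A B : ℝ) (hA : A = a * b + 1 / (a * b)) (hB : B = a / b + b / a) :
    A > B ∧
    CompletelyMonotoneOn (fun T => (a - a⁻¹)⁻¹ * Real.log ((T + A) / (T + B))) := by
  have ha0 : 0 < a := by linarith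
  have hb0 : 0 < b := by linarith
  have hAB : B < A := by
    have hdiff : A - B = (a ^ 2 - 1) * (b ^ 2 - 1) / (a * b) := by
      rw [hA, hB]
      field_simp
      ring
    have hpos : 0 < (a ^ 2 - 1) * (b ^ 2 - 1) / (a * b) :=
      div_pos (mul_pos (by nlinarith) (by nlinarith)) (by positivity)
    linarith
  have hB0 : 0 < B := by rw [hB]; positivity
  have hc : 0 ≤ (a - a⁻¹)⁻¹ :=
    inv_nonneg.2 (sub_nonneg.2 ((inv_le_one_of_one_le₀ ha.le).trans ha.le))
  exact ⟨hAB, completelyMonotoneOn_const_mul_log_div_add hc hB0 hAB.le⟩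
end

section
/- Let k > 0, a > 1, b > 1 and t > 0, and set T = t + 1/t, α = a + 1/a, β = b + 1/b, A = ab + 1/(ab), B = a/b + b/a. Then ∫_{1/b}^{b} ((b − v)(v − 1/b)/((v + ta)(v + t/a)))^k · t^k/((b − v)(v − 1/b)) dv = ∫_{0}^{∞} ((b − 1/b)^2/((δ + 1/δ)·√((T + A)(T + B)) + 2T + αβ))^k · (b − 1/b)^{-1} · dδ/δ. -/
open MeasureTheory Real

/-- The substitution `v = (p + q r δ) / (1 + r δ)` carries `(0, ∞)` onto `(p, q)`. -/
theorem image_mobius_Ioi {p q r : ℝ} (hpq : p < q) (hr : 0 < r) :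
    (fun δ : ℝ => (p + q * (r * δ)) / (1 + r * δ)) '' Set.Ioi 0 = Set.Ioo p q := by
  ext v
  simp only [Set.mem_image, Set.mem_Ioi, Set.mem_Ioo]
  constructor
  · rintro ⟨δ, hδ, rfl⟩
    have hu : 0 < r * δ := mul_pos hr hδ
    constructor
    · rw [lt_div_iff₀ (by positivity)]
      nlinarith
    · rw [div_lt_iff₀ (by positivity)]
      nlinarith
  · rintro ⟨h1, h2⟩
    have h3 : 0 < v - p := sub_pos.2 h1
    have h4 : 0 < q - v := sub_pos.2 h2
    refine ⟨(v - p) / (q - v) / r, by positivity, ?_⟩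
    have h5 : r * ((v - p) / (q - v) / r) = (v - p) / (q - v) := by field_simp
    have h6 : 1 + (v - p) / (q - v) = (q - p) / (q - v) := by field_simp; ring
    have h7 : q - p ≠ 0 := (sub_pos.2 hpq).ne'
    rw [h5, h6]
    field_simp
    ring

theorem injOn_mobius_Ioi {p q r : ℝ} (hpq : p < q) (hr : 0 < r) :
    Set.InjOn (fun δ : ℝ => (p + q * (r * δ)) / (1 + r * δ)) (Set.Ioi 0) := by
  intro x hx y hy h
  have hx' : 0 < r * x := mul_pos hr hx
  have hy' : 0 < r * y := mul_pos hr hy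
  simp only at h
  rw [div_eq_div_iff (by positivity) (by positivity)] at h
  have h1 : ((q - p) * r) * (x - y) = 0 := by linear_combination h
  have h2 : (q - p) * r ≠ 0 := (mul_pos (sub_pos.2 hpq) hr).ne'
  exact sub_eq_zero.1 ((mul_eq_zero.1 h1).resolve_left h2)

theorem hasDerivAt_mobius {p q r x : ℝ} (h : 1 + r * x ≠ 0) :
    HasDerivAt (fun δ : ℝ => (p + q * (r * δ)) / (1 + r * δ))
      ((q - p) * r / (1 + r * x) ^ 2) x := by
  have h1 : HasDerivAt (fun δ : ℝ => r * δ) r x := by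
    simpa using (hasDerivAt_id x).const_mul r
  refine (((h1.const_mul q).const_add p).fun_div (h1.const_add 1) h).congr_deriv ?_
  congr 1
  ring

theorem J_k_eval (k a b t : ℝ) (hk : 0 < k) (ha : 1 < a) (hb : 1 < b) (ht : 0 < t)
    (T α β A B : ℝ) (hT : T = t + 1 / t) (hα : α = a + 1 / a) (hβ : β = b + 1 / b)
    (hA : A = a * b + 1 / (a * b)) (hB : B = a / b + b / a) :
    (∫⁻ v in Set.Ioo (1 / b) b,
        ENNReal.ofReal
          (((b - v) * (v - 1 / b) / ((v + t * a) * (v + t / a))) ^ k *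
            (t ^ k / ((b - v) * (v - 1 / b))))) =
      ∫⁻ δ in Set.Ioi (0 : ℝ),
        ENNReal.ofReal
          (((b - 1 / b) ^ 2 /
              ((δ + 1 / δ) * Real.sqrt ((T + A) * (T + B)) + 2 * T + α * β)) ^ k *
            (b - 1 / b)⁻¹ * δ⁻¹) := by
  have ha0 : 0 < a := by linarith
  have hb0 : 0 < b := by linarith
  have hpq : 1 / b < b := by
    rw [div_lt_iff₀ hb0]
    nlinarith
  have hTA : 0 < T + A := by rw [hT, hA]; positivity
  have hTB : 0 < T + B := by rw [hT, hB]; positivity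
  have hT0 : 0 < T := by rw [hT]; positivity
  have hα0 : 0 < α := by rw [hα]; positivity
  have hβ0 : 0 < β := by rw [hβ]; positivity
  set S := Real.sqrt ((T + A) * (T + B)) with hS
  have hS0 : 0 < S := Real.sqrt_pos.2 (by positivity)
  have hSS : S ^ 2 = (T + A) * (T + B) := Real.sq_sqrt (by positivity)
  obtain ⟨R, hR⟩ : ∃ R, R = (b + t * a) * (b + t / a) := ⟨_, rfl⟩
  have hR0 : 0 < R := by rw [hR]; positivity
  obtain ⟨r, hr⟩ : ∃ r, r = t * S / R := ⟨_, rfl⟩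
  have hr0 : 0 < r := by rw [hr]; positivity
  have hRr : R * r = t * S := by rw [hr]; field_simp
  have hPR : (1 / b + t * a) * (1 / b + t / a) * R = (t * S) ^ 2 := by
    rw [mul_pow, hSS, hR, hT, hA, hB]
    field_simp
    ring
  have hP : (1 / b + t * a) * (1 / b + t / a) = t * S * r := by
    apply mul_right_cancel₀ hR0.ne'
    linear_combination hPR - t * S * hRr
  have hQ : (1 / b + t * a) * (b + t / a) + (1 / b + t / a) * (b + t * a)
      = t * (2 * T + α * β) := by
    rw [hT, hα, hβ]
    field_simp
    ring
  rw [← image_mobius_Ioi hpq hr0, lintegral_image_eq_lintegral_abs_deriv_mul measurableSet_Ioi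
    (fun x hx => (hasDerivAt_mobius (by
      have : 0 < r * x := mul_pos hr0 hx
      positivity)).hasDerivWithinAt) (injOn_mobius_Ioi hpq hr0)]
  refine setLIntegral_congr_fun measurableSet_Ioi fun δ hδ => ?_
  have hδ0 : 0 < δ := hδ
  obtain ⟨p, hp⟩ : ∃ p, p = 1 / b := ⟨_, rfl⟩
  have hp0 : 0 < p := by rw [hp]; positivity
  simp only [← hp] at hpq hP hQ ⊢
  have hc : 0 < b - p := sub_pos.2 hpq
  have hu : 0 < 1 + r * δ := by positivity
  obtain ⟨v, hv⟩ : ∃ v, v = (p + b * (r * δ)) / (1 + r * δ) := ⟨_, rfl⟩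
  simp only [← hv]
  have hbv : b - v = (b - p) / (1 + r * δ) := by rw [hv]; field_simp; ring
  have hvp : v - p = (b - p) * (r * δ) / (1 + r * δ) := by rw [hv]; field_simp; ring
  have hv0 : 0 < v := by rw [hv]; positivity
  have hY : (b - v) * (v - p) = (b - p) ^ 2 * (r * δ) / (1 + r * δ) ^ 2 := by
    rw [hbv, hvp]; field_simp
  have hD : (v + t * a) * (v + t / a)
      = t * (r * δ) * ((δ + 1 / δ) * S + 2 * T + α * β) / (1 + r * δ) ^ 2 := by
    have e1 : v + t * a = (p + t * a + (b + t * a) * (r * δ)) / (1 + r * δ) := by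
      rw [hv, eq_div_iff hu.ne', add_mul, div_mul_cancel₀ _ hu.ne']; ring
    have e2 : v + t / a = (p + t / a + (b + t / a) * (r * δ)) / (1 + r * δ) := by
      rw [hv, eq_div_iff hu.ne', add_mul, div_mul_cancel₀ _ hu.ne']; ring
    rw [e1, e2, div_mul_div_comm, ← sq]
    congr 1
    have e3 : δ * (1 / δ) = 1 := by field_simp
    linear_combination hP + r * δ * hQ - (r * δ) ^ 2 * hR + r * δ ^ 2 * hRr - t * r * S * e3
  have hX : (b - v) * (v - p) / ((v + t * a) * (v + t / a)) * t
      = (b - p) ^ 2 / ((δ + 1 / δ) * S + 2 * T + α * β) := by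
    have : 0 < (δ + 1 / δ) * S + 2 * T + α * β := by positivity
    rw [hY, hD]
    generalize (δ + 1 / δ) * S + 2 * T + α * β = D at *
    field_simp
  have hXnn : 0 ≤ (b - v) * (v - p) / ((v + t * a) * (v + t / a)) := by
    rw [hY]; positivity
  rw [← ENNReal.ofReal_mul (abs_nonneg _), abs_of_pos (by positivity), ← hX,
    Real.mul_rpow hXnn ht.le]
  congr 1
  have hJ : (b - p) * r / (1 + r * δ) ^ 2 / ((b - v) * (v - p)) = (b - p)⁻¹ * δ⁻¹ := by
    rw [hY]; field_simp
  rw [mul_assoc _ (b - p)⁻¹, ← hJ]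
  ring
end

section
/- Let k > 0, b > 1, δ > 0, and let A ≥ 0, B ≥ 0, α ≥ 0, β ≥ 0. Then the function T ↦ ((b − 1/b)^2/((δ + 1/δ)·√((T + A)(T + B)) + 2T + αβ))^k is completely monotone on (0,∞); consequently, for a > 1, with α = a + 1/a, β = b + 1/b, A = ab + 1/(ab), B = a/b + b/a, the function T ↦ ∫_{0}^{∞} ((b − 1/b)^2/((δ + 1/δ)·√((T + A)(T + B)) + 2T + αβ))^k · (b − 1/b)^{-1} · dδ/δ is completely monotone on (0,∞). -/
open MeasureTheory Real

/-- `g` is nonnegative on `(0, ∞)`, and so are the derivatives `(-1) ^ m * g ^ (m)` for `m ≤ n`. -/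
def CompletelyMonotoneUpTo : ℕ → (ℝ → ℝ) → Prop
  | 0, g => ∀ T, 0 < T → 0 ≤ g T
  | n + 1, g => (∀ T, 0 < T → 0 ≤ g T) ∧
      ∃ g' : ℝ → ℝ, (∀ T, 0 < T → HasDerivAt g (-g' T) T) ∧ CompletelyMonotoneUpTo n g'

namespace CompletelyMonotoneUpTo

variable {n : ℕ} {f g : ℝ → ℝ}

lemma nonneg (h : CompletelyMonotoneUpTo n g) {T : ℝ} (hT : 0 < T) : 0 ≤ g T := by
  cases n with
  | zero => exact h T hT
  | succ n => exact h.1 T hT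

lemma congr (h : CompletelyMonotoneUpTo n f) (hfg : ∀ T, 0 < T → f T = g T) :
    CompletelyMonotoneUpTo n g := by
  have h0 : ∀ T, 0 < T → 0 ≤ g T := fun T hT => hfg T hT ▸ h.nonneg hT
  cases n with
  | zero => exact h0
  | succ n =>
    obtain ⟨-, f', hf', hn⟩ := h
    refine ⟨h0, f', fun T hT => (hf' T hT).congr_of_eventuallyEq ?_, hn⟩
    filter_upwards [Ioi_mem_nhds hT] with x hx using (hfg x hx).symm

lemma of_succ (h : CompletelyMonotoneUpTo (n + 1) g) : CompletelyMonotoneUpTo n g := by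
  induction n generalizing g with
  | zero => exact h.1
  | succ n ih =>
    obtain ⟨h0, g', hg', hn⟩ := h
    exact ⟨h0, g', hg', ih hn⟩

lemma differentiableAt (h : CompletelyMonotoneUpTo (n + 1) g) {T : ℝ} (hT : 0 < T) :
    DifferentiableAt ℝ g T := by
  obtain ⟨-, g', hg', -⟩ := h
  exact (hg' T hT).differentiableAt

lemma neg_deriv (h : CompletelyMonotoneUpTo (n + 1) g) :
    CompletelyMonotoneUpTo n (fun T => -deriv g T) := by
  obtain ⟨-, g', hg', hn⟩ := h
  exact hn.congr fun T hT => by rw [(hg' T hT).deriv, neg_neg]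

lemma antitoneOn (h : CompletelyMonotoneUpTo 1 g) : AntitoneOn g (Set.Ioi 0) := by
  refine antitoneOn_of_deriv_nonpos (convex_Ioi 0)
    (fun T hT => (h.differentiableAt hT).continuousAt.continuousWithinAt)
    (fun T hT => (h.differentiableAt (by simpa using hT)).differentiableWithinAt) fun T hT => ?_
  have := h.neg_deriv.nonneg (T := T) (by simpa using hT)
  linarith

lemma contDiffOn (h : CompletelyMonotoneUpTo (n + 1) g) : ContDiffOn ℝ n g (Set.Ioi 0) := by
  induction n generalizing g with
  | zero =>
    exact contDiffOn_zero.2 fun T hT => (h.differentiableAt hT).continuousAt.continuousWithinAt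
  | succ n ih =>
    push_cast
    rw [contDiffOn_succ_iff_deriv_of_isOpen isOpen_Ioi]
    refine ⟨fun T hT => (h.differentiableAt hT).differentiableWithinAt, by simp, ?_⟩
    simpa using (ih h.neg_deriv).neg

lemma iteratedDerivWithin_nonneg (h : CompletelyMonotoneUpTo n g) {T : ℝ} (hT : 0 < T) :
    0 ≤ (-1 : ℝ) ^ n * iteratedDerivWithin n g (Set.Ioi 0) T := by
  induction n generalizing g with
  | zero => simpa using h.nonneg hT
  | succ n ih =>
    have key := ih h.neg_deriv
    rw [iteratedDerivWithin_fun_neg] at key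
    rw [iteratedDerivWithin_succ', iteratedDerivWithin_congr (g := deriv g)
      (fun x hx => derivWithin_of_isOpen isOpen_Ioi hx) hT, pow_succ]
    linarith

lemma completelyMonotoneOn (h : ∀ n, CompletelyMonotoneUpTo n g) : CompletelyMonotoneOn g :=
  ⟨contDiffOn_infty.2 fun n => (h (n + 1)).contDiffOn,
    fun n _ hT => (h n).iteratedDerivWithin_nonneg hT⟩

lemma const {c : ℝ} (hc : 0 ≤ c) : CompletelyMonotoneUpTo n (fun _ => c) := by
  induction n generalizing c with
  | zero => exact fun _ _ => hc
  | succ n ih =>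
    exact ⟨fun _ _ => hc, fun _ => 0, fun T _ => by simpa using hasDerivAt_const T c, ih le_rfl⟩

lemma add (hf : CompletelyMonotoneUpTo n f) (hg : CompletelyMonotoneUpTo n g) :
    CompletelyMonotoneUpTo n (fun T => f T + g T) := by
  have h0 : ∀ T, 0 < T → 0 ≤ f T + g T := fun T hT => add_nonneg (hf.nonneg hT) (hg.nonneg hT)
  induction n generalizing f g with
  | zero => exact h0
  | succ n ih =>
    obtain ⟨-, f', hf', hfn⟩ := hf
    obtain ⟨-, g', hg', hgn⟩ := hg
    refine ⟨h0, fun T => f' T + g' T, fun T hT => ?_,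
      ih hfn hgn fun T hT => add_nonneg (hfn.nonneg hT) (hgn.nonneg hT)⟩
    exact ((hf' T hT).add (hg' T hT)).congr_deriv (by ring)

lemma mul (hf : CompletelyMonotoneUpTo n f) (hg : CompletelyMonotoneUpTo n g) :
    CompletelyMonotoneUpTo n (fun T => f T * g T) := by
  induction n generalizing f g with
  | zero => exact fun T hT => mul_nonneg (hf T hT) (hg T hT)
  | succ n ih =>
    have hf₀ := hf.of_succ
    have hg₀ := hg.of_succ
    obtain ⟨h0f, f', hf', hfn⟩ := hf
    obtain ⟨h0g, g', hg', hgn⟩ := hg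
    refine ⟨fun T hT => mul_nonneg (h0f T hT) (h0g T hT), fun T => f' T * g T + f T * g' T,
      fun T hT => ?_, (ih hfn hg₀).add (ih hf₀ hgn)⟩
    exact ((hf' T hT).mul (hg' T hT)).congr_deriv (by ring)

/-- A negative power of a positive function whose derivative is completely monotone is completely
monotone. -/
lemma rpow_neg {f' : ℝ → ℝ} (hpos : ∀ T, 0 < T → 0 < f T)
    (hf : ∀ T, 0 < T → HasDerivAt f (f' T) T) (hf' : CompletelyMonotoneUpTo n f') {k : ℝ}
    (hk : 0 ≤ k) : CompletelyMonotoneUpTo n (fun T => f T ^ (-k)) := by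
  induction n generalizing k with
  | zero => exact fun T hT => rpow_nonneg (hpos T hT).le _
  | succ n ih =>
    refine ⟨fun T hT => rpow_nonneg (hpos T hT).le _,
      fun T => k * f T ^ (-(k + 1)) * f' T, fun T hT => ?_,
      ((const hk).mul (ih hf'.of_succ (by linarith))).mul hf'.of_succ⟩
    refine ((hf T hT).rpow_const (p := -k) (Or.inl (hpos T hT).ne')).congr_deriv ?_
    rw [show -k - 1 = -(k + 1) by ring]
    ring

lemma add_const_rpow_neg {A k : ℝ} (hA : 0 ≤ A) (hk : 0 ≤ k) :
    CompletelyMonotoneUpTo n (fun T => (T + A) ^ (-k)) :=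
  rpow_neg (f' := fun _ => 1) (f := fun T => T + A) (fun T hT => by linarith)
    (fun T _ => (hasDerivAt_id T).add_const A) (const zero_le_one) hk

/-- An integral of completely monotone functions is completely monotone. -/
theorem integral {α : Type*} [MeasurableSpace α] {μ : Measure α} {F : ℝ → α → ℝ}
    (hF : ∀ᵐ a ∂μ, ∀ m, CompletelyMonotoneUpTo m (F · a))
    (hint : ∀ T, 0 < T → Integrable (F T) μ) :
    CompletelyMonotoneUpTo n (fun T => ∫ a, F T a ∂μ) := by
  have h0 : ∀ T, 0 < T → 0 ≤ ∫ a, F T a ∂μ := fun T hT =>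
    integral_nonneg_of_ae (hF.mono fun a ha => (ha 0).nonneg hT)
  induction n generalizing F with
  | zero => exact h0
  | succ n ih =>
    set G : ℝ → α → ℝ := fun T a => -deriv (F · a) T with hGdef
    have hG : ∀ᵐ a ∂μ, ∀ m, CompletelyMonotoneUpTo m (G · a) :=
      hF.mono fun a ha m => (ha (m + 1)).neg_deriv
    have hd : ∀ᵐ a ∂μ, ∀ T, 0 < T → HasDerivAt (F · a) (-G T a) T :=
      hF.mono fun a ha T hT => by
        simpa [hGdef] using ((ha 1).differentiableAt hT).hasDerivAt
    have hmeas : ∀ T, 0 < T → AEStronglyMeasurable (G T) μ := by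
      intro T hT
      have : AEStronglyMeasurable (fun a => -G T a) μ := by
        refine aestronglyMeasurable_of_tendsto_ae (nhdsWithin (0 : ℝ) (Set.Ioi 0))
          (f := fun t a => t⁻¹ • (F (T + |t|) a - F T a)) (fun t => ?_) ?_
        · exact ((hint _ (by positivity)).1.sub (hint T hT).1).const_smul t⁻¹
        · filter_upwards [hd] with a ha
          refine (ha T hT).tendsto_slope_zero_right.congr' ?_
          filter_upwards [self_mem_nhdsWithin] with t ht
          rw [abs_of_pos ht]
      simpa [Pi.neg_def] using this.neg
    have hbd : ∀ᵐ a ∂μ, ∀ T, 0 < T → G T a ≤ (T / 2)⁻¹ * F (T / 2) a := by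
      filter_upwards [hF, hG, hd] with a ha hGa hda T hT
      obtain ⟨c, hc, hcd⟩ := exists_hasDerivAt_eq_slope (F · a) (fun T => -G T a)
        (show T / 2 < T by linarith)
        (fun x hx => (hda x (by linarith [hx.1])).continuousAt.continuousWithinAt)
        (fun x hx => hda x (by linarith [hx.1]))
      have h1 : G T a ≤ G c a :=
        (hGa 1).antitoneOn (show 0 < c by linarith [hc.1]) hT hc.2.le
      have h2 := (ha 0).nonneg hT
      rw [eq_div_iff (by linarith)] at hcd
      rw [inv_mul_eq_div, le_div_iff₀ (by linarith)]
      nlinarith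
    have hGint : ∀ T, 0 < T → Integrable (G T) μ := by
      intro T hT
      refine ((hint (T / 2) (by linarith)).const_mul (T / 2)⁻¹).mono' (hmeas T hT) ?_
      filter_upwards [hG, hbd] with a ha hb
      rw [Real.norm_of_nonneg ((ha 0).nonneg hT)]
      exact hb T hT
    refine ⟨h0, fun T => ∫ a, G T a ∂μ, fun T hT => ?_, ih hG hGint fun T hT =>
      integral_nonneg_of_ae (hG.mono fun a ha => (ha 0).nonneg hT)⟩
    have key := (hasDerivAt_integral_of_dominated_loc_of_deriv_le (μ := μ) (F := F)
      (F' := fun T a => -G T a) (bound := G (T / 2)) (Ioi_mem_nhds (show T / 2 < T by linarith))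
      ?_ (hint T hT) (hmeas T hT).neg ?_ (hGint _ (by linarith)) ?_).2
    · rwa [integral_neg] at key
    · filter_upwards [Ioi_mem_nhds hT] with x hx using (hint x hx).1
    · filter_upwards [hG] with a ha x hx
      have hx0 : 0 < x := lt_trans (by linarith) hx
      rw [norm_neg, Real.norm_of_nonneg ((ha 0).nonneg hx0)]
      exact (ha 1).antitoneOn (show 0 < T / 2 by linarith) hx0 (le_of_lt hx)
    · filter_upwards [hd] with a ha x hx using ha x (lt_trans (by linarith) hx)

end CompletelyMonotoneUpTo

open CompletelyMonotoneUpTo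

lemma hasDerivAt_sqrt_mul_add {A B T : ℝ} (hA : 0 < T + A) (hB : 0 < T + B) :
    HasDerivAt (fun T => √((T + A) * (T + B)))
      ((2 * T + A + B) / (2 * √((T + A) * (T + B)))) T := by
  refine ((((hasDerivAt_id T).add_const A).mul ((hasDerivAt_id T).add_const B)).sqrt
    (mul_pos hA hB).ne').congr_deriv ?_
  simp only [id, Pi.mul_apply]
  ring

/-- The derivative of the geometric mean of `T + A` and `T + B` is completely monotone. -/
lemma completelyMonotoneUpTo_deriv_sqrt_mul_add {A B : ℝ} (hA : 0 ≤ A) (hB : 0 ≤ B) (n : ℕ) :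
    CompletelyMonotoneUpTo n
      (fun T => (2 * T + A + B) / (2 * √((T + A) * (T + B)))) := by
  have h0 : ∀ T, 0 < T → 0 ≤ (2 * T + A + B) / (2 * √((T + A) * (T + B))) := fun T hT => by
    positivity
  cases n with
  | zero => exact h0
  | succ n =>
    refine ⟨h0, fun T => (B - A) ^ 2 / 4 * ((T + A) ^ (-(3 / 2) : ℝ) * (T + B) ^ (-(3 / 2) : ℝ)),
      fun T hT => ?_, (const (by positivity)).mul
        ((add_const_rpow_neg hA (by norm_num)).mul (add_const_rpow_neg hB (by norm_num)))⟩
    have hTA : 0 < T + A := by linarith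
    have hTB : 0 < T + B := by linarith
    have hs : 0 < √((T + A) * (T + B)) := by positivity
    have hsq : √((T + A) * (T + B)) ^ 2 = (T + A) * (T + B) := Real.sq_sqrt (by positivity)
    have hcube : (T + A) ^ (-(3 / 2) : ℝ) * (T + B) ^ (-(3 / 2) : ℝ) =
        (√((T + A) * (T + B)) ^ 3)⁻¹ := by
      rw [← mul_rpow hTA.le hTB.le, Real.rpow_neg (by positivity), Real.sqrt_eq_rpow,
        ← Real.rpow_mul_natCast (by positivity)]
      norm_num
    have hnum : HasDerivAt (fun T : ℝ => 2 * T + A + B) 2 T := by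
      simpa using (((hasDerivAt_id T).const_mul 2).add_const A).add_const B
    refine (hnum.div ((hasDerivAt_sqrt_mul_add hTA hTB).const_mul 2) (by positivity)).congr_deriv ?_
    simp only [hcube]
    set s := √((T + A) * (T + B))
    field_simp
    rw [hsq]
    ring

lemma completelyMonotoneUpTo_div_sqrt_rpow {k c δ A B C : ℝ} (hk : 0 < k) (hc : 0 ≤ c)
    (hδ : 0 < δ) (hA : 0 ≤ A) (hB : 0 ≤ B) (hC : 0 ≤ C) (n : ℕ) :
    CompletelyMonotoneUpTo n (fun T =>
      (c / ((δ + 1 / δ) * √((T + A) * (T + B)) + 2 * T + C)) ^ k) := by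
  have hD : ∀ T, 0 < T → 0 < (δ + 1 / δ) * √((T + A) * (T + B)) + 2 * T + C := fun T hT => by
    positivity
  have hmain := rpow_neg (n := n) (k := k) hD (f' := fun T =>
    (δ + 1 / δ) * ((2 * T + A + B) / (2 * √((T + A) * (T + B)))) + 2) (fun T hT => ?_)
    (((const (by positivity)).mul (completelyMonotoneUpTo_deriv_sqrt_mul_add hA hB n)).add
      (const zero_le_two)) hk.le
  · refine ((const (rpow_nonneg hc k)).mul hmain).congr fun T hT => ?_
    rw [Real.div_rpow hc (hD T hT).le, Real.rpow_neg (hD T hT).le, div_eq_mul_inv (c ^ k)]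
  · simpa using (((hasDerivAt_sqrt_mul_add (by linarith : 0 < T + A)
      (by linarith : 0 < T + B)).const_mul (δ + 1 / δ)).add
        ((hasDerivAt_id T).const_mul 2)).add_const C

lemma integrableOn_div_add_inv_rpow {k c s C : ℝ} (hk : 0 < k) (hc : 0 ≤ c) (hs : 0 < s)
    (hC : 0 ≤ C) :
    IntegrableOn (fun δ : ℝ => (c / ((δ + 1 / δ) * s + C)) ^ k * δ⁻¹) (Set.Ioi 0) := by
  have hm : Measurable fun δ : ℝ => (c / ((δ + 1 / δ) * s + C)) ^ k * δ⁻¹ := by fun_prop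
  have hnorm : ∀ δ : ℝ, 0 < δ → ‖(c / ((δ + 1 / δ) * s + C)) ^ k * δ⁻¹‖ =
      (c / ((δ + 1 / δ) * s + C)) ^ k * δ⁻¹ := fun δ hδ =>
    Real.norm_of_nonneg (by positivity)
  rw [← Set.Ioc_union_Ioi_eq_Ioi zero_le_one, integrableOn_union]
  constructor
  · have h1 : IntegrableOn (fun δ : ℝ => (c / s) ^ k * δ ^ (k - 1)) (Set.Ioc 0 1) :=
      ((intervalIntegrable_iff_integrableOn_Ioc_of_le zero_le_one).1
        (intervalIntegral.intervalIntegrable_rpow' (by linarith))).const_mul _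
    refine h1.mono' hm.aestronglyMeasurable
      (ae_restrict_of_forall_mem measurableSet_Ioc fun δ hδ => ?_)
    have hδ0 : 0 < δ := hδ.1
    rw [hnorm δ hδ0, Real.rpow_sub_one hδ0.ne', div_eq_mul_inv (δ ^ k), ← mul_assoc,
      ← Real.mul_rpow (by positivity) hδ0.le]
    gcongr
    rw [div_mul_eq_mul_div, div_le_div_iff₀ (by positivity) hs]
    have : δ * ((δ + 1 / δ) * s + C) = s + (δ ^ 2 * s + δ * C) := by field_simp; ring
    rw [mul_assoc, this]
    gcongr
    exact le_add_of_nonneg_right (by positivity)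
  · have h1 : IntegrableOn (fun δ : ℝ => (c / s) ^ k * δ ^ (-k - 1)) (Set.Ioi 1) :=
      (integrableOn_Ioi_rpow_of_lt (by linarith) zero_lt_one).const_mul _
    refine h1.mono' hm.aestronglyMeasurable
      (ae_restrict_of_forall_mem measurableSet_Ioi fun δ hδ => ?_)
    have hδ0 : 0 < δ := lt_trans one_pos hδ
    rw [hnorm δ hδ0, Real.rpow_sub_one hδ0.ne', Real.rpow_neg hδ0.le, div_eq_mul_inv (δ ^ k)⁻¹,
      ← mul_assoc, ← Real.inv_rpow hδ0.le, ← Real.mul_rpow (by positivity) (by positivity)]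
    gcongr
    rw [div_mul_eq_mul_div, ← div_eq_mul_inv, div_div]
    gcongr
    have : (δ + 1 / δ) * s + C = δ * s + (1 / δ * s + C) := by ring
    rw [this]
    exact le_add_of_nonneg_right (by positivity)

theorem integrand_and_J_k_CM (k b : ℝ) (hk : 0 < k) (hb : 1 < b) :
    (∀ δ A B α β : ℝ, 0 < δ → 0 ≤ A → 0 ≤ B → 0 ≤ α → 0 ≤ β →
      CompletelyMonotoneOn (fun T =>
        ((b - 1 / b) ^ 2 /
            ((δ + 1 / δ) * Real.sqrt ((T + A) * (T + B)) + 2 * T + α * β)) ^ k)) ∧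
    (∀ a : ℝ, 1 < a →
      CompletelyMonotoneOn (fun T =>
        ∫ δ in Set.Ioi (0 : ℝ),
          ((b - 1 / b) ^ 2 /
              ((δ + 1 / δ) *
                  Real.sqrt ((T + (a * b + 1 / (a * b))) * (T + (a / b + b / a))) +
                2 * T + (a + 1 / a) * (b + 1 / b))) ^ k *
            (b - 1 / b)⁻¹ * δ⁻¹)) := by
  have hc : 0 ≤ (b - 1 / b) ^ 2 := sq_nonneg _
  have hb0 : 0 < b := zero_lt_one.trans hb
  have hbi : 0 ≤ (b - 1 / b)⁻¹ := by
    rw [inv_nonneg, sub_nonneg, div_le_iff₀ hb0]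
    nlinarith
  refine ⟨fun δ A B α β hδ hA hB hα hβ => completelyMonotoneOn
    (completelyMonotoneUpTo_div_sqrt_rpow hk hc hδ hA hB (mul_nonneg hα hβ)), fun a ha => ?_⟩
  have ha0 : 0 < a := zero_lt_one.trans ha
  refine completelyMonotoneOn fun n => integral
    (ae_restrict_of_forall_mem measurableSet_Ioi fun δ hδ m => ?_) fun T hT => ?_
  · exact ((completelyMonotoneUpTo_div_sqrt_rpow hk hc hδ (by positivity) (by positivity)
      (by positivity) m).mul (const hbi)).mul (const (inv_nonneg.2 (le_of_lt hδ)))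
  · refine ((integrableOn_div_add_inv_rpow hk hc
      (s := √((T + (a * b + 1 / (a * b))) * (T + (a / b + b / a)))) (by positivity)
      (C := 2 * T + (a + 1 / a) * (b + 1 / b)) (by positivity)).const_mul
        (b - 1 / b)⁻¹).congr ?_
    refine Filter.Eventually.of_forall fun δ => ?_
    simp only [add_assoc]
    ring
end
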